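/- Let N ≥ 4 and 1 ≤ k < N − 2 be integers. Let Γ ⊂ ℝ^N be a smooth compact embedded k-dimensional submanifold without boundary, and let Ω ⊂ ℝ^N be a smooth domain containing Γ. Let q ∈ C²(Ω̄) with q ≥ 0 in Ω and max_{σ∈Γ} q(σ) = 1. Set δ(x) := dist(x, Γ). Suppose p ≥ (N−k+2)/(N−k−2). Then there is no function u ∈ L^p_loc(Ω \ Γ) that is nonnegative, not almost everywhere zero, has δ^{−2}q·u ∈ L¹_loc(Ω \ Γ), and satisfies ∫ u(−Δφ − ((N−k−2)²/4)δ^{−2}q φ) dx ≥ ∫ u^p φ dx for every nonnegative φ ∈ C_c^∞(Ω \ Γ). -/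

import Mathlib

open MeasureTheory Metric Filter
open scoped Topology ENNReal NNReal RealInnerProductSpace

noncomputable section

/-- `ℝ^N` as a Euclidean space. -/
abbrev Euc (N : ℕ) : Type := EuclideanSpace ℝ (Fin N)

/-- `φ ∈ C_c^∞(Ω)`: smooth functions with compact support contained in `Ω`. -/
def IsTestFun {N : ℕ} (Ω : Set (Euc N)) (φ : Euc N → ℝ) : Prop :=
  ContDiff ℝ (⊤ : ℕ∞) φ ∧ HasCompactSupport φ ∧ tsupport φ ⊆ Ω

/-- The classical Laplacian of `φ` at `x`: the sum of the pure second partial derivatives. -/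
def lap {N : ℕ} (φ : Euc N → ℝ) (x : Euc N) : ℝ :=
  ∑ i : Fin N, iteratedFDeriv ℝ 2 φ x ![EuclideanSpace.single i 1, EuclideanSpace.single i 1]

/-- A smooth domain of `ℝ^N`: a nonempty open connected set whose boundary is, near each of
its points, the zero set of a smooth function with non-vanishing differential, the domain
being the corresponding sublevel set. -/
def IsSmoothDomain {N : ℕ} (Ω : Set (Euc N)) : Prop :=
  IsOpen Ω ∧ Ω.Nonempty ∧ IsConnected Ω ∧
    ∀ x ∈ frontier Ω, ∃ (U : Set (Euc N)) (f : Euc N → ℝ),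
      IsOpen U ∧ x ∈ U ∧ ContDiff ℝ (⊤ : ℕ∞) f ∧ (∀ y ∈ U, fderiv ℝ f y ≠ 0) ∧
      Ω ∩ U = {y ∈ U | f y < 0} ∧ frontier Ω ∩ U = {y ∈ U | f y = 0}

/-- A smooth compact embedded `k`-dimensional submanifold of `ℝ^N` without boundary:
a nonempty compact set which is locally the zero set of a smooth submersion into `ℝ^{N-k}`. -/
def IsSmoothSubmanifold (N k : ℕ) (Γ : Set (Euc N)) : Prop :=
  IsCompact Γ ∧ Γ.Nonempty ∧
    ∀ x ∈ Γ, ∃ (U : Set (Euc N)) (f : Euc N → Euc (N - k)),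
      IsOpen U ∧ x ∈ U ∧ ContDiff ℝ (⊤ : ℕ∞) f ∧
      (∀ y ∈ U, Function.Surjective ⇑(fderiv ℝ f y)) ∧
      Γ ∩ U = {y ∈ U | f y = 0}

/-- `δ(x) = dist(x, Γ)`, the distance to `Γ`. -/
def distG {N : ℕ} (Γ : Set (Euc N)) (x : Euc N) : ℝ := Metric.infDist x Γ

/-- The tube `Γ_β = {x ∈ Ω : dist(x, Γ) < β}` around `Γ` inside `Ω`. -/
def tube {N : ℕ} (Ω Γ : Set (Euc N)) (β : ℝ) : Set (Euc N) :=
  {x ∈ Ω | distG Γ x < β}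

/-! ### Two-jets: value, gradient and Laplacian calculus -/

/-- the standard basis vector -/
def eb {N : ℕ} (i : Fin N) : Euc N := EuclideanSpace.single i 1

lemma sum_inner_eb {N : ℕ} (a b : Euc N) : ∑ i, ⟪a, eb i⟫ * ⟪b, eb i⟫ = ⟪a, b⟫ := by
  have := (EuclideanSpace.basisFun (Fin N) ℝ).sum_inner_mul_inner a b
  rw [← this]
  refine Finset.sum_congr rfl fun i _ => ?_
  simp only [EuclideanSpace.basisFun_apply]
  rw [real_inner_comm b (EuclideanSpace.single i 1)]
  rfl

lemma lap_eq_sum {N : ℕ} {f : Euc N → ℝ} {x : Euc N} (hf : ContDiffAt ℝ 2 f x) :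
    lap f x = ∑ i, fderiv ℝ (fun y => fderiv ℝ f y (eb i)) x (eb i) := by
  unfold lap
  refine Finset.sum_congr rfl fun i _ => ?_
  rw [iteratedFDeriv_two_apply]
  have hd : DifferentiableAt ℝ (fderiv ℝ f) x :=
    (hf.fderiv_right (m := 1) (by norm_num)).differentiableAt (by norm_num)
  rw [fderiv_clm_apply hd (differentiableAt_const _)]
  simp [eb]

/-- `f` is `C²` at `x` with gradient `g` and Laplacian `L`. -/
def HasJ {N : ℕ} (f : Euc N → ℝ) (x : Euc N) (g : Euc N) (L : ℝ) : Prop :=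
  ContDiffAt ℝ 2 f x ∧ (∀ v, fderiv ℝ f x v = ⟪g, v⟫) ∧ lap f x = L

lemma ev_diff {N : ℕ} {F : Type*} [NormedAddCommGroup F] [NormedSpace ℝ F]
    {f : Euc N → F} {x : Euc N} (hf : ContDiffAt ℝ 2 f x) :
    ∀ᶠ y in 𝓝 x, DifferentiableAt ℝ f y := by
  have := hf.eventually (by norm_num)
  filter_upwards [this] with y hy using hy.differentiableAt (by norm_num)

lemma diff_fderiv {N : ℕ} {F : Type*} [NormedAddCommGroup F] [NormedSpace ℝ F]
    {f : Euc N → F} {x : Euc N} (hf : ContDiffAt ℝ 2 f x) (e : Euc N) :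
    DifferentiableAt ℝ (fun y => fderiv ℝ f y e) x :=
  ((hf.fderiv_right (m := 1) (by norm_num)).differentiableAt (by norm_num)).clm_apply
    (differentiableAt_const _)

lemma HasJ.mul {N : ℕ} {f f' : Euc N → ℝ} {x g g' : Euc N} {L L' : ℝ}
    (h : HasJ f x g L) (h' : HasJ f' x g' L') :
    HasJ (fun y => f y * f' y) x (f x • g' + f' x • g) (f x * L' + f' x * L + 2 * ⟪g, g'⟫) := by
  have hc : ContDiffAt ℝ 2 (fun y => f y * f' y) x := h.1.mul h'.1
  refine ⟨hc, fun v => ?_, ?_⟩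
  · rw [fderiv_fun_mul (h.1.differentiableAt (by norm_num)) (h'.1.differentiableAt (by norm_num))]
    simp [inner_add_left, inner_smul_left, h.2.1 v, h'.2.1 v]
  · rw [lap_eq_sum hc, ← h.2.2, ← h'.2.2, lap_eq_sum h.1, lap_eq_sum h'.1, ← sum_inner_eb,
      Finset.mul_sum, Finset.mul_sum, Finset.mul_sum, ← Finset.sum_add_distrib,
      ← Finset.sum_add_distrib]
    refine Finset.sum_congr rfl fun i _ => ?_
    have h1 : (fun y => fderiv ℝ (fun y => f y * f' y) y (eb i)) =ᶠ[𝓝 x]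
        fun y => f y * fderiv ℝ f' y (eb i) + f' y * fderiv ℝ f y (eb i) := by
      filter_upwards [ev_diff h.1, ev_diff h'.1] with y hy hy'
      rw [fderiv_fun_mul hy hy']; simp
    have d1 := h.1.differentiableAt (by norm_num : (2 : WithTop ℕ∞) ≠ 0)
    have d2 := h'.1.differentiableAt (by norm_num : (2 : WithTop ℕ∞) ≠ 0)
    have d3 := diff_fderiv h.1 (eb i)
    have d4 := diff_fderiv h'.1 (eb i)
    rw [h1.fderiv_eq, fderiv_fun_add (d1.fun_mul d4) (d2.fun_mul d3), fderiv_fun_mul d1 d4,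
      fderiv_fun_mul d2 d3]
    simp only [_root_.add_apply, _root_.smul_apply, smul_eq_mul,
      h.2.1, h'.2.1]
    ring

lemma HasJ.add {N : ℕ} {f f' : Euc N → ℝ} {x g g' : Euc N} {L L' : ℝ}
    (h : HasJ f x g L) (h' : HasJ f' x g' L') :
    HasJ (fun y => f y + f' y) x (g + g') (L + L') := by
  have hc : ContDiffAt ℝ 2 (fun y => f y + f' y) x := h.1.add h'.1
  refine ⟨hc, fun v => ?_, ?_⟩
  · rw [fderiv_fun_add (h.1.differentiableAt (by norm_num)) (h'.1.differentiableAt (by norm_num))]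
    simp [inner_add_left, h.2.1 v, h'.2.1 v]
  · rw [lap_eq_sum hc, ← h.2.2, ← h'.2.2, lap_eq_sum h.1, lap_eq_sum h'.1,
      ← Finset.sum_add_distrib]
    refine Finset.sum_congr rfl fun i _ => ?_
    have h1 : (fun y => fderiv ℝ (fun y => f y + f' y) y (eb i)) =ᶠ[𝓝 x]
        fun y => fderiv ℝ f y (eb i) + fderiv ℝ f' y (eb i) := by
      filter_upwards [ev_diff h.1, ev_diff h'.1] with y hy hy'
      rw [fderiv_fun_add hy hy']; simp
    rw [h1.fderiv_eq, fderiv_fun_add (diff_fderiv h.1 (eb i)) (diff_fderiv h'.1 (eb i))]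
    simp

lemma HasJ.comp {N : ℕ} {f : Euc N → ℝ} {x g : Euc N} {L : ℝ}
    (h : HasJ f x g L) {φ φ1 : ℝ → ℝ} {φ2 : ℝ} (hφ : ContDiffAt ℝ 2 φ (f x))
    (h1 : ∀ᶠ t in 𝓝 (f x), HasDerivAt φ (φ1 t) t) (h2 : HasDerivAt φ1 φ2 (f x)) :
    HasJ (fun y => φ (f y)) x (φ1 (f x) • g) (φ2 * ⟪g, g⟫ + φ1 (f x) * L) := by
  have hc : ContDiffAt ℝ 2 (fun y => φ (f y)) x := hφ.comp x h.1
  have d1 := h.1.differentiableAt (by norm_num : (2 : WithTop ℕ∞) ≠ 0)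
  have e1 : ∀ᶠ y in 𝓝 x, HasDerivAt φ (φ1 (f y)) (f y) := d1.continuousAt.eventually h1
  refine ⟨hc, fun v => ?_, ?_⟩
  · have : fderiv ℝ (fun y => φ (f y)) x = _ :=
      ((h1.self_of_nhds).comp_hasFDerivAt x d1.hasFDerivAt).fderiv
    rw [this]
    simp [inner_smul_left, h.2.1 v]
  · rw [lap_eq_sum hc, ← h.2.2, lap_eq_sum h.1, ← sum_inner_eb,
      Finset.mul_sum, Finset.mul_sum, ← Finset.sum_add_distrib]
    refine Finset.sum_congr rfl fun i _ => ?_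
    have h3 : (fun y => fderiv ℝ (fun y => φ (f y)) y (eb i)) =ᶠ[𝓝 x]
        fun y => φ1 (f y) * fderiv ℝ f y (eb i) := by
      filter_upwards [ev_diff h.1, e1] with y hy hy'
      have : fderiv ℝ (fun y => φ (f y)) y = _ :=
        (hy'.comp_hasFDerivAt y hy.hasFDerivAt).fderiv
      rw [this]; simp
    have d3 := diff_fderiv h.1 (eb i)
    have d4 := (h2.comp_hasFDerivAt x d1.hasFDerivAt)
    have d5 : DifferentiableAt ℝ (fun y => φ1 (f y)) x := d4.differentiableAt
    have d6 : fderiv ℝ (fun y => φ1 (f y)) x = φ2 • fderiv ℝ f x := d4.fderiv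
    rw [h3.fderiv_eq, fderiv_fun_mul d5 d3, d6]
    simp only [_root_.add_apply, _root_.smul_apply, smul_eq_mul,
      h.2.1]
    ring

lemma HasJ.const {N : ℕ} (c : ℝ) (x : Euc N) : HasJ (fun _ => c) x (0 : Euc N) 0 := by
  refine ⟨contDiffAt_const, fun v => by simp, ?_⟩
  rw [lap_eq_sum contDiffAt_const]; simp

lemma HasJ.const_mul {N : ℕ} {f : Euc N → ℝ} {x g : Euc N} {L : ℝ}
    (h : HasJ f x g L) (c : ℝ) : HasJ (fun y => c * f y) x (c • g) (c * L) := by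
  have := (HasJ.const c x).mul h
  simpa using this

lemma HasJ.congr {N : ℕ} {f f' : Euc N → ℝ} {x g : Euc N} {L : ℝ}
    (h : HasJ f x g L) (e : f' =ᶠ[𝓝 x] f) : HasJ f' x g L := by
  have hc := h.1.congr_of_eventuallyEq e
  refine ⟨hc, fun v => by rw [e.fderiv_eq, h.2.1], ?_⟩
  rw [lap_eq_sum hc, ← h.2.2, lap_eq_sum h.1]
  refine Finset.sum_congr rfl fun i _ => ?_
  have : (fun y => fderiv ℝ f' y (eb i)) =ᶠ[𝓝 x] fun y => fderiv ℝ f y (eb i) := by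
    filter_upwards [e.fderiv (𝕜 := ℝ)] with y hy
    rw [hy]
  rw [this.fderiv_eq]

lemma HasJ.cast {N : ℕ} {f : Euc N → ℝ} {x g g' : Euc N} {L L' : ℝ}
    (h : HasJ f x g L) (e : g = g') (e' : L = L') : HasJ f x g' L' := by
  subst e; subst e'; exact h

lemma HasJ.log {N : ℕ} {f : Euc N → ℝ} {x g : Euc N} {L : ℝ}
    (h : HasJ f x g L) (h0 : 0 < f x) :
    HasJ (fun y => Real.log (f y)) x ((f x)⁻¹ • g) (L / f x - ⟪g, g⟫ / (f x) ^ 2) := by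
  refine (h.comp (φ := Real.log) (φ1 := fun t => t⁻¹) (φ2 := -((f x) ^ 2)⁻¹)
    (Real.contDiffAt_log.2 h0.ne') ?_ (hasDerivAt_inv h0.ne')).cast rfl ?_
  · filter_upwards [lt_mem_nhds h0] with t ht using Real.hasDerivAt_log ht.ne'
  · field_simp; ring

lemma HasJ.exp {N : ℕ} {f : Euc N → ℝ} {x g : Euc N} {L : ℝ}
    (h : HasJ f x g L) :
    HasJ (fun y => Real.exp (f y)) x (Real.exp (f x) • g)
      (Real.exp (f x) * (L + ⟪g, g⟫)) := by
  refine (h.comp (φ := Real.exp) (φ1 := Real.exp) (φ2 := Real.exp (f x))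
    Real.contDiff_exp.contDiffAt ?_ (Real.hasDerivAt_exp _)).cast rfl ?_
  · exact Eventually.of_forall fun t => Real.hasDerivAt_exp t
  · ring

/-- the two-jet of the square of the norm of a map -/
lemma hasJ_normSq {N : ℕ} {h : Euc N → Euc N} {x : Euc N} (hc : ContDiffAt ℝ 2 h x) :
    HasJ (fun y => ‖h y‖ ^ 2) x ((2 : ℝ) • (ContinuousLinearMap.adjoint (fderiv ℝ h x)) (h x))
      (2 * ∑ i, ‖fderiv ℝ h x (eb i)‖ ^ 2
        + 2 * ∑ i, ⟪h x, fderiv ℝ (fun y => fderiv ℝ h y (eb i)) x (eb i)⟫) := by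
  have hcc : ContDiffAt ℝ 2 (fun y => ‖h y‖ ^ 2) x := hc.norm_sq ℝ
  have key : ∀ y, DifferentiableAt ℝ h y → ∀ v, fderiv ℝ (fun y => ‖h y‖ ^ 2) y v
      = 2 * ⟪h y, fderiv ℝ h y v⟫ := by
    intro y hy v
    rw [(hy.hasFDerivAt.norm_sq).fderiv]
    simp
  have d1 := hc.differentiableAt (by norm_num : (2 : WithTop ℕ∞) ≠ 0)
  refine ⟨hcc, fun v => ?_, ?_⟩
  · rw [key x d1, inner_smul_left, ContinuousLinearMap.adjoint_inner_left]; simp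
  · rw [lap_eq_sum hcc, Finset.mul_sum, Finset.mul_sum, ← Finset.sum_add_distrib]
    refine Finset.sum_congr rfl fun i _ => ?_
    have h3 : (fun y => fderiv ℝ (fun y => ‖h y‖ ^ 2) y (eb i)) =ᶠ[𝓝 x]
        fun y => 2 * ⟪h y, fderiv ℝ h y (eb i)⟫ := by
      filter_upwards [ev_diff hc] with y hy using key y hy _
    have d3 := diff_fderiv hc (eb i)
    rw [h3.fderiv_eq, fderiv_const_mul (d1.inner ℝ d3), _root_.smul_apply,
      fderiv_inner_apply ℝ d1 d3, real_inner_self_eq_norm_sq, smul_eq_mul]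
    ring

lemma hasJ_distSq {N : ℕ} (σ x : Euc N) :
    HasJ (fun y => ‖y - σ‖ ^ 2) x ((2 : ℝ) • (x - σ)) (2 * N) := by
  have hc : ContDiffAt ℝ 2 (fun y : Euc N => y - σ) x := by fun_prop
  have hf : ∀ y, fderiv ℝ (fun y : Euc N => y - σ) y = ContinuousLinearMap.id ℝ (Euc N) := by
    intro y
    exact ((hasFDerivAt_id y).sub_const σ).fderiv
  refine (hasJ_normSq hc).cast ?_ ?_
  · rw [hf, ← ContinuousLinearMap.one_def, ← ContinuousLinearMap.star_eq_adjoint, star_one]; simp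
  · simp only [hf]; simp [eb]

/-! ### A smooth convex truncation -/

/-- The smooth convex function `t ↦ t exp(-1/t)` on `t > 0`, extended by zero. -/
def tG (t : ℝ) : ℝ := t * expNegInvGlue t
/-- its derivative -/
def tG1 (t : ℝ) : ℝ := (1 + t⁻¹) * expNegInvGlue t
/-- its second derivative -/
def tG2 (t : ℝ) : ℝ := t⁻¹ ^ 3 * expNegInvGlue t

lemma tG_contDiff {n : ℕ∞} : ContDiff ℝ n tG := contDiff_id.mul expNegInvGlue.contDiff

lemma tG_hasDerivAt (t : ℝ) : HasDerivAt tG (tG1 t) t := by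
  have h := expNegInvGlue.hasDerivAt_polynomial_eval_inv_mul 1 t
  simp only [Polynomial.eval_one, one_mul, Polynomial.derivative_one, sub_zero, mul_one,
    Polynomial.eval_pow, Polynomial.eval_X] at h
  have h2 := (hasDerivAt_id t).mul h
  unfold tG tG1
  refine h2.congr_deriv ?_
  rcases eq_or_ne t 0 with rfl | ht
  · simp
  · simp only [id]; field_simp

lemma tG1_hasDerivAt (t : ℝ) : HasDerivAt tG1 (tG2 t) t := by
  have h := expNegInvGlue.hasDerivAt_polynomial_eval_inv_mul (1 + Polynomial.X) t
  simp only [Polynomial.eval_mul, Polynomial.eval_add, Polynomial.eval_sub,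
    Polynomial.derivative_add, Polynomial.derivative_X, Polynomial.derivative_one,
    Polynomial.eval_one, Polynomial.eval_pow, Polynomial.eval_X, Polynomial.eval_zero] at h
  unfold tG1 tG2
  refine h.congr_deriv ?_
  ring

lemma tG_of_nonpos {t : ℝ} (h : t ≤ 0) : tG t = 0 := by
  simp [tG, expNegInvGlue.zero_of_nonpos h]
lemma tG1_of_nonpos {t : ℝ} (h : t ≤ 0) : tG1 t = 0 := by
  simp [tG1, expNegInvGlue.zero_of_nonpos h]
lemma tG2_of_nonpos {t : ℝ} (h : t ≤ 0) : tG2 t = 0 := by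
  simp [tG2, expNegInvGlue.zero_of_nonpos h]
lemma tG_pos {t : ℝ} (h : 0 < t) : 0 < tG t := mul_pos h (expNegInvGlue.pos_of_pos h)
lemma tG1_pos {t : ℝ} (h : 0 < t) : 0 < tG1 t :=
  mul_pos (by positivity) (expNegInvGlue.pos_of_pos h)
lemma tG_nonneg (t : ℝ) : 0 ≤ tG t := by
  rcases le_or_gt t 0 with h | h
  · rw [tG_of_nonpos h]
  · exact (tG_pos h).le
lemma tG1_nonneg (t : ℝ) : 0 ≤ tG1 t := by
  rcases le_or_gt t 0 with h | h
  · rw [tG1_of_nonpos h]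
  · exact (tG1_pos h).le
lemma tG2_nonneg (t : ℝ) : 0 ≤ tG2 t := by
  rcases le_or_gt t 0 with h | h
  · rw [tG2_of_nonpos h]
  · exact mul_nonneg (by positivity) (expNegInvGlue.nonneg t)
lemma tG_le (t : ℝ) : tG t ≤ t * tG1 t := by
  rcases le_or_gt t 0 with h | h
  · rw [tG_of_nonpos h, tG1_of_nonpos h]; simp
  · unfold tG tG1
    have := (expNegInvGlue.pos_of_pos h).le
    gcongr
    nlinarith [inv_pos.2 h]
lemma tG_mono : Monotone tG :=
  monotone_of_hasDerivAt_nonneg tG_hasDerivAt tG1_nonneg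

lemma HasJ.tG {N : ℕ} {f : Euc N → ℝ} {x g : Euc N} {L : ℝ} (h : HasJ f x g L) :
    HasJ (fun y => _root_.tG (f y)) x (tG1 (f x) • g) (tG2 (f x) * ⟪g, g⟫ + tG1 (f x) * L) :=
  h.comp (tG_contDiff (n := 2)).contDiffAt (Eventually.of_forall tG_hasDerivAt) (tG1_hasDerivAt _)

/-- `e^{-τ}(1+τ)^{q}` is bounded. -/
lemma exp_mul_bdd (q : ℝ) : ∃ C > 0, ∀ τ : ℝ, 0 ≤ τ → Real.exp (-τ) * (1 + τ) ^ q ≤ C := by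
  have h := tendsto_rpow_mul_exp_neg_mul_atTop_nhds_zero q 1 one_pos
  have h2 : ∀ᶠ x : ℝ in atTop, x ^ q * Real.exp (-1 * x) ≤ 1 :=
    (h.eventually_le_const one_pos)
  obtain ⟨T, hT⟩ := eventually_atTop.1 h2
  have hcont : ContinuousOn (fun x : ℝ => x ^ q * Real.exp (-1 * x)) (Set.Icc 1 (max T 1)) := by
    refine ContinuousOn.mul (fun x hx => ?_) (by fun_prop)
    exact (Real.continuousAt_rpow_const x q (Or.inl (by linarith [hx.1]))).continuousWithinAt
  obtain ⟨C, hC⟩ := isCompact_Icc.bddAbove_image hcont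
  refine ⟨Real.exp 1 * max C 1, by positivity, fun τ hτ => ?_⟩
  have : (1 + τ) ^ q * Real.exp (-1 * (1 + τ)) ≤ max C 1 := by
    by_cases hc : 1 + τ ≤ max T 1
    · exact le_trans (hC ⟨1 + τ, ⟨by linarith, hc⟩, rfl⟩) (le_max_left _ _)
    · push Not at hc
      exact le_trans (hT _ ((le_max_left _ _).trans hc.le)) (le_max_right _ _)
  calc Real.exp (-τ) * (1 + τ) ^ q = Real.exp 1 * ((1 + τ) ^ q * Real.exp (-1 * (1 + τ))) := by
        rw [show -τ = 1 + -1 * (1 + τ) by ring, Real.exp_add]; ring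
    _ ≤ _ := by gcongr

/-- Comparison between `G'` and `G` used in Young's inequality. -/
lemma tG1_bound (q : ℝ) : ∃ C > 0, ∀ t : ℝ, 0 < t →
    tG t ^ (1 - q) * tG1 t ^ q ≤ C * (1 + t) ^ (1 - q) := by
  obtain ⟨C, hC, h⟩ := exp_mul_bdd (2 * q - 1)
  refine ⟨C, hC, fun t ht => ?_⟩
  have hg := expNegInvGlue.pos_of_pos ht
  have hgl : expNegInvGlue t = Real.exp (-t⁻¹) := by simp [expNegInvGlue, not_le.2 ht]
  have h1 := h t⁻¹ (by positivity)
  unfold tG tG1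
  rw [Real.mul_rpow ht.le hg.le, Real.mul_rpow (by positivity) hg.le]
  have e1 : expNegInvGlue t ^ (1 - q) * expNegInvGlue t ^ q = Real.exp (-t⁻¹) := by
    rw [← Real.rpow_add hg, ← hgl]; simp
  have e2 : (1 + t⁻¹) ^ q = (1 + t⁻¹) ^ (2 * q - 1) * (1 + t⁻¹) ^ (1 - q) := by
    rw [← Real.rpow_add (by positivity)]; congr 1; ring
  have e3 : t ^ (1 - q) * (1 + t⁻¹) ^ (1 - q) = (1 + t) ^ (1 - q) := by
    rw [← Real.mul_rpow ht.le (by positivity)]; congr 1; field_simp; ring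
  calc _ = (expNegInvGlue t ^ (1 - q) * expNegInvGlue t ^ q) * (1 + t⁻¹) ^ (2 * q - 1)
        * (t ^ (1 - q) * (1 + t⁻¹) ^ (1 - q)) := by rw [e2]; ring
    _ ≤ _ := by rw [e1, e3]; gcongr

lemma integrable_mul_test {N : ℕ} {W : Set (Euc N)} {u φ : Euc N → ℝ}
    (hu : LocallyIntegrableOn u W volume) (hφ : Continuous φ) (hc : HasCompactSupport φ)
    (hs : tsupport φ ⊆ W) : Integrable (fun x => u x * φ x) volume := by
  have h1 : IntegrableOn u (tsupport φ) volume := hu.integrableOn_compact_subset hs hc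
  have h2 : IntegrableOn (fun x => u x * φ x) (tsupport φ) volume :=
    h1.mul_continuousOn hφ.continuousOn hc
  refine (integrableOn_iff_integrable_of_support_subset ?_).1 h2
  intro x hx
  by_contra hx'
  exact hx (by simp [image_eq_zero_of_notMem_tsupport hx'])

lemma lap_cont {N : ℕ} {φ : Euc N → ℝ} (h : ContDiff ℝ (⊤ : ℕ∞) φ) : Continuous (lap φ) := by
  unfold lap
  refine continuous_finsetSum _ fun i _ => ?_
  have := h.continuous_iteratedFDeriv (m := 2) (WithTop.coe_le_coe.2 (le_top : ((2:ℕ) : ℕ∞) ≤ ⊤))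
  fun_prop

lemma lap_tsupport {N : ℕ} (φ : Euc N → ℝ) : tsupport (lap φ) ⊆ tsupport φ := by
  have : Function.support (lap φ) ⊆ Function.support (iteratedFDeriv ℝ 2 φ) := by
    intro x hx hx'
    apply hx
    simp [lap, hx']
  exact (closure_mono this).trans (tsupport_iteratedFDeriv_subset 2)

lemma smp_ball {N : ℕ} {W : Set (Euc N)} (hW : IsOpen W) {u : Euc N → ℝ}
    (hu0 : ∀ᵐ x ∂volume, x ∈ W → 0 ≤ u x) (hloc : LocallyIntegrableOn u W volume)
    (hsup : ∀ φ : Euc N → ℝ, IsTestFun W φ → (∀ x, 0 ≤ φ x) → 0 ≤ ∫ x in W, u x * (-(lap φ x)))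
    {z : Euc N} {ρ ε : ℝ} (hε : 0 < ε) (hρ : ε < ρ) (hb : closedBall z ρ ⊆ W)
    (h0 : ∀ᵐ x ∂volume, x ∈ ball z ε → u x = 0) :
    ∀ᵐ x ∂volume, x ∈ ball z ρ → u x = 0 := by
  obtain ⟨κ, hκ, hκε⟩ : ∃ κ : ℝ, 0 < κ ∧ (N : ℝ) < 2 * κ * ε ^ 2 := by
    refine ⟨((N : ℝ) + 1) / ε ^ 2, by positivity, ?_⟩
    field_simp
    nlinarith [(Nat.cast_nonneg N : (0:ℝ) ≤ N)]
  set f : Euc N → ℝ := fun x => Real.exp (-κ * ‖x - z‖ ^ 2) + -Real.exp (-κ * ρ ^ 2) with hf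
  set φ : Euc N → ℝ := fun x => tG (f x) with hφ
  have hfsm : ContDiff ℝ (⊤ : ℕ∞) f := by
    have : ContDiff ℝ (⊤ : ℕ∞) (fun x : Euc N => ‖x - z‖ ^ 2) :=
      (contDiff_id.sub contDiff_const).norm_sq ℝ
    exact ((contDiff_const.mul this).exp).add contDiff_const
  have hsm : ContDiff ℝ (⊤ : ℕ∞) φ := tG_contDiff.comp hfsm
  have hJ : ∀ x, HasJ φ x _ _ := fun x =>
    (((((hasJ_distSq z x).const_mul (-κ)).exp).add (HasJ.const (-Real.exp (-κ * ρ ^ 2)) x)).tG)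
  have hfle : ∀ x, ρ ≤ ‖x - z‖ → f x ≤ 0 := by
    intro x hx
    have : ρ ^ 2 ≤ ‖x - z‖ ^ 2 := by gcongr; linarith
    have : Real.exp (-κ * ‖x - z‖ ^ 2) ≤ Real.exp (-κ * ρ ^ 2) := by
      apply Real.exp_le_exp.2; nlinarith
    simp only [hf]; linarith
  have hfpos : ∀ x, ‖x - z‖ < ρ → 0 < f x := by
    intro x hx
    have : ‖x - z‖ ^ 2 < ρ ^ 2 := by gcongr
    have : Real.exp (-κ * ρ ^ 2) < Real.exp (-κ * ‖x - z‖ ^ 2) := by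
      apply Real.exp_lt_exp.2; nlinarith
    simp only [hf]; linarith
  have hlap0 : ∀ x, ρ ≤ ‖x - z‖ → lap φ x = 0 := by
    intro x hx
    rw [(hJ x).2.2]
    have := hfle x hx
    simp only [hf] at this
    rw [tG1_of_nonpos this, tG2_of_nonpos this]; ring
  have hlapp : ∀ x, ε ≤ ‖x - z‖ → ‖x - z‖ < ρ → 0 < lap φ x := by
    intro x hx1 hx2
    rw [(hJ x).2.2]
    have := hfpos x hx2
    simp only [hf] at this
    have h1 := tG1_pos this
    have h2 := tG2_nonneg (Real.exp (-κ * ‖x - z‖ ^ 2) + -Real.exp (-κ * ρ ^ 2))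
    refine add_pos_of_nonneg_of_pos (mul_nonneg h2 real_inner_self_nonneg) (mul_pos h1 ?_)
    rw [add_zero]
    refine mul_pos (Real.exp_pos _) ?_
    simp only [inner_smul_left, inner_smul_right, real_inner_self_eq_norm_sq, RCLike.conj_to_real]
    have : ε ^ 2 ≤ ‖x - z‖ ^ 2 := by gcongr
    have h3 : (N:ℝ) < 2 * κ * ‖x - z‖ ^ 2 := by nlinarith
    nlinarith
  have hts : tsupport φ ⊆ closedBall z ρ := by
    refine closure_minimal ?_ isClosed_closedBall
    intro x hx
    by_contra hx'
    rw [mem_closedBall, dist_eq_norm, not_le] at hx'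
    exact hx (tG_of_nonpos (hfle x hx'.le))
  have hcs : HasCompactSupport φ :=
    HasCompactSupport.intro (isCompact_closedBall z ρ) fun x hx => by
      by_contra h; exact hx (hts (subset_tsupport _ h))
  have htest : IsTestFun W φ := ⟨hsm, hcs, hts.trans hb⟩
  have hitg := hsup φ htest (fun x => tG_nonneg _)
  have hcl : HasCompactSupport (lap φ) := hcs.of_isClosed_subset (isClosed_tsupport _) (lap_tsupport φ)
  have hI : Integrable (fun x => u x * lap φ x) volume :=
    integrable_mul_test hloc (lap_cont hsm) hcl ((lap_tsupport φ).trans (hts.trans hb))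
  have hnn : 0 ≤ᵐ[volume.restrict W] fun x => u x * lap φ x := by
    rw [EventuallyLE, ae_restrict_iff' hW.measurableSet]
    filter_upwards [hu0, h0] with x hx1 hx2 hxW
    have hx1 := hx1 hxW
    show 0 ≤ u x * lap φ x
    rcases lt_or_ge ‖x - z‖ ε with h | h
    · rw [hx2 (by rwa [mem_ball, dist_eq_norm])]; simp
    · rcases lt_or_ge ‖x - z‖ ρ with h' | h'
      · exact mul_nonneg hx1 (hlapp x h h').le
      · rw [hlap0 x h']; simp
  have hz : ∫ x in W, u x * lap φ x = 0 := by
    apply le_antisymm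
    · simp only [mul_neg, integral_neg] at hitg; linarith
    · exact integral_nonneg_of_ae hnn
  rw [integral_eq_zero_iff_of_nonneg_ae hnn hI.integrableOn, EventuallyEq,
    ae_restrict_iff' hW.measurableSet] at hz
  filter_upwards [hz, h0] with x hx1 hx2 hxb
  rw [mem_ball, dist_eq_norm] at hxb
  rcases lt_or_ge ‖x - z‖ ε with h | h
  · exact hx2 (by rwa [mem_ball, dist_eq_norm])
  · have := hx1 (hb (by rw [mem_closedBall, dist_eq_norm]; exact hxb.le))
    simpa [(hlapp x h hxb).ne'] using this

/-- a normalised defining map of `Γ` near `σ` -/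
structure IsChart {N : ℕ} (Γ : Set (Euc N)) (σ : Euc N) (m : ℕ) (V : Submodule ℝ (Euc N))
    (h : Euc N → Euc N) (U : Set (Euc N)) : Prop where
  fr : Module.finrank ℝ V = m
  sm : ContDiff ℝ (⊤ : ℕ∞) h
  mem : ∀ y, h y ∈ V
  fd : fderiv ℝ h σ = V.starProjection
  op : IsOpen U
  hσ : σ ∈ U
  hΓ : Γ ∩ U = {y ∈ U | h y = 0}
  h0 : h σ = 0

lemma exists_chart {N k : ℕ} {Γ : Set (Euc N)} (hΓ : IsSmoothSubmanifold N k Γ) {σ : Euc N}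
    (hσ : σ ∈ Γ) : ∃ V h U, IsChart Γ σ (N - k) V h U := by
  obtain ⟨U, f, hU, hσU, hf, hsurj, hz⟩ := hΓ.2.2 σ hσ
  set f' := fderiv ℝ f σ with hf'
  have hs := hsurj σ hσU
  set K : Submodule ℝ (Euc N) := LinearMap.ker (f' : Euc N →ₗ[ℝ] Euc (N - k)) with hK
  set V := Kᗮ with hV
  let g : V →ₗ[ℝ] Euc (N - k) := (f' : Euc N →ₗ[ℝ] Euc (N - k)).domRestrict V
  have hproj : ∀ x, f' (V.starProjection x) = f' x := by
    intro x
    have h1 : x - V.starProjection x ∈ Vᗮ := V.sub_starProjection_mem_orthogonal x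
    have h3 : x - V.starProjection x ∈ K := (Submodule.orthogonal_orthogonal K).le h1
    have h2 : f' (x - V.starProjection x) = 0 := h3
    rw [map_sub, sub_eq_zero] at h2
    exact h2.symm
  have hinj : Function.Injective g := by
    rw [← LinearMap.ker_eq_bot, LinearMap.ker_eq_bot']
    intro v hv
    have h1 : (v : Euc N) ∈ K := hv
    have h2 : ⟪(v : Euc N), (v : Euc N)⟫ = 0 := (Submodule.mem_orthogonal K _).1 v.2 _ h1
    exact Subtype.ext (inner_self_eq_zero.1 h2)
  have hsg : Function.Surjective g := by
    intro y
    obtain ⟨x, hx⟩ := hs y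
    exact ⟨⟨V.starProjection x, V.starProjection_apply_mem x⟩, (hproj x).trans hx⟩
  let e : V ≃ₗ[ℝ] Euc (N - k) := LinearEquiv.ofBijective g ⟨hinj, hsg⟩
  let S : Euc (N - k) →L[ℝ] Euc N :=
    LinearMap.toContinuousLinearMap (V.subtype ∘ₗ (e.symm : Euc (N - k) →ₗ[ℝ] V))
  have hSa : ∀ y, S y = (e.symm y : Euc N) := fun y => rfl
  have hS0 : ∀ y, S y = 0 ↔ y = 0 := by
    intro y
    rw [hSa]; simp
  have hz0 : f σ = 0 := by
    have : σ ∈ Γ ∩ U := ⟨hσ, hσU⟩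
    rw [hz] at this; exact this.2
  refine ⟨V, fun y => S (f y), U, ?_, ?_, ?_, ?_, hU, hσU, ?_, ?_⟩
  · rw [LinearEquiv.finrank_eq e]; simp
  · exact S.contDiff.comp hf
  · intro y; rw [hSa]; exact (e.symm (f y)).2
  · have hd : DifferentiableAt ℝ f σ := hf.differentiable (by simp) σ
    have := (S.hasFDerivAt.comp σ hd.hasFDerivAt).fderiv
    rw [show (fun y => S (f y)) = S ∘ f from rfl, this]
    ext1 x
    show S (f' x) = _
    rw [← hproj x, hSa]
    have : e ⟨V.starProjection x, V.starProjection_apply_mem x⟩ = f' (V.starProjection x) := rfl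
    rw [← this, e.symm_apply_apply]
  · rw [hz]; simp only [hS0]
  · exact (hS0 _).2 hz0

/-- the straightening map -/
def chH {N : ℕ} (σ : Euc N) (V : Submodule ℝ (Euc N)) (h : Euc N → Euc N) (x : Euc N) : Euc N :=
  h x + ((x - σ) - V.starProjection (x - σ))

lemma starProj_of_mem {N : ℕ} {V : Submodule ℝ (Euc N)} {v : Euc N} (hv : v ∈ V) :
    V.starProjection v = v := Submodule.starProjection_eq_self_iff.2 hv

section
variable {N m : ℕ} {Γ U : Set (Euc N)} {σ : Euc N} {V : Submodule ℝ (Euc N)} {h : Euc N → Euc N}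

lemma IsChart.proj (hc : IsChart Γ σ m V h U) (x : Euc N) : V.starProjection (chH σ V h x) = h x := by
  have : V.starProjection (V.starProjection (x - σ)) = V.starProjection (x - σ) :=
    starProj_of_mem (V.starProjection_apply_mem _)
  rw [chH, map_add, map_sub, starProj_of_mem (hc.mem x), this]; simp

lemma IsChart.H0 (hc : IsChart Γ σ m V h U) : chH σ V h σ = 0 := by simp [chH, hc.h0]

lemma IsChart.Hsm (hc : IsChart Γ σ m V h U) : ContDiff ℝ (⊤ : ℕ∞) (chH σ V h) := by
  unfold chH
  have := hc.sm
  fun_prop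

lemma IsChart.hdiff (hc : IsChart Γ σ m V h U) : Differentiable ℝ h :=
  hc.sm.differentiable (by simp)

lemma IsChart.Hfd (hc : IsChart Γ σ m V h U) (x : Euc N) :
    HasFDerivAt (chH σ V h)
      (fderiv ℝ h x + (ContinuousLinearMap.id ℝ (Euc N) - V.starProjection)) x := by
  unfold chH
  have h1 : HasFDerivAt (fun x : Euc N => x - σ) (ContinuousLinearMap.id ℝ (Euc N)) x :=
    (hasFDerivAt_id x).sub_const σ
  have h2 := (V.starProjection).hasFDerivAt.comp x h1
  have := (hc.hdiff x).hasFDerivAt.add (h1.sub h2)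
  rw [ContinuousLinearMap.comp_id] at this
  exact this

lemma IsChart.Hstrict (hc : IsChart Γ σ m V h U) :
    HasStrictFDerivAt (chH σ V h) ((ContinuousLinearEquiv.refl ℝ (Euc N) : Euc N →L[ℝ] Euc N)) σ := by
  have h1 := (hc.Hsm.contDiffAt (x := σ)).hasStrictFDerivAt (by simp)
  rw [(hc.Hfd σ).fderiv, hc.fd] at h1
  have h2 : V.starProjection + (ContinuousLinearMap.id ℝ (Euc N) - V.starProjection)
      = (ContinuousLinearEquiv.refl ℝ (Euc N) : Euc N →L[ℝ] Euc N) := by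
    ext1 x; simp
  rwa [h2] at h1

/-- a local homeomorphism onto a ball straightening `Γ` -/
lemma IsChart.nhd (hc : IsChart Γ σ m V h U) {O : Set (Euc N)} (hO : O ∈ 𝓝 σ) :
    ∃ (H : OpenPartialHomeomorph (Euc N) (Euc N)) (r : ℝ), 0 < r ∧ σ ∈ H.source ∧ H σ = 0 ∧
      (H : Euc N → Euc N) = chH σ V h ∧ H.source ⊆ O ∩ U ∧ H.target = ball 0 r := by
  let e := hc.Hstrict.toOpenPartialHomeomorph (chH σ V h)
  have he : (e : Euc N → Euc N) = chH σ V h := hc.Hstrict.toOpenPartialHomeomorph_coe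
  have hs : σ ∈ e.source := hc.Hstrict.mem_toOpenPartialHomeomorph_source
  obtain ⟨O', hO'O, hO', hσO'⟩ := _root_.mem_nhds_iff.1 (inter_mem hO (hc.op.mem_nhds hc.hσ))
  let e1 := e.restrOpen O' hO'
  have h1 : σ ∈ e1.source := ⟨hs, hσO'⟩
  have he1 : (e1 : Euc N → Euc N) = chH σ V h := he
  have h0 : (0 : Euc N) ∈ e1.target := by
    have := e1.map_source h1
    rwa [he1, hc.H0] at this
  obtain ⟨r, hr, hrb⟩ := Metric.isOpen_iff.1 e1.open_target 0 h0
  let e2 := (e1.symm.restrOpen (ball 0 r) isOpen_ball).symm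
  refine ⟨e2, r, hr, ?_, ?_, he1, ?_, ?_⟩
  · have : e2.source = e1.source ∩ e1 ⁻¹' (ball 0 r) := by
      simp only [e2, OpenPartialHomeomorph.symm_source]
      ext x
      simp [OpenPartialHomeomorph.restrOpen, OpenPartialHomeomorph.restr, PartialEquiv.restr]
    rw [this]
    refine ⟨h1, ?_⟩
    rw [Set.mem_preimage, he1, hc.H0]; simpa using hr
  · show e1 σ = 0
    rw [he1, hc.H0]
  · intro x hx
    have : x ∈ e1.source := by
      have : e2.source = e1.source ∩ e1 ⁻¹' (ball 0 r) := by
        simp only [e2, OpenPartialHomeomorph.symm_source]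
        ext x
        simp [OpenPartialHomeomorph.restrOpen, OpenPartialHomeomorph.restr, PartialEquiv.restr]
      rw [this] at hx; exact hx.1
    exact hO'O this.2
  · show e1.target ∩ ball 0 r = _
    exact Set.inter_eq_right.2 hrb

end

lemma preconn_diff {X : Type*} [TopologicalSpace X] {Ω Γ : Set X} (hΩ : IsOpen Ω)
    (hΩc : IsPreconnected Ω) (hΓ : IsClosed Γ)
    (hloc : ∀ x ∈ Γ, x ∈ Ω → ∃ O, IsOpen O ∧ x ∈ O ∧ O ⊆ Ω ∧ IsPreconnected (O \ Γ))
    (hd : ∀ O, IsOpen O → O.Nonempty → (O \ Γ).Nonempty) : IsPreconnected (Ω \ Γ) := by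
  rw [isPreconnected_iff_subset_of_disjoint]
  intro u v hu hv huv hdis
  let A : Set X → Set X := fun w => {x | ∃ O, IsOpen O ∧ x ∈ O ∧ O ⊆ Ω ∧ O \ Γ ⊆ w}
  have hAo : ∀ w, IsOpen (A w) := by
    intro w
    rw [isOpen_iff_forall_mem_open]
    rintro x ⟨O, h1, h2, h3, h4⟩
    exact ⟨O, fun y hy => ⟨O, h1, hy, h3, h4⟩, h1, h2⟩
  have hcov : Ω ⊆ A u ∪ A v := by
    intro x hx
    by_cases hxΓ : x ∈ Γ
    · obtain ⟨O, h1, h2, h3, h4⟩ := hloc x hxΓ hx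
      have hsub : O \ Γ ⊆ Ω \ Γ := Set.sdiff_subset_sdiff_left h3
      rcases isPreconnected_iff_subset_of_disjoint.1 h4 u v hu hv (hsub.trans huv)
        (Set.subset_empty_iff.1 (hdis ▸ Set.inter_subset_inter_left _ hsub)) with h | h
      · exact Or.inl ⟨O, h1, h2, h3, h⟩
      · exact Or.inr ⟨O, h1, h2, h3, h⟩
    · have hW : IsOpen (Ω \ Γ) := hΩ.sdiff hΓ
      rcases huv ⟨hx, hxΓ⟩ with h | h
      · exact Or.inl ⟨(Ω \ Γ) ∩ u, hW.inter hu, ⟨⟨hx, hxΓ⟩, h⟩, fun y hy => hy.1.1, fun y hy => hy.1.2⟩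
      · exact Or.inr ⟨(Ω \ Γ) ∩ v, hW.inter hv, ⟨⟨hx, hxΓ⟩, h⟩, fun y hy => hy.1.1, fun y hy => hy.1.2⟩
  have hdisj : Ω ∩ (A u ∩ A v) = ∅ := by
    rw [Set.eq_empty_iff_forall_notMem]
    rintro x ⟨hx, ⟨O, h1, h2, h3, h4⟩, ⟨O', h1', h2', h3', h4'⟩⟩
    obtain ⟨y, hy⟩ := hd (O ∩ O') (h1.inter h1') ⟨x, h2, h2'⟩
    have : y ∈ (Ω \ Γ) ∩ (u ∩ v) :=
      ⟨⟨h3 hy.1.1, hy.2⟩, h4 ⟨hy.1.1, hy.2⟩, h4' ⟨hy.1.2, hy.2⟩⟩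
    rw [hdis] at this; exact this
  rcases isPreconnected_iff_subset_of_disjoint.1 hΩc _ _ (hAo u) (hAo v) hcov hdisj with h | h
  · left
    intro x hx
    obtain ⟨O, h1, h2, h3, h4⟩ := h hx.1
    exact h4 ⟨h2, hx.2⟩
  · right
    intro x hx
    obtain ⟨O, h1, h2, h3, h4⟩ := h hx.1
    exact h4 ⟨h2, hx.2⟩

lemma smp_global {N : ℕ} {W : Set (Euc N)} (hW : IsOpen W) (hWc : IsPreconnected W) {u : Euc N → ℝ}
    (hu0 : ∀ᵐ x ∂volume, x ∈ W → 0 ≤ u x) (hloc : LocallyIntegrableOn u W volume)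
    (hsup : ∀ φ : Euc N → ℝ, IsTestFun W φ → (∀ x, 0 ≤ φ x) → 0 ≤ ∫ x in W, u x * (-(lap φ x)))
    {O : Set (Euc N)} (hO : IsOpen O) (hne : (W ∩ O).Nonempty)
    (h0 : ∀ᵐ x ∂volume, x ∈ O → u x = 0) :
    ∀ᵐ x ∂volume, x ∈ W → u x = 0 := by
  let Z : Set (Euc N) := {x | ∃ O, IsOpen O ∧ x ∈ O ∧ ∀ᵐ y ∂volume, y ∈ O → u y = 0}
  have hZ : IsOpen Z := by
    rw [isOpen_iff_forall_mem_open]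
    rintro x ⟨O, h1, h2, h3⟩
    exact ⟨O, fun y hy => ⟨O, h1, hy, h3⟩, h1, h2⟩
  have hWZ : W ⊆ Z := by
    refine hWc.subset_of_closure_inter_subset hZ ?_ ?_
    · obtain ⟨x, hx⟩ := hne
      exact ⟨x, hx.1, O, hO, hx.2, h0⟩
    · rintro x ⟨hxc, hxW⟩
      obtain ⟨ρ, hρ, hρW⟩ := Metric.isOpen_iff.1 hW x hxW
      obtain ⟨z, hzZ, hz⟩ := Metric.mem_closure_iff.1 hxc (ρ / 8) (by positivity)
      obtain ⟨O', h1, h2, h3⟩ := hzZ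
      obtain ⟨ε, hε, hεO⟩ := Metric.isOpen_iff.1 h1 z h2
      have hb : closedBall z (ρ / 2) ⊆ W := by
        intro y hy
        apply hρW
        rw [mem_closedBall] at hy
        rw [mem_ball]
        have := dist_triangle y z x
        rw [dist_comm] at hz
        linarith
      have hmin : min ε (ρ / 4) < ρ / 2 := lt_of_le_of_lt (min_le_right _ _) (by linarith)
      have key := smp_ball hW hu0 hloc hsup (z := z) (ρ := ρ / 2) (ε := min ε (ρ / 4))
        (lt_min hε (by positivity)) hmin hb (by
          filter_upwards [h3] with y hy hyb
          exact hy (hεO (ball_subset_ball (min_le_left _ _) hyb)))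
      exact ⟨ball z (ρ / 2), isOpen_ball, by rw [mem_ball]; linarith, key⟩
  rw [ae_iff]
  have : {a | ¬(a ∈ W → u a = 0)} = {a | a ∈ W ∧ u a ≠ 0} := by ext; simp
  rw [this]
  refine measure_null_of_locally_null _ fun x hx => ?_
  obtain ⟨O', h1, h2, h3⟩ := hWZ hx.1
  refine ⟨{a | a ∈ W ∧ u a ≠ 0} ∩ O', inter_mem self_mem_nhdsWithin
    (mem_nhdsWithin_of_mem_nhds (h1.mem_nhds h2)), ?_⟩
  rw [ae_iff] at h3
  refine measure_mono_null ?_ h3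
  rintro y ⟨⟨_, hy⟩, hyO⟩
  simpa using ⟨hyO, hy⟩

lemma ball_diff_conn {N : ℕ} {V : Submodule ℝ (Euc N)} (hV : 2 ≤ Module.finrank ℝ V) {r : ℝ}
    (hr : 0 < r) : IsPreconnected (ball (0 : Euc N) r \ (Vᗮ : Submodule ℝ (Euc N))) := by
  have h1 : IsPreconnected ((Vᗮ : Submodule ℝ (Euc N)) : Set (Euc N))ᶜ := by
    refine (isConnected_compl_of_one_lt_codim ?_).2
    rw [← Module.finrank_eq_rank]
    have h2 := Submodule.finrank_quotient_add_finrank (Vᗮ)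
    have h3 := V.finrank_add_finrank_orthogonal
    have : 1 < Module.finrank ℝ (Euc N ⧸ Vᗮ) := by omega
    exact_mod_cast this
  let T : Euc N → Euc N := fun z => (r / (1 + ‖z‖)) • z
  have hT : Continuous T := by
    have h2 : Continuous (fun z : Euc N => r / (1 + ‖z‖)) :=
      continuous_const.div (continuous_const.add continuous_norm) fun z => by positivity
    exact h2.smul continuous_id
  convert h1.image T hT.continuousOn using 1
  ext w
  constructor
  · rintro ⟨hw, hwV⟩
    rw [mem_ball_zero_iff] at hw
    have hrw : 0 < r - ‖w‖ := by linarith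
    refine ⟨(r - ‖w‖)⁻¹ • w, ?_, ?_⟩
    · intro hmem
      apply hwV
      have := (Vᗮ).smul_mem (r - ‖w‖) hmem
      rwa [smul_smul, mul_inv_cancel₀ hrw.ne', one_smul] at this
    · simp only [T, norm_smul, smul_smul, norm_inv, Real.norm_of_nonneg hrw.le]
      have : r / (1 + (r - ‖w‖)⁻¹ * ‖w‖) * (r - ‖w‖)⁻¹ = 1 := by
        have : r - ‖w‖ + ‖w‖ ≠ 0 := by linarith
        field_simp
        ring
      rw [this, one_smul]
  · rintro ⟨z, hz, rfl⟩
    have h1z : 0 < 1 + ‖z‖ := by positivity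
    refine ⟨?_, ?_⟩
    · rw [mem_ball_zero_iff]
      simp only [T, norm_smul, norm_div, Real.norm_of_nonneg h1z.le, Real.norm_of_nonneg hr.le]
      rw [div_mul_eq_mul_div, div_lt_iff₀ h1z]
      nlinarith [norm_nonneg z]
    · intro hmem
      apply hz
      have := (Vᗮ).smul_mem ((1 + ‖z‖) / r) hmem
      simp only [T, smul_smul] at this
      rwa [div_mul_div_comm, mul_comm, div_self (by positivity), one_smul] at this

lemma mem_orth_iff {N : ℕ} {V : Submodule ℝ (Euc N)} (x : Euc N) :
    x ∈ Vᗮ ↔ V.starProjection x = 0 := V.starProjection_apply_eq_zero_iff.symm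

lemma IsChart.conn {N m : ℕ} {Γ U : Set (Euc N)} {σ : Euc N} {V : Submodule ℝ (Euc N)}
    {h : Euc N → Euc N} (hc : IsChart Γ σ m V h U) (hm : 2 ≤ m) {O : Set (Euc N)} (hO : O ∈ 𝓝 σ) :
    ∃ O', IsOpen O' ∧ σ ∈ O' ∧ O' ⊆ O ∧ IsPreconnected (O' \ Γ) ∧ (O' \ Γ).Nonempty := by
  obtain ⟨H, r, hr, hσ, hH0, hH, hsub, ht⟩ := hc.nhd hO
  have him : H.source \ Γ = H.symm '' (ball (0 : Euc N) r \ (Vᗮ : Submodule ℝ (Euc N))) := by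
    have hiff : ∀ x ∈ H.source, (x ∉ Γ ↔ H x ∉ (Vᗮ : Submodule ℝ (Euc N))) := by
      intro x hx
      rw [hH, mem_orth_iff, hc.proj]
      have h1 : x ∈ Γ ∩ U ↔ x ∈ {y ∈ U | h y = 0} := by rw [hc.hΓ]
      have h2 := (hsub hx).2
      simp only [Set.mem_inter_iff, h2, and_true, Set.mem_ofPred_eq, true_and] at h1
      rw [h1]
    rw [← ht]
    ext x
    constructor
    · rintro ⟨hx, hxΓ⟩
      exact ⟨H x, ⟨H.map_source hx, (hiff x hx).1 hxΓ⟩, H.left_inv hx⟩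
    · rintro ⟨w, ⟨hw, hwV⟩, rfl⟩
      have := H.map_target hw
      refine ⟨this, (hiff _ this).2 ?_⟩
      rwa [H.right_inv hw]
  refine ⟨H.source, H.open_source, hσ, fun x hx => (hsub hx).1, ?_, ?_⟩
  · rw [him]
    refine (ball_diff_conn (hc.fr ▸ hm) hr).image _ ?_
    exact H.continuousOn_symm.mono (fun x hx => by rw [ht]; exact hx.1)
  · rw [him]
    refine Set.Nonempty.image _ ?_
    have : Nontrivial V := Module.nontrivial_of_finrank_pos (R := ℝ) (by rw [hc.fr]; omega)
    obtain ⟨v, hv⟩ := exists_ne (0 : V)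
    have hv0 : (v : Euc N) ≠ 0 := by simpa using hv
    have hvn : 0 < ‖(v : Euc N)‖ := norm_pos_iff.2 hv0
    have hs : 0 < r / (2 * ‖(v : Euc N)‖) := by positivity
    refine ⟨(r / (2 * ‖(v : Euc N)‖)) • (v : Euc N), ?_, ?_⟩
    · rw [mem_ball_zero_iff, norm_smul, Real.norm_of_nonneg hs.le]
      field_simp; linarith
    · intro hmem
      rw [SetLike.mem_coe, mem_orth_iff, map_smul, starProj_of_mem v.2] at hmem
      rcases smul_eq_zero.1 hmem with h | h
      · exact hs.ne' h
      · exact hv0 h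

lemma conn_diff {N k : ℕ} (hk2 : k + 2 < N) {Γ Ω : Set (Euc N)} (hΓ : IsSmoothSubmanifold N k Γ)
    (hΩ : IsOpen Ω) (hΩc : IsPreconnected Ω) : IsPreconnected (Ω \ Γ) := by
  refine preconn_diff hΩ hΩc hΓ.1.isClosed ?_ ?_
  · intro x hx hxΩ
    obtain ⟨V, h, U, hc⟩ := exists_chart hΓ hx
    obtain ⟨O, h1, h2, h3, h4, _⟩ := hc.conn (by omega) (hΩ.mem_nhds hxΩ)
    exact ⟨O, h1, h2, h3, h4⟩
  · rintro O hO ⟨x, hx⟩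
    by_cases hxΓ : x ∈ Γ
    · obtain ⟨V, h, U, hc⟩ := exists_chart hΓ hxΓ
      obtain ⟨O', h1, h2, h3, _, h4⟩ := hc.conn (by omega) (hO.mem_nhds hx)
      exact h4.mono (Set.sdiff_subset_sdiff_left h3)
    · exact ⟨x, hx, hxΓ⟩

/-- quantitative chart estimates on `ball σ r` -/
structure ChartEst {N : ℕ} (Γ : Set (Euc N)) (σ : Euc N) (V : Submodule ℝ (Euc N))
    (h : Euc N → Euc N) (U : Set (Euc N)) (C r : ℝ) : Prop where
  C1 : 1 ≤ C
  r0 : 0 < r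
  sub : ball σ r ⊆ U
  dh : ∀ x ∈ ball σ r, ‖fderiv ℝ h x - V.starProjection‖ ≤ C * ‖x - σ‖
  hh : ∀ x ∈ ball σ r, ‖h x‖ ≤ C * ‖x - σ‖
  h2 : ∀ x ∈ ball σ r, ‖h x - fderiv ℝ h x (x - σ)‖ ≤ C * ‖x - σ‖ ^ 2
  d2 : ∀ x ∈ ball σ r, ∀ i, ‖fderiv ℝ (fun y => fderiv ℝ h y (eb i)) x (eb i)‖ ≤ C
  dist : ∀ x ∈ ball σ r, infDist x Γ ≤ ‖h x‖ * (1 + C * ‖x - σ‖)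
  bi : ∀ x ∈ ball σ r, ∀ y ∈ ball σ r, ‖chH σ V h x - chH σ V h y - (x - y)‖ ≤ 2⁻¹ * ‖x - y‖
  det : ∀ x ∈ ball σ r, 2⁻¹ ≤ |(fderiv ℝ (chH σ V h) x).det|

set_option maxHeartbeats 1000000 in
lemma IsChart.est {N m : ℕ} {Γ U : Set (Euc N)} {σ : Euc N} {V : Submodule ℝ (Euc N)}
    {h : Euc N → Euc N} (hc : IsChart Γ σ m V h U) :
    ∃ C r, ChartEst Γ σ V h U C r := by
  have hd2 : ContDiff ℝ (⊤ : ℕ∞) (fderiv ℝ h) :=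
    hc.sm.fderiv_right (m := (⊤ : ℕ∞)) (by simp)
  obtain ⟨K, t, ht, hK⟩ := (hd2.contDiffAt (x := σ)).of_le (n := (⊤ : ℕ∞)) (m := 1) (by simp)
    |>.exists_lipschitzOnWith
  obtain ⟨r0, hr0, hr0t⟩ := Metric.mem_nhds_iff.1 (inter_mem ht (hc.op.mem_nhds hc.hσ))
  have hP : ‖V.starProjection‖ ≤ 1 := V.starProjection_norm_le
  set C0 : ℝ := (K : ℝ) + 1 with hC0
  have hC0p : 1 ≤ C0 := by rw [hC0]; linarith [K.2]
  have e1 : ∀ x ∈ ball σ r0, ‖fderiv ℝ h x - V.starProjection‖ ≤ C0 * ‖x - σ‖ := by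
    intro x hx
    have := hK.norm_sub_le (hr0t hx).1 (hr0t (mem_ball_self hr0)).1
    rw [hc.fd] at this
    refine this.trans ?_
    gcongr
    rw [hC0]; linarith
  -- mean value inequality
  have mv : ∀ ρ ≤ r0, ∀ x ∈ ball σ ρ, ∀ y ∈ ball σ ρ,
      ‖h x - h y - V.starProjection (x - y)‖ ≤ C0 * ρ * ‖x - y‖ := by
    intro ρ hρ x hx y hy
    refine (convex_ball σ ρ).norm_image_sub_le_of_norm_fderiv_le' (𝕜 := ℝ) (f := h)
      (fun z hz => hc.hdiff z) (fun z hz => ?_) hy hx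
    have := e1 z (ball_subset_ball hρ hz)
    refine this.trans ?_
    rw [mem_ball, dist_eq_norm] at hz
    gcongr
  have mvX : ∀ x ∈ ball σ r0, ‖h x - V.starProjection (x - σ)‖ ≤ 2 * C0 * ‖x - σ‖ ^ 2 := by
    intro x hx
    rcases eq_or_ne x σ with rfl | hne
    · simp [hc.h0]
    have hX : 0 < ‖x - σ‖ := norm_pos_iff.2 (sub_ne_zero.2 hne)
    rw [mem_ball, dist_eq_norm] at hx
    have := mv (min r0 (2 * ‖x - σ‖)) (min_le_left _ _) x
      (by rw [mem_ball, dist_eq_norm]; exact lt_min hx (by linarith)) σ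
      (by rw [mem_ball, dist_self]; exact lt_min hr0 (by linarith))
    rw [hc.h0, sub_zero] at this
    refine this.trans ?_
    have h2 : min r0 (2 * ‖x - σ‖) ≤ 2 * ‖x - σ‖ := min_le_right _ _
    calc C0 * min r0 (2 * ‖x - σ‖) * ‖x - σ‖ ≤ C0 * (2 * ‖x - σ‖) * ‖x - σ‖ := by gcongr
      _ = _ := by ring
  -- second derivatives
  have hd2c : ∀ i : Fin N, Continuous fun x => fderiv ℝ (fun y => fderiv ℝ h y (eb i)) x (eb i) := by
    intro i
    have : ContDiff ℝ (⊤ : ℕ∞) (fun y => fderiv ℝ h y (eb i)) := hd2.clm_apply contDiff_const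
    exact (this.continuous_fderiv (by simp)).clm_apply continuous_const
  set C2 : ℝ := ∑ i : Fin N, ‖fderiv ℝ (fun y => fderiv ℝ h y (eb i)) σ (eb i)‖ + 1 with hC2
  have hC2p : 1 ≤ C2 := by
    rw [hC2]; linarith [Finset.sum_nonneg (fun i (_ : i ∈ Finset.univ) =>
      norm_nonneg (fderiv ℝ (fun y => fderiv ℝ h y (eb (N := N) i)) σ (eb i)))]
  have ev2 : ∀ᶠ x in 𝓝 σ, ∀ i : Fin N, ‖fderiv ℝ (fun y => fderiv ℝ h y (eb i)) x (eb i)‖ ≤ C2 := by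
    rw [eventually_all]
    intro i
    have h1 : ‖fderiv ℝ (fun y => fderiv ℝ h y (eb i)) σ (eb i)‖ < C2 := by
      have := Finset.single_le_sum (f := fun i : Fin N =>
        ‖fderiv ℝ (fun y => fderiv ℝ h y (eb i)) σ (eb i)‖)
        (fun i _ => norm_nonneg _) (Finset.mem_univ i)
      rw [hC2]; linarith
    filter_upwards [((hd2c i).norm.continuousAt (x := σ)).eventually_lt continuousAt_const h1]
      with x hx using hx.le
  -- determinant
  have evdet : ∀ᶠ x in 𝓝 σ, 2⁻¹ < |(fderiv ℝ (chH σ V h) x).det| := by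
    have hcont : Continuous fun x => |(fderiv ℝ (chH σ V h) x).det| := by
      refine continuous_abs.comp (ContinuousLinearMap.continuous_det.comp ?_)
      exact hc.Hsm.continuous_fderiv (by simp)
    refine continuousAt_const.eventually_lt hcont.continuousAt ?_
    have : fderiv ℝ (chH σ V h) σ = ContinuousLinearMap.id ℝ (Euc N) := by
      rw [(hc.Hfd σ).fderiv, hc.fd]; ext1 x; simp
    rw [this]
    simp [ContinuousLinearMap.det]
    norm_num
  set r' : ℝ := min r0 (1 / (8 * C0)) with hr'
  have hr'p : 0 < r' := lt_min hr0 (by positivity)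
  have hr'C : 8 * C0 * r' ≤ 1 := by
    have : r' ≤ 1 / (8 * C0) := min_le_right _ _
    rw [le_div_iff₀ (by positivity)] at this
    linarith
  have hr'0 : r' ≤ r0 := min_le_left _ _
  have bi : ∀ x ∈ ball σ r', ∀ y ∈ ball σ r',
      ‖chH σ V h x - chH σ V h y - (x - y)‖ ≤ 2⁻¹ * ‖x - y‖ := by
    intro x hx y hy
    have h1 : chH σ V h x - chH σ V h y - (x - y) = h x - h y - V.starProjection (x - y) := by
      simp only [chH, map_sub]; abel
    rw [h1]
    refine (mv r' hr'0 x hx y hy).trans ?_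
    gcongr
    linarith
  obtain ⟨H, ρ, hρ, hσs, hHσ, hHeq, hsrc, htgt⟩ := hc.nhd (ball_mem_nhds σ hr'p)
  obtain ⟨r2, hr2, hr2s⟩ := Metric.mem_nhds_iff.1 (ev2.and evdet)
  set r : ℝ := min (min (r' / 4) ρ) r2 with hr
  have hrp : 0 < r := lt_min (lt_min (by linarith) hρ) hr2
  have hrr' : r ≤ r' / 4 := (min_le_left _ _).trans (min_le_left _ _)
  have hrρ : r ≤ ρ := (min_le_left _ _).trans (min_le_right _ _)
  have hrr2 : r ≤ r2 := min_le_right _ _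
  have hb' : ball σ r ⊆ ball σ r' := ball_subset_ball (by linarith)
  have hb0 : ball σ r ⊆ ball σ r0 := ball_subset_ball (by linarith)
  refine ⟨8 * C0 + C2, r, by linarith, hrp, fun x hx => (hr0t (hb0 hx)).2, ?_, ?_, ?_, ?_, ?_, ?_, ?_⟩
  · intro x hx
    refine (e1 x (hb0 hx)).trans ?_
    gcongr; linarith
  · intro x hx
    have h1 := mvX x (hb0 hx)
    have h2 : ‖V.starProjection (x - σ)‖ ≤ ‖x - σ‖ := V.norm_starProjection_apply_le _
    have h3 : ‖h x‖ ≤ ‖h x - V.starProjection (x - σ)‖ + ‖V.starProjection (x - σ)‖ := by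
      have := norm_add_le (h x - V.starProjection (x - σ)) (V.starProjection (x - σ))
      rwa [sub_add_cancel] at this
    have hx' := hb' hx
    rw [mem_ball, dist_eq_norm] at hx'
    have h4 : 2 * C0 * ‖x - σ‖ ^ 2 ≤ ‖x - σ‖ := by nlinarith [norm_nonneg (x - σ)]
    nlinarith [norm_nonneg (x - σ)]
  · intro x hx
    have h1 := mvX x (hb0 hx)
    have h2 : ‖(fderiv ℝ h x - V.starProjection) (x - σ)‖ ≤ C0 * ‖x - σ‖ * ‖x - σ‖ :=
      ((fderiv ℝ h x - V.starProjection).le_opNorm _).trans (by gcongr; exact e1 x (hb0 hx))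
    have h3 : h x - fderiv ℝ h x (x - σ) = (h x - V.starProjection (x - σ))
        - (fderiv ℝ h x - V.starProjection) (x - σ) := by
      rw [_root_.sub_apply]; abel
    rw [h3]
    refine (norm_sub_le _ _).trans ?_
    nlinarith [sq_nonneg ‖x - σ‖]
  · intro x hx i
    have := (hr2s (ball_subset_ball hrr2 hx)).1 i
    linarith
  · intro x hx
    rw [mem_ball, dist_eq_norm] at hx
    set X := ‖x - σ‖ with hX
    rcases eq_or_ne x σ with hxe | hne
    · have : X = 0 := by rw [hX, hxe]; simp
      rw [hxe, hc.h0]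
      have hσΓ : σ ∈ Γ := by
        have : σ ∈ {y ∈ U | h y = 0} := ⟨hc.hσ, hc.h0⟩
        rw [← hc.hΓ] at this; exact this.1
      rw [infDist_zero_of_mem hσΓ]; simp
    have hXp : 0 < X := norm_pos_iff.2 (sub_ne_zero.2 hne)
    set w : Euc N := (x - σ) - V.starProjection (x - σ) with hw
    have hwn : ‖w‖ ≤ X := by
      have h1 : w = (Vᗮ).starProjection (x - σ) := by
        rw [hw, Submodule.starProjection_orthogonal']; simp
      rw [h1]; exact (Vᗮ).norm_starProjection_apply_le _
    have hPw : V.starProjection w = 0 := by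
      rw [hw, map_sub, starProj_of_mem (V.starProjection_apply_mem _), sub_self]
    have hwt : w ∈ H.target := by rw [htgt, mem_ball_zero_iff]; linarith
    set b := H.symm w with hb
    have hbs : b ∈ H.source := H.map_target hwt
    have hHb : chH σ V h b = w := by rw [← hHeq]; exact H.right_inv hwt
    have hhb : h b = 0 := by rw [← hc.proj, hHb, hPw]
    have hbΓ : b ∈ Γ := by
      have : b ∈ {y ∈ U | h y = 0} := ⟨(hsrc hbs).2, hhb⟩
      rw [← hc.hΓ] at this; exact this.1
    have hbb := (hsrc hbs).1
    have hbσ : ‖b - σ‖ ≤ 2 * X := by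
      have h1 := bi b hbb σ (mem_ball_self hr'p)
      rw [hHb, hc.H0, sub_zero] at h1
      have h2 := norm_sub_norm_le (b - σ) w
      rw [norm_sub_rev (b - σ) w] at h2
      linarith
    have h3 := mv (min r0 (3 * X)) (min_le_left _ _) x
      (by rw [mem_ball, dist_eq_norm]; exact lt_min (by linarith) (by linarith)) b
      (by rw [mem_ball, dist_eq_norm]; exact lt_min (by linarith) (by linarith))
    have h4 : h x - h b - V.starProjection (x - b) = h x - (x - b) := by
      have h5 : chH σ V h x - chH σ V h b = h x := by rw [hHb, hw, chH]; abel
      have h6 : chH σ V h x - chH σ V h b = h x - h b + ((x - b) - V.starProjection (x - b)) := by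
        simp only [chH, map_sub]; abel
      rw [h5] at h6
      nth_rewrite 2 [h6]
      abel
    rw [h4] at h3
    have h5 : ‖x - b‖ ≤ ‖h x‖ + C0 * (3 * X) * ‖x - b‖ := by
      have h6 := norm_sub_norm_le (x - b) (h x)
      rw [norm_sub_rev (x - b) (h x)] at h6
      have h7 : C0 * min r0 (3 * X) * ‖x - b‖ ≤ C0 * (3 * X) * ‖x - b‖ := by
        gcongr; exact min_le_right _ _
      linarith
    have h6 : infDist x Γ ≤ ‖x - b‖ := by
      rw [← dist_eq_norm]; exact infDist_le_dist_of_mem hbΓ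
    refine h6.trans ?_
    have h7 : C0 * X ≤ 1 / 8 := by nlinarith
    have h8 : ‖x - b‖ ≤ ‖h x‖ * (1 + 8 * C0 * X) := by
      have h9 : ‖x - b‖ * (1 - 3 * (C0 * X)) ≤ ‖h x‖ := by linarith
      have h10 : 1 ≤ (1 - 3 * (C0 * X)) * (1 + 8 * (C0 * X)) := by
        have hp : 0 < C0 * X := mul_pos (by linarith) hXp
        clear_value C0 X
        nlinarith only [hp, h7]
      have h11 : (0:ℝ) ≤ 1 + 8 * (C0 * X) := by positivity
      calc ‖x - b‖ = ‖x - b‖ * 1 := (mul_one _).symm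
        _ ≤ ‖x - b‖ * ((1 - 3 * (C0 * X)) * (1 + 8 * (C0 * X))) := by gcongr
        _ = ‖x - b‖ * (1 - 3 * (C0 * X)) * (1 + 8 * (C0 * X)) := by ring
        _ ≤ ‖h x‖ * (1 + 8 * (C0 * X)) := by gcongr
        _ = _ := by ring
    refine h8.trans ?_
    gcongr
    linarith
  · intro x hx y hy
    exact bi x (hb' hx) y (hb' hy)
  · intro x hx
    exact (hr2s (ball_subset_ball hrr2 hx)).2.le

lemma lint_prod {n : ℕ} (f : Fin n → ℝ → ℝ≥0∞) (hf : ∀ i, Measurable (f i)) :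
    ∫⁻ x : Fin n → ℝ, ∏ i, f i (x i) = ∏ i, ∫⁻ t, f i t := by
  induction n with
  | zero => simp [volume_pi]
  | succ n ih =>
    have h1 := (volume_preserving_piFinSuccAbove (fun _ : Fin (n + 1) => ℝ) 0).symm
    rw [← h1.lintegral_comp_emb (MeasurableEquiv.measurableEmbedding _)]
    rw [Fin.prod_univ_succ, ← ih (fun i => f i.succ) (fun i => hf _)]
    rw [← lintegral_prod_mul (hf 0).aemeasurable (by
      refine (Finset.measurable_prod _ fun i _ => (hf _).comp (measurable_pi_apply i)).aemeasurable)]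
    simp_rw [MeasurableEquiv.piFinSuccAbove_symm_apply, Fin.insertNthEquiv,
            Fin.prod_univ_succ, Fin.insertNth_zero, Equiv.coe_fn_mk, Fin.cons_succ,
            Fin.cons_zero]
    rfl

lemma lint_one {c ρ : ℝ} (hc : c < 1) (hρ : 0 < ρ) :
    ∫⁻ t in Set.Ioo (-ρ) ρ, ENNReal.ofReal |t| ^ (-c) ≤ ENNReal.ofReal (2 / (1 - c) * ρ ^ (1 - c)) := by
  have hhalf : ∫⁻ t in Set.Ioc 0 ρ, ENNReal.ofReal |t| ^ (-c) = ENNReal.ofReal (ρ ^ (1 - c) / (1 - c)) := by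
    have hI : IntervalIntegrable (fun t : ℝ => t ^ (-c)) volume 0 ρ :=
      intervalIntegral.intervalIntegrable_rpow' (by linarith)
    have h2 : ∫ t in (0:ℝ)..ρ, t ^ (-c) = ρ ^ (1 - c) / (1 - c) := by
      rw [integral_rpow (Or.inl (by linarith))]
      have : -c + 1 = 1 - c := by ring
      rw [this, Real.zero_rpow (by linarith), sub_zero]
    rw [intervalIntegral.integral_of_le hρ.le] at h2
    rw [← h2, ofReal_integral_eq_lintegral_ofReal]
    · refine setLIntegral_congr_fun measurableSet_Ioc fun t ht => ?_
      rw [← ENNReal.ofReal_rpow_of_pos ht.1, abs_of_pos ht.1]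
    · exact (intervalIntegrable_iff_integrableOn_Ioc_of_le hρ.le).1 hI
    · refine (ae_restrict_iff' measurableSet_Ioc).2 (Eventually.of_forall fun t ht => ?_)
      exact Real.rpow_nonneg ht.1.le _
  have hneg : ∫⁻ t in Set.Ico (-ρ) 0, ENNReal.ofReal |t| ^ (-c)
      = ∫⁻ t in Set.Ioc 0 ρ, ENNReal.ofReal |t| ^ (-c) := by
    have := (Measure.measurePreserving_neg (volume : Measure ℝ)).setLIntegral_comp_preimage_emb
      (MeasurableEquiv.neg ℝ).measurableEmbedding (fun t => ENNReal.ofReal |t| ^ (-c)) (Set.Ioc 0 ρ)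
    rw [← this]
    simp [abs_neg]
  have hsub : Set.Ioo (-ρ) ρ ⊆ (Set.Ico (-ρ) 0 ∪ Set.Ioc 0 ρ) ∪ {0} := by
    intro t ht
    rcases lt_trichotomy t 0 with h | h | h
    · exact Or.inl (Or.inl ⟨ht.1.le, h⟩)
    · exact Or.inr h
    · exact Or.inl (Or.inr ⟨h, ht.2.le⟩)
  refine (lintegral_mono_set hsub).trans ?_
  refine (lintegral_union_le _ _ _).trans ?_
  have h0 : ∫⁻ t in ({0} : Set ℝ), ENNReal.ofReal |t| ^ (-c) = 0 :=
    setLIntegral_measure_zero _ _ (by simp)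
  rw [h0, add_zero]
  refine (lintegral_union_le _ _ _).trans ?_
  rw [hneg, hhalf]
  have hp : 0 ≤ ρ ^ (1 - c) / (1 - c) := div_nonneg (Real.rpow_nonneg hρ.le _) (by linarith)
  rw [← ENNReal.ofReal_add hp hp]
  refine ENNReal.ofReal_le_ofReal (le_of_eq ?_)
  ring

lemma lint_proj {N m : ℕ} {V : Submodule ℝ (Euc N)} (hV : Module.finrank ℝ V = m) (hm : 0 < m)
    {τ : ℝ} (hτ0 : 0 ≤ τ) (hτ : τ < m) : ∃ C : ℝ, 0 < C ∧ ∀ ρ : ℝ, 0 < ρ →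
      ∫⁻ z in ball (0 : Euc N) ρ, ENNReal.ofReal ‖V.starProjection z‖ ^ (-τ)
        ≤ ENNReal.ofReal (C * ρ ^ ((N : ℝ) - τ)) := by
  have hmN : m ≤ N := by
    have := V.finrank_le
    simpa [hV] using this
  have hm0 : (0 : ℝ) < m := by exact_mod_cast hm
  set c : ℝ := τ / m with hc
  have hc0 : 0 ≤ c := by positivity
  have hc1 : c < 1 := by rw [hc, div_lt_one hm0]; exact hτ
  have hcm : c * m = τ := by rw [hc]; field_simp
  let bV := (stdOrthonormalBasis ℝ V).reindex (finCongr hV)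
  let v : Fin N → Euc N := fun i => if h : i.1 < m then (bV ⟨i.1, h⟩ : Euc N) else 0
  let s : Set (Fin N) := {i | i.1 < m}
  have hon : Orthonormal ℝ (s.domRestrict v) := by
    have h1 : s.domRestrict v = fun i : s => (bV ⟨i.1.1, i.2⟩ : Euc N) := by
      funext i
      have hi : i.1.1 < m := i.2
      simp [Set.domRestrict, v, hi]
    rw [h1]
    have h2 : Orthonormal ℝ (fun i => (bV i : Euc N)) := bV.orthonormal.comp_linearIsometry V.subtypeₗᵢ
    exact h2.comp _ (fun i j hij => by
      have : i.1.1 = j.1.1 := by simpa using hij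
      exact Subtype.ext (Fin.ext this))
  obtain ⟨b, hb⟩ := hon.exists_orthonormalBasis_extension_of_card_eq (by simp)
  have hbV : ∀ i : Fin N, i.1 < m → b i ∈ V := by
    intro i hi
    rw [hb i hi]
    simp [v, hi]
  have hcoord : ∀ i : Fin N, i.1 < m → ∀ z, |b.repr z i| ≤ ‖V.starProjection z‖ := by
    intro i hi z
    have h1 : b.repr z i = ⟪b i, V.starProjection z⟫ := by
      rw [b.repr_apply_apply]
      have := V.inner_starProjection_left_eq_right (b i) z
      rw [starProj_of_mem (hbV i hi)] at this
      exact this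
    rw [h1]
    refine (abs_real_inner_le_norm _ _).trans ?_
    simp
  let e : Fin N → ℝ := fun i => if i.1 < m then c else 0
  have he1 : ∀ i, e i < 1 := by intro i; simp only [e]; split_ifs <;> linarith
  have hsum : ∑ i, e i = τ := by
    simp only [e]
    rw [Finset.sum_ite, Finset.sum_const, Finset.sum_const_zero, add_zero, nsmul_eq_mul]
    have : (Finset.univ.filter fun i : Fin N => i.1 < m).card = m := by
      rw [Fin.card_filter_val_lt]; omega
    rw [this, mul_comm, hcm]
  let F : ℝ → Fin N → ℝ → ℝ≥0∞ := fun ρ i =>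
    (Set.Ioo (-ρ) ρ).indicator fun t => ENNReal.ofReal |t| ^ (-(e i))
  have hFm : ∀ ρ i, Measurable (F ρ i) := by
    intro ρ i
    refine Measurable.indicator ?_ measurableSet_Ioo
    fun_prop
  refine ⟨∏ i, (2 / (1 - e i)), Finset.prod_pos fun i _ => div_pos two_pos (by linarith [he1 i]), ?_⟩
  intro ρ hρ
  have hpt : ∀ z ∈ ball (0 : Euc N) ρ, ENNReal.ofReal ‖V.starProjection z‖ ^ (-τ)
      ≤ ∏ i, F ρ i (b.repr z i) := by
    intro z hz
    have hz' : ∀ i, b.repr z i ∈ Set.Ioo (-ρ) ρ := by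
      intro i
      rw [mem_ball_zero_iff] at hz
      have h1 : |b.repr z i| ≤ ‖z‖ := by
        have := PiLp.norm_apply_le (b.repr z) i
        rwa [b.repr.norm_map, Real.norm_eq_abs] at this
      exact abs_lt.1 (lt_of_le_of_lt h1 hz)
    have h2 : ENNReal.ofReal ‖V.starProjection z‖ ^ (-τ)
        = ∏ i, ENNReal.ofReal ‖V.starProjection z‖ ^ (-(e i)) := by
      have h3 : ∀ i, ENNReal.ofReal ‖V.starProjection z‖ ^ (-(e i))
          = if i.1 < m then ENNReal.ofReal ‖V.starProjection z‖ ^ (-c) else 1 := by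
        intro i; simp only [e]; split_ifs <;> simp
      simp_rw [h3]
      rw [Finset.prod_ite, Finset.prod_const, Finset.prod_const_one, mul_one]
      have : (Finset.univ.filter fun i : Fin N => i.1 < m).card = m := by
        rw [Fin.card_filter_val_lt]; omega
      rw [this, ← ENNReal.rpow_natCast, ← ENNReal.rpow_mul]
      congr 1; rw [neg_mul, hcm]
    rw [h2]
    refine Finset.prod_le_prod' fun i _ => ?_
    simp only [F]
    rw [Set.indicator_of_mem (hz' i)]
    by_cases hi : i.1 < m
    · rw [ENNReal.rpow_neg, ENNReal.rpow_neg, ENNReal.inv_le_inv]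
      refine ENNReal.rpow_le_rpow (ENNReal.ofReal_le_ofReal (hcoord i hi z)) ?_
      simp [e, hi, hc0]
    · simp [e, hi]
  have hmp : MeasurePreserving (fun z : Euc N => WithLp.ofLp (b.repr z)) :=
    (PiLp.volume_preserving_ofLp (Fin N)).comp b.measurePreserving_repr
  calc ∫⁻ z in ball (0 : Euc N) ρ, ENNReal.ofReal ‖V.starProjection z‖ ^ (-τ)
      ≤ ∫⁻ z in ball (0 : Euc N) ρ, ∏ i, F ρ i (b.repr z i) :=
        setLIntegral_mono' measurableSet_ball hpt
    _ ≤ ∫⁻ z : Euc N, ∏ i, F ρ i (b.repr z i) := setLIntegral_le_lintegral _ _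
    _ = ∫⁻ y : Fin N → ℝ, ∏ i, F ρ i (y i) := by
        have hmm : Measurable fun y : Fin N → ℝ => ∏ i, F ρ i (y i) :=
          Finset.measurable_prod _ fun i _ => (hFm ρ i).comp (measurable_pi_apply i)
        exact hmp.lintegral_comp hmm
    _ = ∏ i, ∫⁻ t, F ρ i t := lint_prod _ (hFm ρ)
    _ ≤ ∏ i, ENNReal.ofReal (2 / (1 - e i) * ρ ^ (1 - e i)) := by
        refine Finset.prod_le_prod' fun i _ => ?_
        simp only [F]
        rw [lintegral_indicator measurableSet_Ioo]
        exact lint_one (he1 i) hρ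
    _ = ENNReal.ofReal ((∏ i, (2 / (1 - e i))) * ρ ^ ((N : ℝ) - τ)) := by
        rw [← ENNReal.ofReal_prod_of_nonneg]
        · rw [Finset.prod_mul_distrib, ← Real.rpow_sum_of_pos hρ]
          congr 3
          rw [Finset.sum_sub_distrib, hsum]; simp
        · intro i _
          exact mul_nonneg (div_nonneg two_pos.le (by linarith [he1 i])) (Real.rpow_nonneg hρ.le _)

lemma lint_chart {N m : ℕ} {Γ U : Set (Euc N)} {σ : Euc N} {V : Submodule ℝ (Euc N)}
    {h : Euc N → Euc N} (hc : IsChart Γ σ m V h U) {C0 r : ℝ} (he : ChartEst Γ σ V h U C0 r)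
    (hm : 0 < m) {τ : ℝ} (hτ0 : 0 ≤ τ) (hτ : τ < m) : ∃ C : ℝ, 0 < C ∧ ∀ s : ℝ, 0 < s → s ≤ r →
      ∫⁻ x in ball σ s, ENNReal.ofReal ‖h x‖ ^ (-τ)
        ≤ ENNReal.ofReal (C * s ^ ((N : ℝ) - τ)) := by
  obtain ⟨C, hC, hb⟩ := lint_proj hc.fr hm hτ0 hτ
  refine ⟨2 * (C * 2 ^ ((N : ℝ) - τ)), by positivity, fun s hs hsr => ?_⟩
  have hsub : ball σ s ⊆ ball σ r := ball_subset_ball hsr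
  have hinj : Set.InjOn (chH σ V h) (ball σ s) := by
    intro x hx y hy hxy
    have := he.bi x (hsub hx) y (hsub hy)
    rw [hxy, sub_self, zero_sub, norm_neg] at this
    have h0 : ‖x - y‖ = 0 := le_antisymm (by linarith) (norm_nonneg _)
    exact sub_eq_zero.1 (norm_eq_zero.1 h0)
  have him : chH σ V h '' ball σ s ⊆ ball 0 (2 * s) := by
    rintro _ ⟨x, hx, rfl⟩
    have := he.bi x (hsub hx) σ (mem_ball_self he.r0)
    rw [hc.H0, sub_zero] at this
    rw [mem_ball_zero_iff]
    rw [mem_ball, dist_eq_norm] at hx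
    have h2 := norm_sub_norm_le (chH σ V h x) (x - σ)
    linarith
  have key := lintegral_image_eq_lintegral_abs_det_fderiv_mul volume (measurableSet_ball (x := σ) (ε := s))
    (fun x _ => (hc.Hsm.differentiable (by simp) x).hasFDerivAt.hasFDerivWithinAt) hinj
    (fun z => ENNReal.ofReal ‖V.starProjection z‖ ^ (-τ))
  have h1 : ∫⁻ x in ball σ s, 2⁻¹ * ENNReal.ofReal ‖h x‖ ^ (-τ)
      ≤ ENNReal.ofReal (C * (2 * s) ^ ((N : ℝ) - τ)) := by
    refine le_trans ?_ (hb (2 * s) (by linarith))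
    refine le_trans ?_ (lintegral_mono_set him)
    rw [key]
    refine setLIntegral_mono' measurableSet_ball fun x hx => ?_
    rw [hc.proj]
    gcongr
    have := ENNReal.ofReal_le_ofReal (he.det x (hsub hx))
    rw [ENNReal.ofReal_inv_of_pos two_pos] at this
    simpa using this
  rw [lintegral_const_mul' _ _ (by simp)] at h1
  calc ∫⁻ x in ball σ s, ENNReal.ofReal ‖h x‖ ^ (-τ)
      = 2 * (2⁻¹ * ∫⁻ x in ball σ s, ENNReal.ofReal ‖h x‖ ^ (-τ)) := by
        rw [← mul_assoc, ENNReal.mul_inv_cancel (by simp) (by simp), one_mul]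
    _ ≤ 2 * ENNReal.ofReal (C * (2 * s) ^ ((N : ℝ) - τ)) := by gcongr
    _ = _ := by
        rw [show (2 : ℝ≥0∞) = ENNReal.ofReal 2 by simp, ← ENNReal.ofReal_mul (by norm_num),
          Real.mul_rpow (by norm_num) hs.le]
        congr 1; ring

lemma ChartEst.mono {N : ℕ} {Γ U : Set (Euc N)} {σ : Euc N} {V : Submodule ℝ (Euc N)}
    {h : Euc N → Euc N} {C r r' : ℝ} (he : ChartEst Γ σ V h U C r) (h0 : 0 < r') (hr : r' ≤ r) :
    ChartEst Γ σ V h U C r' := by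
  have hs : ball σ r' ⊆ ball σ r := ball_subset_ball hr
  exact ⟨he.C1, h0, hs.trans he.sub, fun x hx => he.dh x (hs hx), fun x hx => he.hh x (hs hx),
    fun x hx => he.h2 x (hs hx), fun x hx => he.d2 x (hs hx), fun x hx => he.dist x (hs hx),
    fun x hx y hy => he.bi x (hs hx) y (hs hy), fun x hx => he.det x (hs hx)⟩

lemma norm_eb {N : ℕ} (i : Fin N) : ‖(eb i : Euc N)‖ = 1 := by simp [eb]

lemma sum_proj {N : ℕ} (V : Submodule ℝ (Euc N)) :
    ∑ i, ‖V.starProjection (eb i)‖ ^ 2 = (Module.finrank ℝ V : ℝ) := by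
  have h1 : LinearMap.IsProj V (V.starProjection : Euc N →ₗ[ℝ] Euc N) :=
    ⟨fun x => V.starProjection_apply_mem x, fun x hx => starProj_of_mem hx⟩
  have h2 := h1.trace
  rw [LinearMap.trace_eq_sum_inner _ (EuclideanSpace.basisFun (Fin N) ℝ)] at h2
  rw [← h2]
  refine Finset.sum_congr rfl fun i _ => ?_
  rw [← real_inner_self_eq_norm_sq]
  have := V.inner_starProjection_left_eq_right (eb i) (V.starProjection (eb i))
  rw [this, starProj_of_mem (V.starProjection_apply_mem _)]
  simp [eb]

lemma sq_diff {a b e M : ℝ} (ha : 0 ≤ a) (hb : 0 ≤ b) (h : |a - b| ≤ e) (hb' : b ≤ M) (he : e ≤ M) :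
    |a ^ 2 - b ^ 2| ≤ 3 * M * e := by
  have h1 : a ^ 2 - b ^ 2 = (a - b) * (a + b) := by ring
  have hh := abs_le.1 h
  rw [h1, abs_mul, abs_of_nonneg (by linarith : 0 ≤ a + b)]
  have he0 : 0 ≤ e := (abs_nonneg _).trans h
  calc |a - b| * (a + b) ≤ e * (3 * M) := by gcongr; linarith
    _ = _ := by ring

/-- jets of `log ‖h‖²` and `log ‖x-σ‖²` -/
structure JetE {N : ℕ} (m : ℕ) (σ : Euc N) (h : Euc N → Euc N) (K : ℝ) (x gl gr : Euc N)
    (e1 e3 e4 : ℝ) : Prop where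
  jl : HasJ (fun y => Real.log (‖h y‖ ^ 2)) x gl ((2 * m - 4) / ‖h x‖ ^ 2 + e4)
  jr : HasJ (fun y => Real.log (‖y - σ‖ ^ 2)) x gr ((2 * N - 4) / ‖x - σ‖ ^ 2)
  ll : ⟪gl, gl⟫ = 4 / ‖h x‖ ^ 2 + e3
  rl : ⟪gr, gl⟫ = 4 / ‖x - σ‖ ^ 2 + e1
  rr : ⟪gr, gr⟫ = 4 / ‖x - σ‖ ^ 2
  b1 : |e1| ≤ K / ‖h x‖
  b3 : |e3| ≤ K * ‖x - σ‖ / ‖h x‖ ^ 2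
  b4 : |e4| ≤ K * ‖x - σ‖ / ‖h x‖ ^ 2

set_option maxHeartbeats 1000000 in
lemma jets {N m : ℕ} {Γ U : Set (Euc N)} {σ : Euc N} {V : Submodule ℝ (Euc N)}
    {h : Euc N → Euc N} (hc : IsChart Γ σ m V h U) {C r : ℝ} (he : ChartEst Γ σ V h U C r)
    (hr : r ≤ 1) : ∃ K : ℝ, 1 ≤ K ∧ ∀ x ∈ ball σ r, h x ≠ 0 → ∃ gl gr e1 e3 e4,
      JetE m σ h K x gl gr e1 e3 e4 := by
  have hC1 := he.C1
  refine ⟨6 * (N : ℝ) * C ^ 2 + 2 * N * C ^ 2 + 12 * C ^ 2 + 4 * C, by nlinarith [(Nat.cast_nonneg N : (0:ℝ) ≤ N)], ?_⟩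
  intro x hx hx0
  have hxσ : x ≠ σ := by rintro rfl; exact hx0 hc.h0
  set X := ‖x - σ‖ with hX
  set d := ‖h x‖ with hd
  have hXp : 0 < X := norm_pos_iff.2 (sub_ne_zero.2 hxσ)
  have hdp : 0 < d := norm_pos_iff.2 hx0
  have hX1 : X ≤ 1 := by rw [mem_ball, dist_eq_norm] at hx; linarith
  set A := fderiv ℝ h x with hA
  set w := ContinuousLinearMap.adjoint A (h x) with hw
  have hcx : ContDiffAt ℝ 2 h x := (hc.sm.of_le (WithTop.coe_le_coe.2 (le_top : ((2:ℕ) : ℕ∞) ≤ ⊤))).contDiffAt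
  have hAd := he.dh x hx
  have hCX : 0 ≤ C * X := by positivity
  -- adjoint estimate
  have hw1 : ‖w - h x‖ ≤ C * X * d := by
    have h1 : w - h x = ContinuousLinearMap.adjoint (A - V.starProjection) (h x) := by
      rw [map_sub, _root_.sub_apply, ← hw]
      congr 1
      have h2 : ContinuousLinearMap.adjoint V.starProjection = V.starProjection := by
        rw [← ContinuousLinearMap.star_eq_adjoint]
        exact isSelfAdjoint_starProjection V
      rw [h2, starProj_of_mem (hc.mem x)]
    rw [h1]
    refine (ContinuousLinearMap.le_opNorm _ _).trans ?_
    gcongr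
    rw [LinearIsometryEquiv.norm_map]; exact hAd
  have hwd : |‖w‖ - d| ≤ C * X * d := (abs_norm_sub_norm_le _ _).trans hw1
  have hw2 : |‖w‖ ^ 2 - d ^ 2| ≤ 3 * (C * d) * (C * X * d) := by
    refine sq_diff (norm_nonneg _) hdp.le hwd (by nlinarith) ?_
    calc C * X * d ≤ C * 1 * d := by gcongr
      _ = _ := by ring
  have hS : |∑ i, ‖A (eb i)‖ ^ 2 - m| ≤ N * (3 * C * (C * X)) := by
    rw [← hc.fr, ← sum_proj V, ← Finset.sum_sub_distrib]
    refine (Finset.abs_sum_le_sum_abs _ _).trans ?_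
    have : ∀ i ∈ (Finset.univ : Finset (Fin N)),
        |‖A (eb i)‖ ^ 2 - ‖V.starProjection (eb i)‖ ^ 2| ≤ 3 * C * (C * X) := by
      intro i _
      refine sq_diff (norm_nonneg _) (norm_nonneg _) ?_ ?_ ?_
      · refine (abs_norm_sub_norm_le _ _).trans ?_
        rw [← _root_.sub_apply]
        refine (ContinuousLinearMap.le_opNorm _ _).trans ?_
        rw [norm_eb, mul_one]; exact hAd
      · refine (V.norm_starProjection_apply_le _).trans ?_
        rw [norm_eb]; exact hC1
      · nlinarith
    refine (Finset.sum_le_sum this).trans ?_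
    simp
  have hT : |∑ i, ⟪h x, fderiv ℝ (fun y => fderiv ℝ h y (eb i)) x (eb i)⟫| ≤ N * (C * (C * X)) := by
    refine (Finset.abs_sum_le_sum_abs _ _).trans ?_
    have : ∀ i ∈ (Finset.univ : Finset (Fin N)),
        |⟪h x, fderiv ℝ (fun y => fderiv ℝ h y (eb i)) x (eb i)⟫| ≤ C * (C * X) := by
      intro i _
      refine (abs_real_inner_le_norm _ _).trans ?_
      rw [mul_comm]
      have h1 := he.d2 x hx i
      have h2 := he.hh x hx
      gcongr
    refine (Finset.sum_le_sum this).trans ?_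
    simp
  have hin : |⟪A (x - σ) - h x, h x⟫| ≤ C * X ^ 2 * d := by
    refine (abs_real_inner_le_norm _ _).trans ?_
    have := he.h2 x hx
    rw [norm_sub_rev]
    gcongr
  have jD := hasJ_normSq hcx
  have jR := hasJ_distSq σ x
  have jl := jD.log (by positivity)
  have jr := jR.log (by positivity)
  rw [← hA, ← hw] at jl
  set S := ∑ i, ‖A (eb i)‖ ^ 2 with hSd
  set T := ∑ i, ⟪h x, fderiv ℝ (fun y => fderiv ℝ h y (eb i)) x (eb i)⟫ with hTd
  set I := ⟪A (x - σ) - h x, h x⟫ with hI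
  have hwin : ⟪x - σ, w⟫ = I + d ^ 2 := by
    rw [hw, ContinuousLinearMap.adjoint_inner_right, hI, inner_sub_left,
      real_inner_self_eq_norm_sq]; ring
  simp only [← hX, ← hd] at jl jr
  refine ⟨_, _, 4 * I / (X ^ 2 * d ^ 2), 4 * (‖w‖ ^ 2 - d ^ 2) / (d ^ 2) ^ 2,
    (2 * (S - m) + 2 * T) / d ^ 2 - 4 * (‖w‖ ^ 2 - d ^ 2) / (d ^ 2) ^ 2,
    ⟨jl.cast rfl ?_, jr.cast rfl ?_, ?_, ?_, ?_, ?_, ?_, ?_⟩⟩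
  · simp only [inner_smul_left, inner_smul_right, real_inner_self_eq_norm_sq, RCLike.conj_to_real]
    rw [← hd]
    field_simp
    ring
  · simp only [inner_smul_left, inner_smul_right, real_inner_self_eq_norm_sq, RCLike.conj_to_real]
    rw [← hX]
    field_simp
    ring
  · simp only [inner_smul_left, inner_smul_right, real_inner_self_eq_norm_sq, RCLike.conj_to_real]
    rw [← hd]
    field_simp
    ring
  · simp only [inner_smul_left, inner_smul_right, RCLike.conj_to_real, hwin]
    rw [← hX]
    field_simp
    ring
  · simp only [inner_smul_left, inner_smul_right, real_inner_self_eq_norm_sq, RCLike.conj_to_real]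
    rw [← hX]
    field_simp
    ring
  · rw [← hd, abs_div, abs_of_pos (by positivity : 0 < X ^ 2 * d ^ 2), div_le_div_iff₀ (by positivity) hdp,
      abs_mul, abs_of_pos (by norm_num : (0:ℝ) < 4)]
    calc 4 * |I| * d ≤ 4 * (C * X ^ 2 * d) * d := by gcongr
      _ = (4 * C) * (X ^ 2 * d ^ 2) := by ring
      _ ≤ _ := by
        gcongr
        nlinarith [(Nat.cast_nonneg N : (0:ℝ) ≤ N), mul_nonneg (Nat.cast_nonneg N : (0:ℝ) ≤ N) (sq_nonneg C), sq_nonneg C]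
  all_goals
    have hq : |4 * (‖w‖ ^ 2 - d ^ 2) / (d ^ 2) ^ 2| ≤ 12 * C ^ 2 * X / d ^ 2 := by
      rw [abs_div, abs_of_pos (by positivity : 0 < (d ^ 2) ^ 2), div_le_div_iff₀ (by positivity) (by positivity),
        abs_mul, abs_of_pos (by norm_num : (0:ℝ) < 4)]
      calc 4 * |‖w‖ ^ 2 - d ^ 2| * d ^ 2 ≤ 4 * (3 * (C * d) * (C * X * d)) * d ^ 2 := by gcongr
        _ = _ := by ring
    have hNN : 0 ≤ (N:ℝ) * C ^ 2 := by positivity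
  · refine hq.trans ?_
    rw [← hd, ← hX]
    gcongr
    nlinarith
  · refine (abs_sub _ _).trans ?_
    have hq2 : |(2 * (S - m) + 2 * T) / d ^ 2| ≤ (2 * (N * (3 * C * (C * X))) + 2 * (N * (C * (C * X)))) / d ^ 2 := by
      rw [abs_div, abs_of_pos (by positivity : 0 < d ^ 2)]
      gcongr
      refine (abs_add_le _ _).trans ?_
      rw [abs_mul, abs_mul, abs_of_pos (by norm_num : (0:ℝ) < 2)]
      gcongr
    refine (add_le_add hq2 hq).trans ?_
    rw [← hd, ← hX, ← add_div]
    gcongr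
    nlinarith [mul_nonneg hNN hXp.le]

/-- cutoff function -/
def cutT (n : ℕ) (t : ℝ) : ℝ := Real.smoothTransition t ^ n

/-- majorant of the derivatives of the cutoff -/
def cutZ (n : ℕ) (t : ℝ) : ℝ := (Set.Icc (0:ℝ) 1).indicator (fun t => Real.smoothTransition t ^ (n - 2)) t

lemma cutT_contDiff (n : ℕ) {j : ℕ∞} : ContDiff ℝ j (cutT n) := Real.smoothTransition.contDiff.pow n

lemma cutT_nonneg (n : ℕ) (t : ℝ) : 0 ≤ cutT n t := pow_nonneg (Real.smoothTransition.nonneg t) n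
lemma cutT_le_one (n : ℕ) (t : ℝ) : cutT n t ≤ 1 :=
  pow_le_one₀ (Real.smoothTransition.nonneg t) (Real.smoothTransition.le_one t)
lemma cutT_zero {n : ℕ} (hn : 2 ≤ n) {t : ℝ} (ht : t ≤ 0) : cutT n t = 0 := by
  rw [cutT, Real.smoothTransition.zero_of_nonpos ht, zero_pow (by omega)]
lemma cutT_one (n : ℕ) {t : ℝ} (ht : 1 ≤ t) : cutT n t = 1 := by
  rw [cutT, Real.smoothTransition.one_of_one_le ht, one_pow]
lemma smT_mono : Monotone Real.smoothTransition := by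
  intro x y hxy
  unfold Real.smoothTransition
  have h1 : expNegInvGlue x ≤ expNegInvGlue y := expNegInvGlue.monotone hxy
  have h2 : expNegInvGlue (1 - y) ≤ expNegInvGlue (1 - x) := expNegInvGlue.monotone (by linarith)
  rw [div_le_div_iff₀ (Real.smoothTransition.pos_denom x) (Real.smoothTransition.pos_denom y)]
  nlinarith [expNegInvGlue.nonneg x, expNegInvGlue.nonneg (1 - y),
    mul_le_mul h1 h2 (expNegInvGlue.nonneg _) (expNegInvGlue.nonneg _)]
lemma cutT_mono (n : ℕ) : Monotone (cutT n) := fun x y hxy =>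
  pow_le_pow_left₀ (Real.smoothTransition.nonneg x) (smT_mono hxy) n
lemma cutZ_nonneg (n : ℕ) (t : ℝ) : 0 ≤ cutZ n t :=
  Set.indicator_nonneg (fun t _ => pow_nonneg (Real.smoothTransition.nonneg t) _) t

lemma deriv_bdd {g : ℝ → ℝ} (hg : Continuous (deriv g)) (h0 : ∀ t < 0, g =ᶠ[𝓝 t] fun _ => g t)
    (h1 : ∀ t > 1, g =ᶠ[𝓝 t] fun _ => g t) :
    ∃ C : ℝ, 0 < C ∧ (∀ t, |deriv g t| ≤ C) ∧ ∀ t, t ∉ Set.Icc (0:ℝ) 1 → deriv g t = 0 := by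
  have hz : ∀ t, t ∉ Set.Icc (0:ℝ) 1 → deriv g t = 0 := by
    intro t ht
    rw [Set.mem_Icc, not_and_or, not_le, not_le] at ht
    rcases ht with h | h
    · rw [(h0 t h).deriv_eq]; simp
    · rw [(h1 t h).deriv_eq]; simp
  obtain ⟨C, hC⟩ := isCompact_Icc.exists_bound_of_continuousOn (s := Set.Icc (0:ℝ) 1) hg.continuousOn
  refine ⟨|C| + 1, by positivity, fun t => ?_, hz⟩
  by_cases ht : t ∈ Set.Icc (0:ℝ) 1
  · have := hC t ht
    rw [Real.norm_eq_abs] at this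
    linarith [le_abs_self C]
  · rw [hz t ht]; simp; positivity

lemma cut_bounds {n : ℕ} (hn : 2 ≤ n) : ∃ (θ1 θ2 : ℝ → ℝ) (C : ℝ), 0 < C ∧
    (∀ t, HasDerivAt (cutT n) (θ1 t) t) ∧ (∀ t, HasDerivAt θ1 (θ2 t) t) ∧
    (∀ t, |θ1 t| ≤ C * cutZ n t) ∧ (∀ t, |θ2 t| ≤ C * cutZ n t) := by
  set χ := Real.smoothTransition with hχ
  have hs : ContDiff ℝ 2 χ := Real.smoothTransition.contDiff (n := 2)
  have hs1 : ContDiff ℝ 1 (deriv χ) := by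
    have := hs.iterate_deriv' 1 1
    simpa using this
  have hc2 : Continuous (deriv (deriv χ)) := hs1.continuous_deriv (by norm_num)
  have e0 : ∀ t < 0, χ =ᶠ[𝓝 t] fun _ => χ t := by
    intro t ht
    filter_upwards [gt_mem_nhds ht] with y hy
    rw [hχ, Real.smoothTransition.zero_of_nonpos hy.le, Real.smoothTransition.zero_of_nonpos ht.le]
  have e1 : ∀ t > 1, χ =ᶠ[𝓝 t] fun _ => χ t := by
    intro t ht
    filter_upwards [lt_mem_nhds ht] with y hy
    rw [hχ, Real.smoothTransition.one_of_one_le hy.le, Real.smoothTransition.one_of_one_le ht.le]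
  obtain ⟨C1, hC1, hb1, hz1⟩ := deriv_bdd (hs.continuous_deriv (by norm_num)) e0 e1
  have f0 : ∀ t < 0, deriv χ =ᶠ[𝓝 t] fun _ => deriv χ t := by
    intro t ht
    filter_upwards [gt_mem_nhds ht] with y hy
    rw [hz1 y (fun h => by linarith [h.1]), hz1 t (fun h => by linarith [h.1])]
  have f1 : ∀ t > 1, deriv χ =ᶠ[𝓝 t] fun _ => deriv χ t := by
    intro t ht
    filter_upwards [lt_mem_nhds ht] with y hy
    rw [hz1 y (fun h => by linarith [h.2]), hz1 t (fun h => by linarith [h.2])]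
  obtain ⟨C2, hC2, hb2, hz2⟩ := deriv_bdd hc2 f0 f1
  have d1 : ∀ t, HasDerivAt χ (deriv χ t) t := fun t => (hs.differentiable (by norm_num) t).hasDerivAt
  have d2 : ∀ t, HasDerivAt (deriv χ) (deriv (deriv χ) t) t :=
    fun t => (hs1.differentiable (by norm_num) t).hasDerivAt
  obtain ⟨j, rfl⟩ : ∃ j, n = j + 2 := ⟨n - 2, by omega⟩
  set n : ℝ := ((j + 2 : ℕ) : ℝ) with hn'
  have hn0 : 0 ≤ n := Nat.cast_nonneg _
  refine ⟨fun t => n * χ t ^ (j + 1) * deriv χ t,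
    fun t => n * (((j + 1 : ℕ) : ℝ) * χ t ^ j * deriv χ t) * deriv χ t + n * χ t ^ (j + 1) * deriv (deriv χ) t,
    n * n * C1 ^ 2 + n * C1 + n * C2 + 1, by positivity, ?_, ?_, ?_, ?_⟩
  · intro t
    exact (d1 t).pow (j + 2)
  · intro t
    exact (((d1 t).pow (j + 1)).const_mul n).mul (d2 t)
  all_goals
    intro t
    have hχ0 : 0 ≤ χ t := Real.smoothTransition.nonneg t
    have hχ1 : χ t ≤ 1 := Real.smoothTransition.le_one t
    have hp : 0 ≤ χ t ^ j := pow_nonneg hχ0 j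
    have hp1 : χ t ^ (j + 1) ≤ χ t ^ j := pow_le_pow_of_le_one hχ0 hχ1 (by omega)
    have hp2 : 0 ≤ χ t ^ (j + 1) := pow_nonneg hχ0 _
    by_cases ht : t ∈ Set.Icc (0:ℝ) 1
  · have hz : cutZ (j + 2) t = χ t ^ j := by simp [cutZ, Set.indicator_of_mem ht, hχ]
    rw [hz, abs_mul, abs_mul, abs_of_nonneg hn0, abs_of_nonneg hp2]
    calc n * χ t ^ (j + 1) * |deriv χ t| ≤ n * χ t ^ j * C1 := by gcongr; exact hb1 t
      _ = n * C1 * χ t ^ j := by ring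
      _ ≤ _ := by
        gcongr
        have : 0 ≤ n * n * C1 ^ 2 + n * C2 + 1 := by positivity
        linarith
  · beta_reduce; rw [hz1 t ht]; simp [cutZ, Set.indicator_of_notMem ht]
  · have hz : cutZ (j + 2) t = χ t ^ j := by simp [cutZ, Set.indicator_of_mem ht, hχ]
    have hj : ((j + 1 : ℕ) : ℝ) ≤ n := by rw [hn']; exact_mod_cast (by omega)
    rw [hz]
    refine (abs_add_le _ _).trans ?_
    simp only [abs_mul, abs_of_nonneg hn0, abs_of_nonneg hp2, abs_of_nonneg hp, Nat.abs_cast]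
    calc n * (((j + 1 : ℕ) : ℝ) * χ t ^ j * |deriv χ t|) * |deriv χ t| + n * χ t ^ (j + 1) * |deriv (deriv χ) t|
        ≤ n * (n * χ t ^ j * C1) * C1 + n * χ t ^ j * C2 := by
          gcongr
          · exact hb1 t
          · exact hb1 t
          · exact hb2 t
      _ = (n * n * C1 ^ 2 + n * C2) * χ t ^ j := by ring
      _ ≤ _ := by
        apply mul_le_mul_of_nonneg_right _ hp
        have : 0 ≤ n * C1 + 1 := by positivity
        linarith
  · beta_reduce; rw [hz1 t ht, hz2 t ht]; simp [cutZ, Set.indicator_of_notMem ht]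

lemma HasJ.add_const' {N : ℕ} {f : Euc N → ℝ} {x g : Euc N} {L : ℝ} (h : HasJ f x g L) (c : ℝ) :
    HasJ (fun y => f y + c) x g L :=
  (h.add (HasJ.const c x)).cast (by simp) (by simp)

lemma core_jet {N : ℕ} {l ρ : Euc N → ℝ} {x gl gr : Euc N} {Ll Lr : ℝ} {θ θ1 : ℝ → ℝ} {θ2 α κ β b c : ℝ}
    (hl : HasJ l x gl Ll) (hr : HasJ ρ x gr Lr) (hθ : ContDiff ℝ 2 θ)
    (h1 : ∀ t, HasDerivAt θ (θ1 t) t) (h2 : HasDerivAt θ1 θ2 (ρ x + b)) :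
    ∃ g L, HasJ (fun y => Real.exp (-(α/2) * l y) *
      tG (Real.exp (Real.exp (β * ρ y) * l y + (-(κ/2)) * ρ y) * θ (ρ y + b) + (-c))) x g L ∧
    ∃ gw : Euc N, gw = Real.exp (β * ρ x) • gl + (β * Real.exp (β * ρ x) * l x - κ/2) • gr ∧
    ∀ a B t : ℝ, a = Real.exp (β * ρ x) → B = Real.exp (a * l x + (-(κ/2)) * ρ x) →
      t = B * θ (ρ x + b) + (-c) →
    Real.exp (-(α/2) * l x) * (tG1 t * (B * (θ (ρ x + b) *
      (a * Ll + l x * (a * (β * Lr + β^2 * ⟪gr, gr⟫)) + 2 * (β * a * ⟪gr, gl⟫) - κ/2 * Lr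
        + ⟪gw, gw⟫ - α * ⟪gl, gw⟫)
      + (θ2 * ⟪gr, gr⟫ + θ1 (ρ x + b) * Lr + 2 * θ1 (ρ x + b) * ⟪gw, gr⟫
        - α * θ1 (ρ x + b) * ⟪gr, gl⟫)))
      + (α^2/4 * ⟪gl, gl⟫ - α/2 * Ll) * tG t) ≤ L := by
  have ja := (hr.const_mul β).exp
  have jw := (ja.mul hl).add (hr.const_mul (-(κ/2)))
  have jB := jw.exp
  have jE := (hr.add_const' b).comp (hθ.contDiffAt) (Eventually.of_forall h1) h2
  have jt := ((jB.mul jE).add_const' (-c)).tG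
  have jp := (hl.const_mul (-(α/2))).exp.mul jt
  refine ⟨_, _, jp, _, rfl, ?_⟩
  intro a B t ha hB ht
  subst ha
  rw [← hB, ← ht]
  have hT := mul_nonneg (Real.exp_pos (-(α/2) * l x)).le (mul_nonneg (tG2_nonneg t) (real_inner_self_nonneg (x := B • θ1 (ρ x + b) • gr +
    θ (ρ x + b) • B • (Real.exp (β * ρ x) • gl + l x • Real.exp (β * ρ x) • β • gr + -(κ/2) • gr))))
  refine le_of_sub_nonneg ?_
  refine hT.trans (le_of_eq ?_)
  simp only [inner_add_left, inner_add_right, real_inner_smul_left, real_inner_smul_right, real_inner_comm gr gl]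
  ring

lemma mul_neg_log_le {d : ℝ} (hd : 0 < d) : d * (-Real.log (d^2)) ≤ 4 * Real.sqrt d := by
  have hs : 0 < Real.sqrt d := Real.sqrt_pos.2 hd
  have h1 : Real.log (Real.sqrt d)⁻¹ ≤ (Real.sqrt d)⁻¹ - 1 := Real.log_le_sub_one_of_pos (inv_pos.2 hs)
  rw [Real.log_inv, Real.log_sqrt hd.le] at h1
  have h2 : -Real.log (d^2) ≤ 4 * (Real.sqrt d)⁻¹ := by
    rw [Real.log_pow]; push_cast; linarith
  have h3 : d * (Real.sqrt d)⁻¹ = Real.sqrt d := by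
    rw [← div_eq_mul_inv]; exact Real.div_sqrt
  calc d * (-Real.log (d^2)) ≤ d * (4 * (Real.sqrt d)⁻¹) := by gcongr
    _ = 4 * (d * (Real.sqrt d)⁻¹) := by ring
    _ = _ := by rw [h3]

lemma bracket_nonneg {k a lam : ℝ} (hk : 1 ≤ k) (ha : 0 < a) (ha1 : a ≤ 1/16) (hl : 32 ≤ lam) :
    0 ≤ a * lam * (k/4 - 1/16) + a * (1 - 4*k) - a^2 * lam + 1/16 * a^2 * lam^2 := by
  have h1 : a * lam ≤ lam / 16 := by nlinarith
  have h2 : 0 ≤ lam * (k/4 - 1/16) + (1 - 4*k) - lam/16 := by nlinarith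
  have h3 : 0 ≤ a * (lam * (k/4 - 1/16) + (1 - 4*k) - a * lam) := by
    apply mul_nonneg ha.le; linarith
  have h4 : 0 ≤ a^2 * lam^2 := by positivity
  nlinarith

set_option maxHeartbeats 2000000 in
lemma Ew_lower {C K Kp k α : ℝ} (hC : 1 ≤ C) (hK : 0 ≤ K) (hKp : 0 ≤ Kp) (hk : 1 ≤ k) (hα : 0 < α) :
    ∃ a0, 0 < a0 ∧ a0 ≤ 1/16 ∧ ∀ X d a lam e1 e3 e4 : ℝ, 0 < d → d ≤ C * X → 0 < a → a ≤ a0 → a^4 = X →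
      lam = -Real.log (d^2) → 32 ≤ lam → |e1| ≤ K / d → |e3| ≤ K * X / d^2 → |e4| ≤ K * X / d^2 →
      Kp * X / d^2 ≤ a * (4*α/d^2 + e4) + (-lam) * (a * (1/8 * ((2*k+4*α)/X^2) + (1/8)^2 * (4/X^2)))
        + 2 * (1/8 * a * (4/X^2 + e1)) - k/2 * ((2*k+4*α)/X^2)
        + (a^2 * (4/d^2 + e3) + 2 * a * (1/8 * a * (-lam) - k/2) * (4/X^2+e1) + (1/8*a*(-lam) - k/2)^2 * (4/X^2))
        - α * (a * (4/d^2+e3) + (1/8*a*(-lam) - k/2) * (4/X^2+e1)) := by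
  obtain ⟨M, hM⟩ : ∃ M, M = K * (2 + α) + K * C * (1/4 + k + α*k/2) + 4 * K * C * (1/4 + α/8) + Kp := ⟨_, rfl⟩
  have hM0 : 0 ≤ M := by rw [hM]; positivity
  refine ⟨min (1/16) (4/(M+1)), by positivity, min_le_left _ _, ?_⟩
  intro X d a lam e1 e3 e4 hd hdC ha ha0 hX hlam h32 h1 h3 h4
  have ha16 : a ≤ 1/16 := ha0.trans (min_le_left _ _)
  have haM : a * M ≤ 4 := by
    have : a ≤ 4/(M+1) := ha0.trans (min_le_right _ _)
    rw [le_div_iff₀ (by positivity)] at this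
    nlinarith
  have hX0 : 0 < X := by rw [← hX]; positivity
  have hl0 : 0 ≤ lam := by linarith
  have hdl : d * lam ≤ 4 * C * a^2 := by
    rw [hlam]
    refine (mul_neg_log_le hd).trans ?_
    have : Real.sqrt d ≤ C * a^2 := by
      apply Real.sqrt_le_iff.2 ⟨by positivity, ?_⟩
      calc d ≤ C * X := hdC
        _ = C * a^4 := by rw [hX]
        _ ≤ C^2 * a^4 := by
          have : C ≤ C^2 := by nlinarith
          gcongr
        _ = _ := by ring
    linarith
  obtain ⟨f1, hf1⟩ : ∃ f1, f1 = e1 * d^2 := ⟨_, rfl⟩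
  obtain ⟨f3, hf3⟩ : ∃ f3, f3 = e3 * d^2 := ⟨_, rfl⟩
  obtain ⟨f4, hf4⟩ : ∃ f4, f4 = e4 * d^2 := ⟨_, rfl⟩
  have b1 : |f1| ≤ K * d := by
    rw [hf1, abs_mul, abs_of_pos (by positivity : 0 < d^2)]
    calc |e1| * d^2 ≤ K/d * d^2 := by gcongr
      _ = K * d := by field_simp
  have b3 : |f3| ≤ K * X := by
    rw [hf3, abs_mul, abs_of_pos (by positivity : 0 < d^2)]
    calc |e3| * d^2 ≤ K*X/d^2 * d^2 := by gcongr
      _ = K * X := by field_simp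
  have b4 : |f4| ≤ K * X := by
    rw [hf4, abs_mul, abs_of_pos (by positivity : 0 < d^2)]
    calc |e4| * d^2 ≤ K*X/d^2 * d^2 := by gcongr
      _ = K * X := by field_simp
  have e1' : e1 = f1 / d^2 := by rw [hf1]; field_simp
  have e3' : e3 = f3 / d^2 := by rw [hf3]; field_simp
  have e4' : e4 = f4 / d^2 := by rw [hf4]; field_simp
  -- bounds for the individual errors
  have ha1 : a ≤ 1 := by linarith
  have a43 : a^4 ≤ a^3 := pow_le_pow_of_le_one ha.le ha1 (by norm_num)
  have a53 : a^5 ≤ a^3 := pow_le_pow_of_le_one ha.le ha1 (by norm_num)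
  have a63 : a^6 ≤ a^3 := pow_le_pow_of_le_one ha.le ha1 (by norm_num)
  have a74 : a^7 ≤ a^3 := pow_le_pow_of_le_one ha.le ha1 (by norm_num)
  have g4 : -(K * a^3) ≤ a * f4 := by
    have : a * f4 ≥ a * (-(K*X)) := by have := (abs_le.1 b4).1; gcongr
    rw [← hX] at this
    have h9 := mul_le_mul_of_nonneg_left a53 hK
    have h10 : a * (-(K * a^4)) = -(K * a^5) := by ring
    linarith
  have g3 : -(K * a^3) ≤ a^2 * f3 := by
    have : a^2 * f3 ≥ a^2 * (-(K*X)) := by have := (abs_le.1 b3).1; gcongr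
    rw [← hX] at this
    have h9 := mul_le_mul_of_nonneg_left a63 hK
    have h10 : a^2 * (-(K * a^4)) = -(K * a^6) := by ring
    linarith
  have g3' : -(α * K * a^3) ≤ -(α * a * f3) := by
    have : α * a * f3 ≤ α * a * (K*X) := by have := (abs_le.1 b3).2; gcongr
    rw [← hX] at this
    have h9 := mul_le_mul_of_nonneg_left a53 (mul_nonneg hα.le hK)
    have h10 : α * a * (K * a^4) = α * K * a^5 := by ring
    linarith
  have hq : |1/4 * a - 1/4*a^2*lam - k*a + α/8*a*lam + α*k/2| ≤ (1/4 + k + α*k/2) + (1/4+α/8) * (a*lam) := by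
    have hal : 0 ≤ a * lam := by positivity
    have hal2 : a^2 * lam ≤ a * lam := by
      have : a^2 ≤ a := by nlinarith
      gcongr
    have hal2' : 0 ≤ a^2 * lam := by positivity
    have hka : k * a ≤ k := by nlinarith
    have hka' : 0 ≤ k * a := by positivity
    have hak : 0 ≤ α * k := by positivity
    have hal3 : 0 ≤ α * (a*lam) := by positivity
    rw [abs_le]; constructor <;> nlinarith
  have g1 : -((K * C * (1/4 + k + α*k/2) + 4 * K * C * (1/4+α/8)) * a^3) ≤
      f1 * (1/4 * a - 1/4*a^2*lam - k*a + α/8*a*lam + α*k/2) := by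
    refine neg_le_of_neg_le ?_
    refine (neg_le_abs _).trans ?_
    rw [abs_mul]
    calc |f1| * _ ≤ K * d * ((1/4 + k + α*k/2) + (1/4+α/8) * (a*lam)) := by gcongr
      _ = K * (1/4 + k + α*k/2) * d + K * (1/4+α/8) * (a * (d*lam)) := by ring
      _ ≤ K * (1/4 + k + α*k/2) * (C * a^3) + K * (1/4+α/8) * (a * (4*C*a^2)) := by
        have : d ≤ C * a^3 := by
          rw [← hX] at hdC
          exact hdC.trans (by gcongr)
        gcongr
      _ = _ := by ring
  have hbr := bracket_nonneg hk ha ha16 h32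
  have key : Kp * X ≤ 4 * a^2 + a * f4 + a^2 * f3 - α * a * f3 + 
      f1 * (1/4 * a - 1/4*a^2*lam - k*a + α/8*a*lam + α*k/2) := by
    have : Kp * X ≤ Kp * a^3 := by rw [← hX]; gcongr
    have h5 : M * a^3 ≤ 4 * a^2 := by
      have := mul_le_mul_of_nonneg_right haM (sq_nonneg a)
      nlinarith
    rw [hM] at h5
    nlinarith
  have h6 : Kp * X / d^2 ≤ (4 * a^2 + a * f4 + a^2 * f3 - α * a * f3 + 
      f1 * (1/4 * a - 1/4*a^2*lam - k*a + α/8*a*lam + α*k/2)) / d^2 := by gcongr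
  have h7 : 0 ≤ (a * lam * (k/4 - 1/16) + a * (1 - 4*k) - a^2 * lam + 1/16 * a^2 * lam^2) / X^2 := by positivity
  refine (le_add_of_le_of_nonneg h6 h7).trans (le_of_eq ?_)
  rw [e1', e3', e4']
  field_simp
  ring

lemma Z_bound {C K k α : ℝ} (hC : 1 ≤ C) (hK : 0 ≤ K) (hk : 1 ≤ k) (hα : 0 < α) :
    ∃ M, 0 < M ∧ ∀ X d a lam e1 t1 t2 ζ : ℝ, 0 < d → d ≤ C * X → 0 < X → X ≤ 1 → 0 < a → a ≤ 1 → 0 ≤ lam →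
      |e1| ≤ K / d → |t1| ≤ ζ → |t2| ≤ ζ →
      |t2 * (4/X^2) + t1 * ((2*k+4*α)/X^2) + 2 * t1 * (a * (4/X^2+e1) + (1/8*a*(-lam) - k/2) * (4/X^2))
        - α * t1 * (4/X^2+e1)| ≤ M * ((1 + a*lam) * ζ / (X * d)) := by
  refine ⟨C * (13 + 6*k + 8*α) + (2 + α) * K, by positivity, ?_⟩
  intro X d a lam e1 t1 t2 ζ hd hdC hX hX1 ha ha1 hl h1 ht1 ht2
  have hζ : 0 ≤ ζ := (abs_nonneg _).trans ht1
  have hR : 1/X^2 ≤ C * (1/(X*d)) := by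
    rw [mul_one_div, div_le_div_iff₀ (by positivity) (by positivity)]
    nlinarith
  have he : |e1| ≤ K * (1/(X*d)) := by
    refine h1.trans ?_
    rw [mul_one_div]
    gcongr
    nlinarith
  have hal : 0 ≤ a * lam := by positivity
  obtain ⟨Q, hQ⟩ : ∃ Q, Q = 1/X^2 := ⟨_, rfl⟩
  obtain ⟨S, hS⟩ : ∃ S, S = 1/(X*d) := ⟨_, rfl⟩
  have hQ0 : 0 < Q := by rw [hQ]; positivity
  have hS0 : 0 < S := by rw [hS]; positivity
  rw [← hQ, ← hS] at hR
  rw [← hS] at he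
  have e : t2 * (4/X^2) + t1 * ((2*k+4*α)/X^2) + 2 * t1 * (a * (4/X^2+e1) + (1/8*a*(-lam) - k/2) * (4/X^2))
        - α * t1 * (4/X^2+e1) = t2 * (4*Q) + t1 * (Q * (2*k + 4*α + 8*a - a*lam - 4*k - 4*α) + e1 * (2*a - α)) := by
    rw [hQ]; field_simp; ring
  have e' : (1 + a*lam) * ζ / (X * d) = (1+a*lam) * ζ * S := by rw [hS]; field_simp
  rw [e, e']
  have h2 : |Q * (2*k + 4*α + 8*a - a*lam - 4*k - 4*α) + e1 * (2*a - α)| ≤ Q * (8 + 2*k + a*lam) + |e1| * (2+α) := by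
    refine (abs_add_le _ _).trans ?_
    rw [abs_mul, abs_mul, abs_of_pos hQ0]
    gcongr
    · rw [abs_le]; constructor <;> nlinarith
    · rw [abs_le]; constructor <;> nlinarith
  refine (abs_add_le _ _).trans ?_
  rw [abs_mul t2, abs_mul t1, abs_of_pos (by positivity : 0 < 4*Q)]
  calc |t2| * (4*Q) + |t1| * _ ≤ ζ * (4*(C*S)) + ζ * ((C*S) * (8 + 2*k + a*lam) + K*S*(2+α)) := by
        gcongr
        refine h2.trans ?_
        gcongr
    _ = ζ * S * (C * (12 + 2*k + a*lam) + K*(2+α)) := by ring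
    _ ≤ ζ * S * ((C * (13 + 6*k + 8*α) + (2 + α) * K) * (1 + a*lam)) := by
        gcongr
        have : 0 ≤ C * k := by positivity
        have : 0 ≤ C * α := by positivity
        have : 0 ≤ (2+α)*K := by positivity
        nlinarith [mul_nonneg (by positivity : 0 ≤ C*(12+6*k+8*α) + (2+α)*K) hal]
    _ = _ := by ring

/-- `log ‖h‖²` -/
def fL {N : ℕ} (h : Euc N → Euc N) (y : Euc N) : ℝ := Real.log (‖h y‖ ^ 2)
/-- `log ‖x-σ‖²` -/
def fR {N : ℕ} (σ : Euc N) (y : Euc N) : ℝ := Real.log (‖y - σ‖ ^ 2)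
/-- `‖x-σ‖^{1/4}` -/
def fA {N : ℕ} (σ : Euc N) (y : Euc N) : ℝ := Real.exp (1/8 * fR σ y)
/-- the weight -/
def fB {N : ℕ} (k : ℝ) (σ : Euc N) (h : Euc N → Euc N) (y : Euc N) : ℝ :=
  Real.exp (fA σ y * fL h y + (-(k/2)) * fR σ y)
/-- the weight with cutoff -/
def fP {N : ℕ} (k : ℝ) (n : ℕ) (σ : Euc N) (h : Euc N → Euc N) (s : ℝ) (y : Euc N) : ℝ :=
  fB k σ h y * cutT n (fR σ y + -(2 * Real.log s))
/-- the test function, before extension by zero -/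
def f0 {N : ℕ} (α k : ℝ) (n : ℕ) (σ : Euc N) (h : Euc N → Euc N) (c s : ℝ) (y : Euc N) : ℝ :=
  Real.exp (-(α/2) * fL h y) * tG (fP k n σ h s y + -c)
/-- the error term -/
def fE {N : ℕ} (α k : ℝ) (n : ℕ) (σ : Euc N) (h : Euc N → Euc N) (c s : ℝ) (y : Euc N) : ℝ :=
  Real.exp (-(α/2) * fL h y) * (tG1 (fP k n σ h s y + -c) * (fB k σ h y *
    ((1 + fA σ y * (-fL h y)) * cutZ n (fR σ y + -(2 * Real.log s)) / (‖y - σ‖ * ‖h y‖))))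

lemma fA_pos {N : ℕ} (σ y : Euc N) : 0 < fA σ y := Real.exp_pos _
lemma fB_pos {N : ℕ} (k : ℝ) (σ : Euc N) (h : Euc N → Euc N) (y : Euc N) : 0 < fB k σ h y := Real.exp_pos _

lemma fA_pow {N : ℕ} {σ y : Euc N} (h : 0 < ‖y - σ‖) : fA σ y ^ 4 = ‖y - σ‖ := by
  rw [fA, ← Real.exp_nat_mul, fR, Real.log_pow]
  rw [show ((4:ℕ):ℝ) * (1/8 * (((2:ℕ):ℝ) * Real.log ‖y - σ‖)) = Real.log ‖y - σ‖ by push_cast; ring]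
  exact Real.exp_log h

lemma final_alg {ee g1 g0 B θ EE ZZ κ pp vv M S : ℝ} (hee : 0 ≤ ee) (hg1 : 0 ≤ g1) (hB : 0 ≤ B) (hθ : 0 ≤ θ)
    (hg0 : 0 ≤ g0) (hκ : 0 ≤ κ) (hE : κ ≤ EE) (hZ : -(M * S) ≤ ZZ) (hp : -κ ≤ pp + vv) (hg : g0 ≤ B * θ * g1) :
    -(M * (ee * (g1 * (B * S)))) ≤ ee * (g1 * (B * (θ * EE + ZZ)) + pp * g0) + vv * (ee * g0) := by
  have h1 : κ * (g1 * B * θ) ≤ EE * (g1 * B * θ) := by gcongr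
  have h2 : (-(M*S)) * (g1 * B) ≤ ZZ * (g1 * B) := by gcongr
  have h3 : (-κ) * g0 ≤ (pp + vv) * g0 := by gcongr
  have h4 : κ * g0 ≤ κ * (B * θ * g1) := by gcongr
  have h5 : -(M * (g1 * (B * S))) ≤ g1 * (B * (θ * EE + ZZ)) + pp * g0 + vv * g0 := by nlinarith
  have h6 := mul_le_mul_of_nonneg_left h5 hee
  nlinarith

set_option maxHeartbeats 1000000 in
lemma ptwise {N m k : ℕ} {Γ U : Set (Euc N)} {σ : Euc N} {V : Submodule ℝ (Euc N)}
    {h : Euc N → Euc N} (hc : IsChart Γ σ m V h U) {C r : ℝ} (he : ChartEst Γ σ V h U C r)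
    (hr : r ≤ 1) (hm : 3 ≤ m) (hk : 1 ≤ k) (hN : m + k = N) {n : ℕ} (hn : 2 ≤ n)
    {α Kp : ℝ} (hα : 2 * α = m - 2) (hKp : 0 ≤ Kp) :
    ∃ r1 M : ℝ, 0 < r1 ∧ r1 ≤ r ∧ 0 < M ∧ ∀ x ∈ ball σ r1, h x ≠ 0 → 0 < ‖x - σ‖ ∧ 32 ≤ - fL h x ∧
      fA σ x ≤ 1 ∧ ∀ s c : ℝ, 0 ≤ c →
      -(M * fE α k n σ h c s x) ≤ lap (f0 α k n σ h c s) x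
        + α^2 * (1 - Kp * ‖x - σ‖) / ‖h x‖^2 * f0 α k n σ h c s x := by
  have hC1 := he.C1
  obtain ⟨K, hK1, hJ⟩ := jets hc he hr
  have hK0 : 0 ≤ K := by linarith
  have hα0 : 0 < α := by
    have : (3:ℝ) ≤ m := by exact_mod_cast hm
    linarith
  have hk' : (1:ℝ) ≤ k := by exact_mod_cast hk
  have hN' : (m:ℝ) + k = N := by exact_mod_cast hN
  obtain ⟨K', hK'⟩ : ∃ K', K' = α^2*K/4 + α*K/2 + α^2*Kp := ⟨_, rfl⟩
  have hK'0 : 0 ≤ K' := by rw [hK']; positivity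
  obtain ⟨a0, ha0, ha01, hEw⟩ := Ew_lower hC1 hK0 hK'0 hk' hα0
  obtain ⟨MZ, hMZ, hZ⟩ := Z_bound hC1 hK0 hk' hα0
  obtain ⟨θ1, θ2, CT, hCT, hd1, hd2, hb1, hb2⟩ := cut_bounds hn
  refine ⟨min r (min (a0^4) (Real.exp (-16) / C)), MZ * CT, ?_, min_le_left _ _, by positivity, ?_⟩
  · have := he.r0; positivity
  intro x hx hx0
  rw [mem_ball, dist_eq_norm, lt_min_iff, lt_min_iff] at hx
  obtain ⟨hxr, hxa, hxC⟩ := hx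
  obtain ⟨gl, gr, e1, e3, e4, J⟩ := hJ x (by rwa [mem_ball, dist_eq_norm]) hx0
  have hX : 0 < ‖x - σ‖ := by
    rw [norm_pos_iff]
    intro h0
    rw [sub_eq_zero] at h0
    rw [h0] at hx0
    exact hx0 hc.h0
  have hd : 0 < ‖h x‖ := norm_pos_iff.2 hx0
  have hdC : ‖h x‖ ≤ C * ‖x - σ‖ := he.hh x (by rwa [mem_ball, dist_eq_norm])
  have hX1 : ‖x - σ‖ ≤ 1 := by linarith
  have h32 : 32 ≤ - fL h x := by
    have h1 : ‖h x‖ ≤ Real.exp (-16) := by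
      refine hdC.trans ?_
      rw [lt_div_iff₀ (by positivity)] at hxC
      linarith
    have h2 := Real.log_le_log hd h1
    rw [Real.log_exp] at h2
    rw [fL, Real.log_pow]; push_cast; linarith
  have haa : fA σ x ≤ a0 := by
    rw [← fA_pow hX] at hxa
    exact (lt_of_pow_lt_pow_left₀ 4 ha0.le hxa).le
  have hA := fA_pos σ x
  refine ⟨hX, h32, by linarith, ?_⟩
  intro s c hc0
  obtain ⟨g, L, jp, gw, hgw, hL⟩ := core_jet (α := α) (κ := k) (β := 1/8) (b := -(2 * Real.log s)) (c := c)
    J.jl J.jr (cutT_contDiff n (j := 2)) hd1 (hd2 _)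
  have hlap : lap (f0 α k n σ h c s) x = L := jp.2.2
  rw [hlap]
  have hL' := hL (fA σ x) (fB k σ h x) (fP k n σ h s x + -c) rfl rfl rfl
  change Real.exp (-(α/2) * fL h x) * (tG1 (fP k n σ h s x + -c) * (fB k σ h x *
    (cutT n (fR σ x + -(2 * Real.log s)) *
      (fA σ x * ((2 * m - 4) / ‖h x‖ ^ 2 + e4) + fL h x * (fA σ x * (1/8 * ((2 * N - 4) / ‖x - σ‖ ^ 2)
      + (1/8)^2 * ⟪gr, gr⟫)) + 2 * (1/8 * fA σ x * ⟪gr, gl⟫) - k/2 * ((2 * N - 4) / ‖x - σ‖ ^ 2)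
        + ⟪gw, gw⟫ - α * ⟪gl, gw⟫)
      + (θ2 (fR σ x + -(2 * Real.log s)) * ⟪gr, gr⟫ + θ1 (fR σ x + -(2 * Real.log s)) * ((2 * N - 4) / ‖x - σ‖ ^ 2)
        + 2 * θ1 (fR σ x + -(2 * Real.log s)) * ⟪gw, gr⟫
        - α * θ1 (fR σ x + -(2 * Real.log s)) * ⟪gr, gl⟫)))
      + (α^2/4 * ⟪gl, gl⟫ - α/2 * ((2 * m - 4) / ‖h x‖ ^ 2 + e4)) * tG (fP k n σ h s x + -c)) ≤ L at hL'
  refine le_trans ?_ (add_le_add_left hL' _)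
  have hgw' : gw = fA σ x • gl + (1/8 * fA σ x * fL h x - k/2) • gr := hgw
  have hlr : ⟪gl, gr⟫ = ⟪gr, gl⟫ := real_inner_comm _ _
  have hww : ⟪gw, gw⟫ = fA σ x^2 * (4/‖h x‖^2+e3) + 2 * fA σ x * (1/8 * fA σ x * fL h x - k/2) * (4/‖x-σ‖^2+e1)
      + (1/8 * fA σ x * fL h x - k/2)^2 * (4/‖x-σ‖^2) := by
    rw [hgw', ← J.ll, ← J.rl, ← J.rr]
    simp only [inner_add_left, inner_add_right, real_inner_smul_left, real_inner_smul_right, hlr]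
    ring
  have hlw : ⟪gl, gw⟫ = fA σ x * (4/‖h x‖^2+e3) + (1/8 * fA σ x * fL h x - k/2) * (4/‖x-σ‖^2+e1) := by
    rw [hgw', ← J.ll, ← J.rl]
    simp only [inner_add_left, inner_add_right, real_inner_smul_left, real_inner_smul_right, hlr]
  have hwr : ⟪gw, gr⟫ = fA σ x * (4/‖x-σ‖^2+e1) + (1/8 * fA σ x * fL h x - k/2) * (4/‖x-σ‖^2) := by
    rw [hgw', ← J.rl, ← J.rr]
    simp only [inner_add_left, inner_add_right, real_inner_smul_left, real_inner_smul_right, hlr]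
  rw [hww, hlw, hwr, J.ll, J.rl, J.rr]
  have e2N : (2 * (N:ℝ) - 4) = 2*k + 4*α := by linarith
  have e2m : (2 * (m:ℝ) - 4) = 4*α := by linarith
  rw [e2N, e2m]
  have hE := hEw ‖x-σ‖ ‖h x‖ (fA σ x) (-fL h x) e1 e3 e4 hd hdC hA haa (fA_pow hX) rfl h32 J.b1 J.b3 J.b4
  have hZ' := hZ ‖x-σ‖ ‖h x‖ (fA σ x) (-fL h x) e1 _ _ (CT * cutZ n (fR σ x + -(2 * Real.log s))) hd hdC hX hX1
    hA (by linarith) (by linarith) J.b1 (hb1 (fR σ x + -(2 * Real.log s))) (hb2 (fR σ x + -(2 * Real.log s)))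
  rw [neg_neg] at hE hZ'
  have hZ'' := (abs_le.1 hZ').1
  generalize hEE : (_ - _ : ℝ) = EE at hE
  generalize hZZ : (_ - _ : ℝ) = ZZ at hZ''
  have hP : fP k n σ h s x = fB k σ h x * cutT n (fR σ x + -(2 * Real.log s)) := rfl
  have hB := fB_pos k σ h x
  have hθ := cutT_nonneg n (fR σ x + -(2 * Real.log s))
  have ht1 := tG1_nonneg (fP k n σ h s x + -c)
  have htle : tG (fP k n σ h s x + -c) ≤ fB k σ h x * cutT n (fR σ x + -(2 * Real.log s)) * tG1 (fP k n σ h s x + -c) := by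
    refine (tG_le _).trans ?_
    rw [← hP]
    gcongr
    linarith
  have ht0 := tG_nonneg (fP k n σ h s x + -c)
  have hpot : -(K' * ‖x-σ‖/‖h x‖^2) ≤ (α^2/4 * (4/‖h x‖^2+e3) - α/2 * (4*α/‖h x‖^2+e4))
      + α^2 * (1 - Kp * ‖x-σ‖)/‖h x‖^2 := by
    have h3 := (abs_le.1 J.b3).1
    have h4 := (abs_le.1 J.b4).2
    have h3' := mul_le_mul_of_nonneg_left h3 (by positivity : 0 ≤ α^2/4)
    have h4' := mul_le_mul_of_nonneg_left h4 (by positivity : 0 ≤ α/2)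
    have e : (α^2/4 * (4/‖h x‖^2+e3) - α/2 * (4*α/‖h x‖^2+e4))
      + α^2 * (1 - Kp * ‖x-σ‖)/‖h x‖^2 = α^2/4*e3 - α/2*e4 - α^2*Kp*‖x-σ‖/‖h x‖^2 := by
      field_simp; ring
    rw [e, hK']
    have e' : -((α^2*K/4 + α*K/2 + α^2*Kp) * ‖x-σ‖/‖h x‖^2) = α^2/4*(-(K*‖x-σ‖/‖h x‖^2)) - α/2*(K*‖x-σ‖/‖h x‖^2)
      - α^2*Kp*‖x-σ‖/‖h x‖^2 := by field_simp; ring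
    rw [e']; linarith
  rw [f0, fE]
  have hκ : 0 ≤ K' * ‖x-σ‖/‖h x‖^2 := by positivity
  have eZ : MZ * ((1 + fA σ x * -fL h x) * (CT * cutZ n (fR σ x + -(2 * Real.log s))) / (‖x - σ‖ * ‖h x‖))
      = MZ * CT * ((1 + fA σ x * -fL h x) * cutZ n (fR σ x + -(2 * Real.log s)) / (‖x - σ‖ * ‖h x‖)) := by
    field_simp
  rw [eZ] at hZ''
  exact final_alg (Real.exp_pos _).le ht1 hB.le hθ ht0 hκ hE hZ'' hpot htle

/-- the domain of the test functions -/
def fO {N : ℕ} (σ : Euc N) (h : Euc N → Euc N) (r : ℝ) : Set (Euc N) := ball σ r ∩ {x | h x ≠ 0}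
/-- the level -/
def cR (k r : ℝ) : ℝ := Real.exp (-(k/2) * Real.log ((r/2)^2))
/-- the test function -/
def fPhi {N : ℕ} (α k : ℝ) (n : ℕ) (σ : Euc N) (h : Euc N → Euc N) (r s : ℝ) : Euc N → ℝ :=
  (fO σ h r).indicator (f0 α k n σ h (cR k r) s)

lemma fO_open {N : ℕ} {σ : Euc N} {h : Euc N → Euc N} (hh : Continuous h) (r : ℝ) : IsOpen (fO σ h r) :=
  isOpen_ball.inter (isOpen_ne_fun hh continuous_const)

lemma cR_pos (k r : ℝ) : 0 < cR k r := Real.exp_pos _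
lemma cR_ge {k r : ℝ} (hk : 0 ≤ k) (hr : 0 < r) (hr1 : r ≤ 1) : 1 ≤ cR k r := by
  rw [cR]
  apply Real.one_le_exp
  have : Real.log ((r/2)^2) ≤ 0 := Real.log_nonpos (by positivity) (by nlinarith)
  nlinarith

lemma fPhi_nonneg {N : ℕ} (α k : ℝ) (n : ℕ) (σ : Euc N) (h : Euc N → Euc N) (r s : ℝ) (x : Euc N) :
    0 ≤ fPhi α k n σ h r s x :=
  Set.indicator_nonneg (fun x _ => mul_nonneg (Real.exp_pos _).le (tG_nonneg _)) x

lemma fPhi_mono {N : ℕ} (α k : ℝ) (n : ℕ) (σ : Euc N) (h : Euc N → Euc N) (r : ℝ) {s s' : ℝ} (hs' : 0 < s')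
    (hs : s' ≤ s) (x : Euc N) : fPhi α k n σ h r s x ≤ fPhi α k n σ h r s' x := by
  unfold fPhi
  apply Set.indicator_le_indicator
  unfold f0 fP
  have h1 : Real.log s' ≤ Real.log s := Real.log_le_log hs' hs
  apply mul_le_mul_of_nonneg_left _ (Real.exp_pos _).le
  apply tG_mono
  have := cutT_mono n (by linarith : fR σ x + -(2 * Real.log s) ≤ fR σ x + -(2 * Real.log s'))
  have := mul_le_mul_of_nonneg_left this (fB_pos k σ h x).le
  linarith

lemma fL_smooth {N : ℕ} {h : Euc N → Euc N} (hh : ContDiff ℝ (⊤:ℕ∞) h) {x : Euc N} (hx : h x ≠ 0) :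
    ContDiffAt ℝ (⊤:ℕ∞) (fL h) x := by
  apply ContDiffAt.log (hh.contDiffAt.norm_sq ℝ)
  have := norm_pos_iff.2 hx
  positivity

lemma fR_smooth {N : ℕ} {σ x : Euc N} (hx : x ≠ σ) : ContDiffAt ℝ (⊤:ℕ∞) (fR σ) x := by
  have := fL_smooth (h := fun y => y - σ) (contDiff_id.sub contDiff_const) (x := x) (sub_ne_zero.2 hx)
  exact this

lemma f0_smooth {N : ℕ} {α k : ℝ} {n : ℕ} {σ : Euc N} {h : Euc N → Euc N} {c s : ℝ}
    (hh : ContDiff ℝ (⊤:ℕ∞) h) {x : Euc N} (hx : h x ≠ 0) (hσ : x ≠ σ) :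
    ContDiffAt ℝ (⊤:ℕ∞) (f0 α k n σ h c s) x := by
  have h1 := fL_smooth hh hx
  have h2 := fR_smooth hσ
  have hA : ContDiffAt ℝ (⊤:ℕ∞) (fA σ) x := (contDiffAt_const.mul h2).exp
  have hB : ContDiffAt ℝ (⊤:ℕ∞) (fB k σ h) x := ((hA.mul h1).add (contDiffAt_const.mul h2)).exp
  have hT : ContDiffAt ℝ (⊤:ℕ∞) (fun y => cutT n (fR σ y + -(2 * Real.log s))) x :=
    (cutT_contDiff n (j := ⊤)).contDiffAt.comp x (h2.add contDiffAt_const)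
  have hP : ContDiffAt ℝ (⊤:ℕ∞) (fun y => tG (fP k n σ h s y + -c)) x :=
    (tG_contDiff (n := ⊤)).contDiffAt.comp x ((hB.mul hT).add contDiffAt_const)
  exact (contDiffAt_const.mul h1).exp.mul hP

/-- a compact set outside of which the test function vanishes -/
lemma fPhi_compact {N : ℕ} {α k : ℝ} {n : ℕ} {σ : Euc N} {h : Euc N → Euc N} {r s : ℝ}
    (hn : 2 ≤ n) (hk : 0 ≤ k) (hh : Continuous h) (hr : 0 < r) (hs : 0 < s)
    (hσ : ∀ x ∈ ball σ r, h x ≠ 0 → 0 < ‖x - σ‖ ∧ fL h x ≤ 0) :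
    ∃ Q : Set (Euc N), IsCompact Q ∧ Q ⊆ fO σ h r ∧ ∀ x, x ∉ Q → fPhi α k n σ h r s x = 0 := by
  obtain ⟨A, hA⟩ : ∃ A, A = Real.exp (1/8 * (2 * Real.log s)) := ⟨_, rfl⟩
  have hA0 : 0 < A := by rw [hA]; exact Real.exp_pos _
  obtain ⟨ε, hε⟩ : ∃ ε, ε = Real.exp ((k * Real.log s + -(k/2) * Real.log ((r/2)^2)) / (2*A)) := ⟨_, rfl⟩
  have hε0 : 0 < ε := by rw [hε]; exact Real.exp_pos _
  refine ⟨closedBall σ (r/2) ∩ {x | s ≤ ‖x - σ‖ ∧ ε ≤ ‖h x‖}, ?_, ?_, ?_⟩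
  · apply (isCompact_closedBall σ (r/2)).inter_right
    have c1 : IsClosed {x : Euc N | s ≤ ‖x - σ‖} := isClosed_le continuous_const (by fun_prop)
    have c2 : IsClosed {x : Euc N | ε ≤ ‖h x‖} := isClosed_le continuous_const (by fun_prop)
    exact c1.inter c2
  · rintro x ⟨hx, hx1, hx2⟩
    refine ⟨?_, ?_⟩
    · rw [mem_closedBall] at hx; rw [mem_ball]; linarith
    · intro h0
      rw [h0, norm_zero] at hx2
      linarith
  · intro x hxQ
    unfold fPhi
    by_cases hxO : x ∈ fO σ h r
    swap
    · exact Set.indicator_of_notMem hxO _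
    rw [Set.indicator_of_mem hxO]
    obtain ⟨hX, hL⟩ := hσ x hxO.1 hxO.2
    suffices hP : fP k n σ h s x ≤ cR k r by
      unfold f0
      rw [tG_of_nonpos (by linarith), mul_zero]
    have hB := fB_pos k σ h x
    have hPB : fP k n σ h s x ≤ fB k σ h x := by
      unfold fP
      have := cutT_le_one n (fR σ x + -(2 * Real.log s))
      nlinarith
    have hd : 0 < ‖h x‖ := norm_pos_iff.2 hxO.2
    by_cases h1 : ‖x - σ‖ < s
    · have : cutT n (fR σ x + -(2 * Real.log s)) = 0 := by
        apply cutT_zero hn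
        unfold fR
        rw [Real.log_pow]
        have := Real.log_le_log hX h1.le
        push_cast; linarith
      unfold fP
      rw [this, mul_zero]; exact (cR_pos k r).le
    push Not at h1
    by_cases h2 : ‖x - σ‖ ≤ r/2
    · have h3 : ‖h x‖ < ε := by
        by_contra hcon
        push Not at hcon
        exact hxQ ⟨by rwa [mem_closedBall, dist_eq_norm], h1, hcon⟩
      refine hPB.trans ?_
      unfold fB cR
      apply Real.exp_le_exp.2
      have hls := Real.log_le_log hs h1
      have hR : 2 * Real.log s ≤ fR σ x := by
        unfold fR; rw [Real.log_pow]; push_cast; linarith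
      have hAA : A ≤ fA σ x := by
        rw [hA, fA]; apply Real.exp_le_exp.2; linarith
      have hLe : fL h x ≤ 2 * Real.log ε := by
        unfold fL; rw [Real.log_pow]; push_cast
        have := Real.log_le_log hd h3.le
        linarith
      have hlε : 2 * A * Real.log ε = k * Real.log s + -(k/2) * Real.log ((r/2)^2) := by
        rw [hε, Real.log_exp]; field_simp
      have h5 : fA σ x * fL h x ≤ A * fL h x := mul_le_mul_of_nonpos_right hAA hL
      have h6 : A * fL h x ≤ A * (2 * Real.log ε) := by gcongr
      nlinarith
    · push Not at h2
      refine hPB.trans ?_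
      unfold fB cR
      apply Real.exp_le_exp.2
      have h3 : Real.log ((r/2)^2) ≤ fR σ x := by
        unfold fR
        apply Real.log_le_log (by positivity)
        gcongr
      have h4 : fA σ x * fL h x ≤ 0 := mul_nonpos_of_nonneg_of_nonpos (fA_pos σ x).le hL
      nlinarith

lemma fPhi_test {N : ℕ} {α k : ℝ} {n : ℕ} {σ : Euc N} {h : Euc N → Euc N} {r s : ℝ}
    (hn : 2 ≤ n) (hk : 0 ≤ k) (hh : ContDiff ℝ (⊤:ℕ∞) h) (hr : 0 < r) (hs : 0 < s)
    (hσ : ∀ x ∈ ball σ r, h x ≠ 0 → 0 < ‖x - σ‖ ∧ fL h x ≤ 0) :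
    IsTestFun (fO σ h r) (fPhi α k n σ h r s) := by
  obtain ⟨Q, hQ, hQO, hQ0⟩ := fPhi_compact (α := α) hn hk hh.continuous hr hs hσ
  have hts : tsupport (fPhi α k n σ h r s) ⊆ Q := by
    apply closure_minimal _ hQ.isClosed
    intro x hx
    by_contra hc
    exact hx (hQ0 x hc)
  refine ⟨?_, HasCompactSupport.intro hQ hQ0, hts.trans hQO⟩
  rw [contDiff_iff_contDiffAt]
  intro x
  by_cases hx : x ∈ fO σ h r
  · have hX := (hσ x hx.1 hx.2).1
    refine (f0_smooth (α := α) (k := k) (n := n) (c := cR k r) (s := s) hh hx.2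
      (sub_ne_zero.1 (norm_pos_iff.1 hX))).congr_of_eventuallyEq ?_
    filter_upwards [(fO_open hh.continuous r).mem_nhds hx] with y hy
    exact Set.indicator_of_mem hy _
  · have hxQ : x ∉ Q := fun h => hx (hQO h)
    refine (contDiffAt_const (c := (0:ℝ))).congr_of_eventuallyEq ?_
    filter_upwards [hQ.isClosed.isOpen_compl.mem_nhds hxQ] with y hy
    exact hQ0 y hy

lemma fPhi_lap {N : ℕ} {α k : ℝ} {n : ℕ} {σ : Euc N} {h : Euc N → Euc N} {r s : ℝ}
    (hh : Continuous h) {x : Euc N} (hx : x ∈ fO σ h r) :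
    lap (fPhi α k n σ h r s) x = lap (f0 α k n σ h (cR k r) s) x := by
  have : fPhi α k n σ h r s =ᶠ[𝓝 x] f0 α k n σ h (cR k r) s := by
    filter_upwards [(fO_open hh r).mem_nhds hx] with y hy
    exact Set.indicator_of_mem hy _
  unfold lap
  rw [this.iteratedFDeriv ℝ 2 |>.eq_of_nhds]

set_option maxHeartbeats 1000000 in
lemma fPhi_pos {N m : ℕ} {Γ U : Set (Euc N)} {σ : Euc N} {V : Submodule ℝ (Euc N)}
    {h : Euc N → Euc N} (hc : IsChart Γ σ m V h U) {C r : ℝ} (he : ChartEst Γ σ V h U C r)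
    (hm : 0 < m) {k α : ℝ} (hk : 1 ≤ k) (n : ℕ) {r1 : ℝ} (hr1 : 0 < r1) (hr : r1 ≤ r) (hr' : r1 ≤ 1) :
    ∃ s, 0 < s ∧ s ≤ r1 ∧ ∃ x, 0 < fPhi α k n σ h r1 s x := by
  have hV : 0 < Module.finrank ℝ V := by rw [hc.fr]; exact hm
  obtain ⟨v, hv0⟩ := Module.finrank_pos_iff_exists_ne_zero.1 hV
  obtain ⟨M, hM⟩ : ∃ M, M = -(k/2) * Real.log ((r1/2)^2) := ⟨_, rfl⟩
  obtain ⟨t, ht⟩ : ∃ t, t = min (r1/2) (Real.exp (-(|M| + 11))) := ⟨_, rfl⟩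
  have ht0 : 0 < t := by rw [ht]; positivity
  have htr : t ≤ r1/2 := by rw [ht]; exact min_le_left _ _
  have hlt : Real.log t ≤ -(|M| + 11) := by
    rw [← Real.log_exp (-(|M| + 11))]
    exact Real.log_le_log ht0 (by rw [ht]; exact min_le_right _ _)
  have hvn : 0 < ‖(v : Euc N)‖ := by
    rw [norm_pos_iff]; simpa using hv0
  obtain ⟨z, hz⟩ : ∃ z : Euc N, z = (t / ‖(v : Euc N)‖) • (v : Euc N) := ⟨_, rfl⟩
  have hzV : z ∈ V := by rw [hz]; exact V.smul_mem _ v.2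
  have hzn : ‖z‖ = t := by
    rw [hz, norm_smul, Real.norm_of_nonneg (by positivity)]; field_simp
  obtain ⟨x, hx⟩ : ∃ x, x = σ + z := ⟨_, rfl⟩
  have hxσ : x - σ = z := by rw [hx]; abel
  have hXt : ‖x - σ‖ = t := by rw [hxσ, hzn]
  have hxb : x ∈ ball σ r1 := by rw [mem_ball, dist_eq_norm, hXt]; linarith
  have hd : t / 2 ≤ ‖h x‖ := by
    have hb := he.bi x (ball_subset_ball hr hxb) σ (mem_ball_self he.r0)
    have e : chH σ V h x - chH σ V h σ - (x - σ) = h x - z := by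
      unfold chH
      simp [hc.h0, hxσ, starProj_of_mem hzV]
    rw [e, hXt] at hb
    have := norm_sub_norm_le z (h x)
    rw [norm_sub_rev, hzn] at this
    linarith
  have hd0 : 0 < ‖h x‖ := by linarith
  have hxO : x ∈ fO σ h r1 := ⟨hxb, norm_pos_iff.1 hd0⟩
  have hX0 : 0 < ‖x - σ‖ := by rw [hXt]; exact ht0
  have ha4 := fA_pow hX0
  rw [hXt] at ha4
  have ha0 := fA_pos σ x
  have hla : Real.log t = 4 * Real.log (fA σ x) := by rw [← ha4, Real.log_pow]; norm_num
  have hal : -(fA σ x * Real.log (fA σ x)) ≤ 1 := by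
    have h1 : Real.log (fA σ x)⁻¹ ≤ (fA σ x)⁻¹ - 1 := Real.log_le_sub_one_of_pos (inv_pos.2 ha0)
    rw [Real.log_inv] at h1
    have := mul_le_mul_of_nonneg_left h1 ha0.le
    have h3 : fA σ x * ((fA σ x)⁻¹ - 1) = 1 - fA σ x := by field_simp
    rw [h3] at this
    linarith
  have ha1 : fA σ x ≤ 1 := by
    by_contra hcon
    push Not at hcon
    have : 1 < fA σ x ^ 4 := one_lt_pow₀ hcon (by norm_num)
    linarith
  have hLl : 2 * (4 * Real.log (fA σ x) - 1) ≤ fL h x := by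
    unfold fL
    rw [Real.log_pow, ← hla]
    have h1 := Real.log_le_log (by positivity) hd
    rw [Real.log_div ht0.ne' (by norm_num)] at h1
    have h2 : Real.log 2 ≤ 1 := by linarith [Real.log_two_lt_d9]
    push_cast; linarith
  have hAL : -10 ≤ fA σ x * fL h x := by
    have := mul_le_mul_of_nonneg_left hLl ha0.le
    nlinarith
  have hRl : fR σ x = 2 * Real.log t := by unfold fR; rw [hXt, Real.log_pow]; norm_num
  have hBc : cR k r1 < fB k σ h x := by
    unfold cR fB
    apply Real.exp_lt_exp.2
    rw [← hM, hRl]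
    have := le_abs_self M
    have := abs_nonneg M
    nlinarith
  refine ⟨t * Real.exp (-1), by positivity, ?_, x, ?_⟩
  · have : Real.exp (-1) ≤ 1 := Real.exp_le_one_iff.2 (by norm_num)
    nlinarith
  · unfold fPhi
    rw [Set.indicator_of_mem hxO]
    unfold f0 fP
    rw [cutT_one, mul_one]
    · exact mul_pos (Real.exp_pos _) (tG_pos (by linarith))
    · rw [hRl, Real.log_mul ht0.ne' (Real.exp_pos _).ne', Real.log_exp]
      linarith

lemma young_real {p p' : ℝ} (hpq : p.HolderConjugate p') {η φ A u : ℝ} (hη : 0 < η) (hφ : 0 < φ)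
    (hA : 0 ≤ A) (hu : 0 ≤ u) : u * A ≤ η * u^p * φ + η^(1-p') * (φ^(1-p') * A^p') := by
  have hp := hpq.pos
  have hp' := hpq.symm.pos
  have hp1 := hpq.lt
  have hp1' := hpq.symm.lt
  have hw : 0 < η * φ := by positivity
  have h := Real.young_inequality_of_nonneg (a := (η*φ)^(1/p) * u) (b := (η*φ)^(-(1/p)) * A)
    (by positivity) (by positivity) hpq
  have e1 : (η*φ)^(1/p) * u * ((η*φ)^(-(1/p)) * A) = u * A := by
    rw [Real.rpow_neg hw.le]
    have : (η*φ)^(1/p) ≠ 0 := (Real.rpow_pos_of_pos hw _).ne'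
    field_simp
  have e2 : ((η*φ)^(1/p) * u)^p = η * u^p * φ := by
    rw [Real.mul_rpow (by positivity) hu, ← Real.rpow_mul hw.le, one_div_mul_cancel hp.ne', Real.rpow_one]
    ring
  have e3 : ((η*φ)^(-(1/p)) * A)^p' = η^(1-p') * (φ^(1-p') * A^p') := by
    rw [Real.mul_rpow (by positivity) hA, ← Real.rpow_mul hw.le]
    have : -(1/p) * p' = 1 - p' := by
      have := hpq.inv_add_inv_eq_one
      field_simp at this
      field_simp
      linarith
    rw [this, Real.mul_rpow hη.le hφ.le]
    ring
  rw [e1, e2, e3] at h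
  refine h.trans ?_
  have k1 : 0 ≤ η * u^p * φ := by positivity
  have k2 : 0 ≤ η^(1-p') * (φ^(1-p') * A^p') := by positivity
  exact add_le_add (div_le_self k1 hp1.le) (div_le_self k2 hp1'.le)

lemma ratio_bound {p' : ℝ} (hp' : 1 < p') {n : ℕ} (hn : 2 ≤ n) (hn' : 2 * p' ≤ n) {t : ℝ} (ht : 0 < cutT n t) :
    cutT n t ^ (1 - p') * cutZ n t ^ p' ≤ 1 := by
  have hχ : 0 < Real.smoothTransition t := by
    rcases (Real.smoothTransition.nonneg t).eq_or_lt with h | h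
    · rw [cutT, ← h, zero_pow (by omega)] at ht; exact absurd ht (lt_irrefl _)
    · exact h
  have hz : cutZ n t ≤ Real.smoothTransition t ^ (n - 2) :=
    Set.indicator_le_self' (fun a _ => pow_nonneg (Real.smoothTransition.nonneg a) _) t
  calc cutT n t ^ (1 - p') * cutZ n t ^ p'
      ≤ cutT n t ^ (1 - p') * (Real.smoothTransition t ^ (n - 2)) ^ p' := by
        have := cutZ_nonneg n t
        gcongr
    _ = Real.smoothTransition t ^ ((n:ℝ) - 2*p') := by
        rw [cutT, ← Real.rpow_natCast, ← Real.rpow_natCast, ← Real.rpow_mul hχ.le, ← Real.rpow_mul hχ.le,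
          ← Real.rpow_add hχ]
        congr 1
        rw [Nat.cast_sub hn]; push_cast; ring
    _ ≤ 1 := Real.rpow_le_one hχ.le (Real.smoothTransition.le_one t) (by linarith)

lemma err_bound {p' c M : ℝ} (hp' : 1 < p') (hc : 1 ≤ c) (hM : 0 < M) {n : ℕ} (hn : 2 ≤ n) (hn' : 2 * p' ≤ n) :
    ∃ C, 0 < C ∧ ∀ ee B θ z b Y, 0 < ee → 0 < B → 0 < Y → 0 ≤ b → 0 ≤ θ → 0 ≤ z → 
      (0 < θ → θ^(1-p') * z^p' ≤ 1) → 0 < B * θ + -c →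
      (ee * tG (B*θ + -c))^(1-p') * (M * (ee * (tG1 (B*θ+-c) * (B * ((1+b) * z / Y)))))^p'
        ≤ C * (ee * (B * (1+b)^p') * Y^(-p')) := by
  obtain ⟨C, hC, hb⟩ := tG1_bound p'
  refine ⟨C * c^(p'-1) * M^p', by positivity, ?_⟩
  intro ee B θ z b Y hee hB hY hb0 hθ hz hr ht
  have hθ' : 0 < θ := by
    by_contra hcon
    have : B * θ ≤ 0 := mul_nonpos_of_nonneg_of_nonpos hB.le (not_lt.1 hcon)
    linarith
  obtain ⟨t, htt⟩ : ∃ t, t = B * θ + -c := ⟨_, rfl⟩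
  rw [← htt] at ht ⊢
  have hg0 := tG_pos ht
  have hg1 := tG1_pos ht
  have h1 := hb t ht
  have h2 : (1+t)^(1-p') ≤ c^(p'-1) * (B^(1-p') * θ^(1-p')) := by
    have h3 : B * θ / c ≤ 1 + t := by
      rw [div_le_iff₀ (by linarith), htt]; nlinarith
    calc (1+t)^(1-p') ≤ (B*θ/c)^(1-p') :=
          Real.rpow_le_rpow_of_nonpos (by positivity) h3 (by linarith)
      _ = _ := by
          rw [Real.div_rpow (by positivity) (by positivity), Real.mul_rpow hB.le hθ'.le,
            show (1 - p') = -(p'-1) by ring, Real.rpow_neg (by positivity : 0 ≤ c)]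
          field_simp
  have e1 : (ee * tG t)^(1-p') * (M * (ee * (tG1 t * (B * ((1+b) * z / Y)))))^p'
      = M^p' * (ee^(1-p') * ee^p') * (tG t^(1-p') * tG1 t^p') * (B^p' * (1+b)^p' * z^p' * Y^(-p')) := by
    rw [Real.mul_rpow hee.le hg0.le, Real.mul_rpow hM.le (by positivity), Real.mul_rpow hee.le (by positivity),
      Real.mul_rpow hg1.le (by positivity), Real.mul_rpow hB.le (by positivity),
      Real.div_rpow (by positivity) hY.le, Real.mul_rpow (by positivity) hz, Real.rpow_neg hY.le]
    ring
  have eE : ee^(1-p') * ee^p' = ee := by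
    rw [← Real.rpow_add hee]; simp
  have eB : B^(1-p') * B^p' = B := by
    rw [← Real.rpow_add hB]; simp
  rw [e1, eE]
  calc M^p' * ee * (tG t^(1-p') * tG1 t^p') * (B^p' * (1+b)^p' * z^p' * Y^(-p'))
      ≤ M^p' * ee * (C * (c^(p'-1) * (B^(1-p') * θ^(1-p')))) * (B^p' * (1+b)^p' * z^p' * Y^(-p')) := by
        have h4 : tG t^(1-p') * tG1 t^p' ≤ C * (c^(p'-1) * (B^(1-p') * θ^(1-p'))) :=
          h1.trans (mul_le_mul_of_nonneg_left h2 hC.le)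
        have h5 : 0 ≤ B^p' * (1+b)^p' * z^p' * Y^(-p') := by positivity
        exact mul_le_mul_of_nonneg_right (mul_le_mul_of_nonneg_left h4 (by positivity)) h5
    _ = C * c^(p'-1) * M^p' * (ee * ((B^(1-p') * B^p') * (1+b)^p') * Y^(-p')) * (θ^(1-p') * z^p') := by ring
    _ ≤ C * c^(p'-1) * M^p' * (ee * ((B^(1-p') * B^p') * (1+b)^p') * Y^(-p')) * 1 := by
        gcongr
        exact hr hθ'
    _ = _ := by rw [eB, mul_one]

lemma young_pt {N : ℕ} {p p' α k M : ℝ} (hpq : p.HolderConjugate p') {σ : Euc N} {h : Euc N → Euc N}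
    {n : ℕ} (hn : 2 ≤ n) (hn' : 2 * p' ≤ n) {c : ℝ} (hc : 1 ≤ c) (hM : 0 < M) :
    ∃ C, 0 < C ∧ ∀ s x u η, h x ≠ 0 → 0 < ‖x - σ‖ → 0 ≤ -fL h x → 0 ≤ u → 0 < η →
      u * (M * fE α k n σ h c s x) ≤ η * u^p * f0 α k n σ h c s x
        + η^(1-p') * (C * (‖x - σ‖^(-k-p') * ‖h x‖^(-(α+p')))) := by
  obtain ⟨C1, hC1, hb⟩ := err_bound hpq.symm.lt hc hM hn hn'
  obtain ⟨C2, hC2, hb2⟩ := exp_mul_bdd p'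
  refine ⟨C1 * C2, by positivity, ?_⟩
  intro s x u η hx hX hL hu hη
  have hd := norm_pos_iff.2 hx
  have hA := fA_pos σ x
  have hB := fB_pos k σ h x
  have hθ := cutT_nonneg n (fR σ x + -(2 * Real.log s))
  have hz := cutZ_nonneg n (fR σ x + -(2 * Real.log s))
  rcases le_or_gt (fP k n σ h s x + -c) 0 with ht | ht
  · have : fE α k n σ h c s x = 0 := by rw [fE, tG1_of_nonpos ht]; ring
    rw [this, f0, tG_of_nonpos ht]
    have : 0 ≤ η^(1-p') * (C1 * C2 * (‖x - σ‖^(-k-p') * ‖h x‖^(-(α+p')))) := by positivity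
    linarith
  have hφ : 0 < f0 α k n σ h c s x := mul_pos (Real.exp_pos _) (tG_pos ht)
  have hE : 0 ≤ fE α k n σ h c s x := by
    unfold fE
    have := tG1_pos ht
    positivity
  refine (young_real hpq hη hφ (mul_nonneg hM.le hE) hu).trans ?_
  refine add_le_add le_rfl (mul_le_mul_of_nonneg_left ?_ (by positivity))
  have := hb (Real.exp (-(α/2) * fL h x)) (fB k σ h x) (cutT n (fR σ x + -(2 * Real.log s)))
    (cutZ n (fR σ x + -(2 * Real.log s))) (fA σ x * (-fL h x)) (‖x - σ‖ * ‖h x‖) (Real.exp_pos _) hB (by positivity)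
    (by positivity) hθ hz (ratio_bound hpq.symm.lt hn hn') ht
  refine this.trans ?_
  rw [mul_assoc C1 C2]
  refine mul_le_mul_of_nonneg_left ?_ hC1.le
  have hb2' := hb2 (fA σ x * (-fL h x)) (by positivity)
  have eB : fB k σ h x = Real.exp (-(fA σ x * (-fL h x))) * ‖x - σ‖^(-k) := by
    rw [fB, Real.exp_add, Real.rpow_def_of_pos hX, fR, Real.log_pow]
    congr 2
    · ring
    · push_cast; ring
  have eE : Real.exp (-(α/2) * fL h x) = ‖h x‖^(-α) := by
    rw [Real.rpow_def_of_pos hd, fL, Real.log_pow]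
    congr 1; push_cast; ring
  rw [eE, eB]
  calc ‖h x‖^(-α) * (Real.exp (-(fA σ x * (-fL h x))) * ‖x - σ‖^(-k) * (1 + fA σ x * (-fL h x))^p')
        * (‖x - σ‖ * ‖h x‖)^(-p')
      = (Real.exp (-(fA σ x * (-fL h x))) * (1 + fA σ x * (-fL h x))^p') *
        ((‖x - σ‖^(-k) * ‖x - σ‖^(-p')) * (‖h x‖^(-α) * ‖h x‖^(-p'))) := by
        rw [Real.mul_rpow hX.le hd.le]; ring
    _ ≤ C2 * ((‖x - σ‖^(-k) * ‖x - σ‖^(-p')) * (‖h x‖^(-α) * ‖h x‖^(-p'))) := by gcongr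
    _ = _ := by
        rw [← Real.rpow_add hX, ← Real.rpow_add hd]
        congr 4; ring

/-- the annulus -/
def fAnn {N : ℕ} (σ : Euc N) (s : ℝ) : Set (Euc N) := {x | s ≤ ‖x - σ‖ ∧ ‖x - σ‖ ≤ Real.exp (1/2) * s}

lemma fE_zero {N : ℕ} {α k : ℝ} {n : ℕ} {σ : Euc N} {h : Euc N → Euc N} {c s : ℝ} {x : Euc N} (hs : 0 < s)
    (hX : 0 < ‖x - σ‖) (hx : x ∉ fAnn σ s) : fE α k n σ h c s x = 0 := by
  have : cutZ n (fR σ x + -(2 * Real.log s)) = 0 := by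
    apply Set.indicator_of_notMem
    rintro ⟨h1, h2⟩
    apply hx
    rw [fR, Real.log_pow] at h1 h2
    push_cast at h1 h2
    constructor
    · exact (Real.log_le_log_iff hs hX).1 (by linarith)
    · apply (Real.log_le_log_iff hX (by positivity)).1
      rw [Real.log_mul (Real.exp_pos _).ne' hs.ne', Real.log_exp]
      linarith
  rw [fE, this]; simp

lemma pot_lower {N m : ℕ} {Γ U Ω : Set (Euc N)} {σ : Euc N} {V : Submodule ℝ (Euc N)}
    {h : Euc N → Euc N} (hc : IsChart Γ σ m V h U) {C r : ℝ} (he : ChartEst Γ σ V h U C r)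
    (hΓ : IsClosed Γ) (hσ : σ ∈ Γ) (hΩ : IsOpen Ω) (hΓΩ : Γ ⊆ Ω) {q : Euc N → ℝ}
    (hq : ContDiffOn ℝ 2 q (closure Ω)) (hq0 : ∀ x ∈ Ω, 0 ≤ q x) (hq1 : q σ = 1) :
    ∃ Kp r2 : ℝ, 0 ≤ Kp ∧ 0 < r2 ∧ r2 ≤ r ∧ ball σ r2 ⊆ Ω ∧ (∀ x ∈ ball σ r2, h x ≠ 0 → x ∉ Γ) ∧
      ∀ x ∈ ball σ r2, h x ≠ 0 → ∀ α : ℝ,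
        α^2 * (1 - Kp * ‖x - σ‖) / ‖h x‖^2 ≤ α^2 * distG Γ x ^ (-2 : ℝ) * q x := by
  have hC1 := he.C1
  have hσΩ : Ω ∈ 𝓝 σ := hΩ.mem_nhds (hΓΩ hσ)
  have hqd : DifferentiableAt ℝ q σ :=
    (hq.contDiffAt (mem_of_superset hσΩ subset_closure)).differentiableAt (by norm_num)
  obtain ⟨K1, hK1, hb⟩ := hqd.isBigO_sub.exists_pos
  rw [Asymptotics.IsBigOWith] at hb
  obtain ⟨r', hr', hb'⟩ := Metric.eventually_nhds_iff_ball.1 (hb.and hσΩ)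
  have hnΓ : ∀ x ∈ ball σ r, h x ≠ 0 → x ∉ Γ := by
    intro x hx hx0 hxΓ
    have : x ∈ Γ ∩ U := ⟨hxΓ, he.sub hx⟩
    rw [hc.hΓ] at this
    exact hx0 this.2
  refine ⟨2*C + K1, min (min r r') (1/(2*C)), by positivity, ?_, (min_le_left _ _).trans (min_le_left _ _), ?_, ?_, ?_⟩
  · have := he.r0; positivity
  · intro x hx
    exact (hb' x (ball_subset_ball ((min_le_left _ _).trans (min_le_right _ _)) hx)).2
  · intro x hx
    exact hnΓ x (ball_subset_ball ((min_le_left _ _).trans (min_le_left _ _)) hx)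
  intro x hx hx0 α
  have hxr : x ∈ ball σ r := ball_subset_ball ((min_le_left _ _).trans (min_le_left _ _)) hx
  obtain ⟨hq', hxΩ⟩ := hb' x (ball_subset_ball ((min_le_left _ _).trans (min_le_right _ _)) hx)
  have hXC : ‖x - σ‖ * (2*C) ≤ 1 := by
    have : ‖x - σ‖ < 1/(2*C) := by
      rw [← dist_eq_norm]
      exact lt_of_lt_of_le hx (min_le_right _ _)
    rw [lt_div_iff₀ (by positivity)] at this
    exact this.le
  have hd := norm_pos_iff.2 hx0
  have hδ := he.dist x hxr
  have hδ0 : 0 < infDist x Γ :=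
    (hΓ.notMem_iff_infDist_pos ⟨σ, hσ⟩).1 (hnΓ x hxr hx0)
  have hX := norm_nonneg (x - σ)
  have hqx : 1 - K1 * ‖x - σ‖ ≤ q x := by
    rw [hq1, Real.norm_eq_abs] at hq'
    linarith [(abs_le.1 hq').1]
  have hq0' := hq0 x hxΩ
  rw [distG, Real.rpow_neg hδ0.le, Real.rpow_two]
  have h1 : (1 - 2*C*‖x-σ‖) / ‖h x‖^2 ≤ (infDist x Γ ^2)⁻¹ := by
    rw [← one_div, div_le_div_iff₀ (by positivity) (by positivity)]
    have hCX : 0 ≤ C * ‖x-σ‖ := by positivity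
    have h2 : infDist x Γ ^ 2 ≤ (‖h x‖ * (1 + C * ‖x-σ‖))^2 := by gcongr
    have h3 : (1 - 2*C*‖x-σ‖) * (1 + C*‖x-σ‖)^2 ≤ 1 := by
      have : (1 - 2*(C*‖x-σ‖)) * (1 + C*‖x-σ‖)^2 ≤ 1 := by
        generalize C*‖x-σ‖ = y at hCX
        nlinarith [mul_nonneg hCX hCX, mul_nonneg (mul_nonneg hCX hCX) hCX]
      linarith
    calc (1 - 2*C*‖x-σ‖) * infDist x Γ ^ 2 ≤ (1 - 2*C*‖x-σ‖) * (‖h x‖ * (1 + C * ‖x-σ‖))^2 := by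
          apply mul_le_mul_of_nonneg_left h2; linarith
      _ = ((1 - 2*C*‖x-σ‖) * (1 + C*‖x-σ‖)^2) * ‖h x‖^2 := by ring
      _ ≤ 1 * ‖h x‖^2 := by gcongr
  have h4 : (1 - (2*C+K1)*‖x-σ‖) / ‖h x‖^2 ≤ (infDist x Γ ^2)⁻¹ * q x := by
    calc (1 - (2*C+K1)*‖x-σ‖) / ‖h x‖^2 ≤ ((1 - 2*C*‖x-σ‖) * q x) / ‖h x‖^2 := by
          gcongr
          have h5 : (1 - 2*C*‖x-σ‖) * (1 - K1 * ‖x-σ‖) ≤ (1 - 2*C*‖x-σ‖) * q x := by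
            apply mul_le_mul_of_nonneg_left hqx; linarith
          have h6 : 0 ≤ C*K1*(‖x-σ‖*‖x-σ‖) := by positivity
          nlinarith
      _ = (1 - 2*C*‖x-σ‖) / ‖h x‖^2 * q x := by ring
      _ ≤ _ := by gcongr
  calc α^2 * (1 - (2*C+K1)*‖x-σ‖) / ‖h x‖^2 = α^2 * ((1 - (2*C+K1)*‖x-σ‖) / ‖h x‖^2) := by ring
    _ ≤ α^2 * ((infDist x Γ ^2)⁻¹ * q x) := by gcongr
    _ = _ := by ring

/-- remainder -/
def fG {N : ℕ} (k p' τ : ℝ) (σ : Euc N) (h : Euc N → Euc N) (s : ℝ) : Euc N → ℝ :=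
  (ball σ (2*s)).indicator (fun x => s^(-k-p') * ‖h x‖^(-τ))

lemma fG_nonneg {N : ℕ} (k p' τ : ℝ) (σ : Euc N) (h : Euc N → Euc N) {s : ℝ} (hs : 0 < s) (x : Euc N) :
    0 ≤ fG k p' τ σ h s x := Set.indicator_nonneg (fun x _ => by positivity) x

lemma rem_int {N m k : ℕ} {Γ U : Set (Euc N)} {σ : Euc N} {V : Submodule ℝ (Euc N)}
    {h : Euc N → Euc N} (hc : IsChart Γ σ m V h U) {C r : ℝ} (he : ChartEst Γ σ V h U C r)
    (hr : r ≤ 1) (hm : 0 < m) (hN : m + k = N) {α p' : ℝ} (hα : 0 < α) (hp' : 1 < p')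
    (h1 : α + p' < m) (h2 : α + 2 * p' ≤ m) :
    ∃ C0, 0 < C0 ∧ ∀ s, 0 < s → 2 * s ≤ r → Integrable (fG k p' (α+p') σ h s) volume ∧
      ∫ x, fG k p' (α+p') σ h s x ≤ C0 := by
  obtain ⟨C1, hC1, hb⟩ := lint_chart hc he hm (by linarith : 0 ≤ α + p') h1
  refine ⟨C1 * 2^((N:ℝ) - (α+p')), by positivity, ?_⟩
  intro s hs hsr
  have hN' : (m:ℝ) + k = N := by exact_mod_cast hN
  have hmeas : AEStronglyMeasurable (fG k p' (α+p') σ h s) volume := by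
    apply AEStronglyMeasurable.indicator _ measurableSet_ball
    apply Measurable.aestronglyMeasurable
    exact measurable_const.mul ((hc.sm.continuous.measurable.norm).pow_const _)
  have hnn := fG_nonneg k p' (α+p') σ h hs
  have hl : ∫⁻ x, ENNReal.ofReal (fG k p' (α+p') σ h s x) ≤ ENNReal.ofReal (C1 * 2^((N:ℝ) - (α+p'))) := by
    have e1 : ∀ x, ENNReal.ofReal (fG k p' (α+p') σ h s x) ≤ (ball σ (2*s)).indicator
        (fun x => ENNReal.ofReal (s^(-(k:ℝ)-p')) * ENNReal.ofReal ‖h x‖ ^ (-(α+p'))) x := by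
      intro x
      unfold fG
      by_cases hx : x ∈ ball σ (2*s)
      · rw [Set.indicator_of_mem hx, Set.indicator_of_mem hx, ENNReal.ofReal_mul (by positivity)]
        gcongr
        rcases (norm_nonneg (h x)).eq_or_lt with h0 | h0
        · rw [← h0, Real.zero_rpow (by linarith)]; simp
        · rw [ENNReal.ofReal_rpow_of_pos h0]
      · rw [Set.indicator_of_notMem hx]; simp
    refine (lintegral_mono e1).trans ?_
    rw [lintegral_indicator measurableSet_ball, lintegral_const_mul' _ _ ENNReal.ofReal_ne_top]
    calc ENNReal.ofReal (s^(-(k:ℝ)-p')) * _ ≤ ENNReal.ofReal (s^(-(k:ℝ)-p')) * ENNReal.ofReal (C1 * (2*s)^((N:ℝ) - (α+p'))) := by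
          gcongr
          exact hb (2*s) (by positivity) hsr
      _ = ENNReal.ofReal (C1 * 2^((N:ℝ) - (α+p')) * s^((m:ℝ) - α - 2*p')) := by
          rw [← ENNReal.ofReal_mul (by positivity), Real.mul_rpow (by norm_num) hs.le]
          congr 1
          have : (m:ℝ) - α - 2*p' = (-(k:ℝ)-p') + ((N:ℝ) - (α+p')) := by linarith
          rw [this, Real.rpow_add hs]; ring
      _ ≤ _ := by
          apply ENNReal.ofReal_le_ofReal
          have : s^((m:ℝ) - α - 2*p') ≤ 1 := Real.rpow_le_one hs.le (by linarith) (by linarith)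
          have : 0 ≤ C1 * 2^((N:ℝ) - (α+p')) := by positivity
          nlinarith
  have hitg : Integrable (fG k p' (α+p') σ h s) volume := by
    refine ⟨hmeas, ?_⟩
    rw [hasFiniteIntegral_iff_ofReal (Eventually.of_forall hnn)]
    exact lt_of_le_of_lt hl ENNReal.ofReal_lt_top
  refine ⟨hitg, ?_⟩
  rw [integral_eq_lintegral_of_nonneg_ae (Eventually.of_forall hnn) hmeas]
  apply ENNReal.toReal_le_of_le_ofReal (by positivity) hl

lemma fAnn_meas {N : ℕ} (σ : Euc N) (s : ℝ) : MeasurableSet (fAnn σ s) := by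
  have c1 : IsClosed {x : Euc N | s ≤ ‖x - σ‖} := isClosed_le continuous_const (by fun_prop)
  have c2 : IsClosed {x : Euc N | ‖x - σ‖ ≤ Real.exp (1/2) * s} := isClosed_le (by fun_prop) continuous_const
  exact (c1.inter c2).measurableSet

lemma sum_ann {N : ℕ} {σ : Euc N} {s1 : ℝ} (hs1 : 0 < s1) {F : ℝ → Euc N → ℝ} {x : Euc N}
    (hF : ∀ s', 0 < s' → 0 ≤ F s' x ∧ ∀ s, s' ≤ s → F s x ≤ F s' x) (J : ℕ) :
    ∑ j ∈ Finset.range J, (fAnn σ (s1 * Real.exp (-(j:ℝ)))).indicator (F (s1 * Real.exp (-(j:ℝ)))) x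
      ≤ F (s1 * Real.exp (-(J:ℝ))) x := by
  by_cases hx : ∃ j ∈ Finset.range J, x ∈ fAnn σ (s1 * Real.exp (-(j:ℝ)))
  · obtain ⟨j, hj, hxj⟩ := hx
    rw [Finset.sum_eq_single_of_mem j hj]
    · rw [Set.indicator_of_mem hxj]
      apply (hF _ (by positivity)).2
      have : (j:ℝ) ≤ J := by exact_mod_cast (Finset.mem_range.1 hj).le
      gcongr
    · intro i _ hij
      apply Set.indicator_of_notMem
      intro hxi
      have key : ∀ a b : ℕ, a < b → x ∈ fAnn σ (s1 * Real.exp (-(a:ℝ))) → x ∈ fAnn σ (s1 * Real.exp (-(b:ℝ))) → False := by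
        intro a b hab ha hb
        have h1 := ha.1.trans hb.2
        have h2 : Real.exp (1/2) * (s1 * Real.exp (-(b:ℝ))) = s1 * Real.exp (1/2 - b) := by
          rw [sub_eq_add_neg, Real.exp_add]; ring
        rw [h2] at h1
        have h3 := Real.exp_le_exp.1 (le_of_mul_le_mul_left h1 hs1)
        have : (a:ℝ) + 1 ≤ b := by exact_mod_cast hab
        linarith
      rcases lt_or_gt_of_ne hij with h | h
      · exact key i j h hxi hxj
      · exact key j i h hxj hxi
  · push Not at hx
    rw [Finset.sum_eq_zero (fun j hj => Set.indicator_of_notMem (hx j hj) _)]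
    exact (hF _ (by positivity)).1

lemma stepD {N : ℕ} {σ : Euc N} {μ : Measure (Euc N)} {F : ℝ → Euc N → ℝ} {s1 p' C1 : ℝ} (hs1 : 0 < s1)
    (hp' : 1 < p') (hC1 : 0 < C1) (hitg : ∀ s, 0 < s → s ≤ s1 → Integrable (F s) μ)
    (hF : ∀ᵐ x ∂μ, ∀ s', 0 < s' → 0 ≤ F s' x ∧ ∀ s, s' ≤ s → F s x ≤ F s' x)
    (hkey : ∀ s, 0 < s → s ≤ s1 → ∀ η, 0 < η →
      ∫ x, F s x ∂μ ≤ η * ∫ x, (fAnn σ s).indicator (F s) x ∂μ + η^(1-p') * C1) :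
    ∫ x, F s1 x ∂μ = 0 := by
  have hI : ∀ s, 0 < s → s ≤ s1 → ∫ x, (fAnn σ s).indicator (F s) x ∂μ ≤ ∫ x, F s x ∂μ := by
    intro s hs hss
    apply integral_mono_ae ((hitg s hs hss).indicator (fAnn_meas σ s)) (hitg s hs hss)
    filter_upwards [hF] with x hx
    exact Set.indicator_le_self' (fun _ _ => (hx s hs).1) x
  have hJb : ∀ s, 0 < s → s ≤ s1 → ∫ x, F s x ∂μ ≤ 2 * ((1/2:ℝ)^(1-p') * C1) := by
    intro s hs hss
    have h1 := hkey s hs hss (1/2) (by norm_num)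
    have h2 := hI s hs hss
    linarith
  have hsj : ∀ j : ℕ, 0 < s1 * Real.exp (-(j:ℝ)) ∧ s1 * Real.exp (-(j:ℝ)) ≤ s1 := by
    intro j
    refine ⟨by positivity, ?_⟩
    have : Real.exp (-(j:ℝ)) ≤ 1 := Real.exp_le_one_iff.2 (by simp)
    nlinarith
  have hsum : ∀ J : ℕ, ∑ j ∈ Finset.range J,
      ∫ x, (fAnn σ (s1 * Real.exp (-(j:ℝ)))).indicator (F (s1 * Real.exp (-(j:ℝ)))) x ∂μ
      ≤ 2 * ((1/2:ℝ)^(1-p') * C1) := by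
    intro J
    have hi : ∀ j ∈ Finset.range J, Integrable
        (fun x => (fAnn σ (s1 * Real.exp (-(j:ℝ)))).indicator (F (s1 * Real.exp (-(j:ℝ)))) x) μ :=
      fun j _ => (hitg _ (hsj j).1 (hsj j).2).indicator (fAnn_meas σ _)
    rw [← integral_finsetSum _ hi]
    refine le_trans ?_ (hJb _ (hsj J).1 (hsj J).2)
    apply integral_mono_ae (integrable_finsetSum _ hi) (hitg _ (hsj J).1 (hsj J).2)
    filter_upwards [hF] with x hx
    exact sum_ann hs1 hx J
  have hsmall : ∀ ε > 0, ∃ j : ℕ,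
      ∫ x, (fAnn σ (s1 * Real.exp (-(j:ℝ)))).indicator (F (s1 * Real.exp (-(j:ℝ)))) x ∂μ < ε := by
    intro ε hε
    by_contra hcon
    push Not at hcon
    obtain ⟨J, hJ⟩ := exists_nat_gt (2 * ((1/2:ℝ)^(1-p') * C1) / ε)
    rw [div_lt_iff₀ hε] at hJ
    have := Finset.sum_le_sum (fun j (_ : j ∈ Finset.range J) => hcon j)
    rw [Finset.sum_const, Finset.card_range, nsmul_eq_mul] at this
    linarith [hsum J]
  have h0 : 0 ≤ ∫ x, F s1 x ∂μ := by
    apply integral_nonneg_of_ae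
    filter_upwards [hF] with x hx using (hx s1 hs1).1
  apply le_antisymm _ h0
  apply le_of_forall_pos_le_add
  intro τ hτ
  obtain ⟨η, hη, hητ⟩ : ∃ η, 0 < η ∧ η^(1-p') * C1 ≤ τ/2 := by
    have ht : Tendsto (fun η : ℝ => η^(-(p'-1))) atTop (𝓝 0) := tendsto_rpow_neg_atTop (by linarith)
    have := (ht.eventually_le_const (by positivity : 0 < τ/2/C1)).and (eventually_gt_atTop 0)
    obtain ⟨η, h1, h2⟩ := this.exists
    refine ⟨η, h2, ?_⟩
    rw [le_div_iff₀ hC1] at h1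
    rwa [show 1 - p' = -(p'-1) by ring]
  obtain ⟨j, hj⟩ := hsmall (τ/2/η) (by positivity)
  have h1 := hkey _ (hsj j).1 (hsj j).2 η hη
  have h2 : ∫ x, F s1 x ∂μ ≤ ∫ x, F (s1 * Real.exp (-(j:ℝ))) x ∂μ := by
    apply integral_mono_ae (hitg _ hs1 le_rfl) (hitg _ (hsj j).1 (hsj j).2)
    filter_upwards [hF] with x hx using (hx _ (hsj j).1).2 _ (hsj j).2
  rw [lt_div_iff₀ hη] at hj
  linarith

set_option maxHeartbeats 2000000 in
lemma vanish {N m k : ℕ} (hm : 3 ≤ m) (hk : 1 ≤ k) (hN : m + k = N)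
    {Γ Ω : Set (Euc N)} (hΓ : IsSmoothSubmanifold N k Γ) (hΩ : IsOpen Ω) (hΓΩ : Γ ⊆ Ω)
    {q : Euc N → ℝ} (hq : ContDiffOn ℝ 2 q (closure Ω)) (hq0 : ∀ x ∈ Ω, 0 ≤ q x) (hqmax : ∃ σ ∈ Γ, q σ = 1)
    {α p p' : ℝ} (hα : 2 * α = m - 2) (hpq : p.HolderConjugate p') (hpp : 2 * p' ≤ α + 2)
    {u : Euc N → ℝ} (hu0 : ∀ᵐ x ∂volume, x ∈ Ω \ Γ → 0 ≤ u x)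
    (hu : LocallyIntegrableOn u (Ω \ Γ) volume)
    (hup : LocallyIntegrableOn (fun x => u x ^ p) (Ω \ Γ) volume)
    (huV : LocallyIntegrableOn (fun x => α^2 * distG Γ x ^ (-2 : ℝ) * q x * u x) (Ω \ Γ) volume)
    (hI : ∀ φ : Euc N → ℝ, IsTestFun (Ω \ Γ) φ → (∀ x, 0 ≤ φ x) →
        ∫ x in Ω \ Γ, u x ^ p * φ x ≤
          ∫ x in Ω \ Γ, u x * (-(lap φ x) - α^2 * distG Γ x ^ (-2 : ℝ) * q x * φ x)) :
    ∃ O : Set (Euc N), IsOpen O ∧ ((Ω \ Γ) ∩ O).Nonempty ∧ ∀ᵐ x ∂volume, x ∈ O → u x = 0 := by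
  have hm' : (3:ℝ) ≤ m := by exact_mod_cast hm
  have hα0 : 0 < α := by linarith
  have hp1 := hpq.lt
  have hp1' := hpq.symm.lt
  have hΓc : IsClosed Γ := hΓ.1.isClosed
  have hWm : MeasurableSet (Ω \ Γ) := hΩ.measurableSet.diff hΓc.measurableSet
  obtain ⟨σ, hσ, hqσ⟩ := hqmax
  obtain ⟨V, h, U, hc0⟩ := exists_chart hΓ hσ
  have hmN : N - k = m := by omega
  rw [hmN] at hc0
  obtain ⟨C, r, he0⟩ := hc0.est
  have he1 := he0.mono (r' := min r 1) (by have := he0.r0; positivity) (min_le_left _ _)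
  obtain ⟨Kp, r2, hKp, hr2, hr2r, hbΩ, hnΓ, hV⟩ := pot_lower hc0 he1 hΓc hσ hΩ hΓΩ hq hq0 hqσ
  have he2 := he1.mono hr2 hr2r
  have hr21 : r2 ≤ 1 := hr2r.trans (min_le_right _ _)
  obtain ⟨n, hn⟩ := exists_nat_ge (max 2 (2*p'))
  have hn2 : 2 ≤ n := by exact_mod_cast (le_max_left _ _).trans hn
  have hnp : 2 * p' ≤ n := (le_max_right _ _).trans hn
  obtain ⟨r1, M, hr1, hr12, hM, hpt⟩ := ptwise hc0 he2 hr21 hm hk hN hn2 hα hKp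
  have hr11 : r1 ≤ 1 := hr12.trans hr21
  have hk' : (1:ℝ) ≤ k := by exact_mod_cast hk
  have hc1 : 1 ≤ cR k r1 := cR_ge (by linarith) hr1 hr11
  obtain ⟨CY, hCY, hY⟩ := young_pt (α := α) (k := k) hpq (σ := σ) (h := h) hn2 hnp hc1 hM
  obtain ⟨C0, hC0, hG⟩ := rem_int (k := k) hc0 he2 hr21 (by omega) hN hα0 hp1' (by linarith) (by linarith)
  obtain ⟨s0, hs0, hs0r, x0, hx0⟩ := fPhi_pos (α := α) hc0 he2 (by omega) hk' n hr1 hr12 hr11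
  have hhc := hc0.sm.continuous
  have hσ' : ∀ x ∈ ball σ r1, h x ≠ 0 → 0 < ‖x - σ‖ ∧ fL h x ≤ 0 := by
    intro x hx hx0
    obtain ⟨a, b, _⟩ := hpt x hx hx0
    exact ⟨a, by linarith⟩
  have hOW : fO σ h r1 ⊆ Ω \ Γ := by
    rintro x ⟨hx, hx0⟩
    exact ⟨hbΩ (ball_subset_ball hr12 hx), hnΓ x (ball_subset_ball hr12 hx) hx0⟩
  have htest0 : ∀ s, 0 < s → IsTestFun (fO σ h r1) (fPhi α k n σ h r1 s) :=
    fun s hs => fPhi_test hn2 (by linarith) hc0.sm hr1 hs hσ'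
  have htest : ∀ s, 0 < s → IsTestFun (Ω \ Γ) (fPhi α k n σ h r1 s) :=
    fun s hs => ⟨(htest0 s hs).1, (htest0 s hs).2.1, (htest0 s hs).2.2.trans hOW⟩
  obtain ⟨s1, hs1, hs10, hs1r⟩ : ∃ s1, 0 < s1 ∧ s1 ≤ s0 ∧ 2 * s1 ≤ r2 :=
    ⟨min s0 (r2/2), by positivity, min_le_left _ _, by linarith [min_le_right s0 (r2/2)]⟩
  have hu0W : ∀ᵐ x ∂(volume.restrict (Ω \ Γ)), 0 ≤ u x := by
    rw [ae_restrict_iff' hWm]; exact hu0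
  have hFint : ∀ s, 0 < s → Integrable (fun x => u x ^ p * fPhi α k n σ h r1 s x) volume :=
    fun s hs => integrable_mul_test hup (htest s hs).1.continuous (htest s hs).2.1 (htest s hs).2.2
  have hzero := stepD (σ := σ) (μ := volume.restrict (Ω \ Γ)) (F := fun s x => u x ^ p * fPhi α k n σ h r1 s x)
    (s1 := s1) (p' := p') (C1 := CY * C0) hs1 hp1' (by positivity)
    (fun s hs _ => (hFint s hs).integrableOn) (by
      filter_upwards [hu0W] with x hx
      intro s' hs'
      have hup := Real.rpow_nonneg hx p
      refine ⟨mul_nonneg hup (fPhi_nonneg _ _ _ _ _ _ _ _), fun s hs => ?_⟩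
      exact mul_le_mul_of_nonneg_left (fPhi_mono _ _ _ _ _ _ hs' hs x) hup) (by
      intro s hs hss η hη
      refine (hI _ (htest s hs) (fPhi_nonneg _ _ _ _ _ _ _)).trans ?_
      have hGs := hG s hs (by linarith)
      have i1 : Integrable (fun x => u x * lap (fPhi α k n σ h r1 s) x) volume :=
        integrable_mul_test hu (lap_cont (htest s hs).1) ((htest s hs).2.1.mono' (subset_closure.trans (lap_tsupport _)))
          ((lap_tsupport _).trans (htest s hs).2.2)
      have i2 : Integrable (fun x => α^2 * distG Γ x ^ (-2 : ℝ) * q x * u x * fPhi α k n σ h r1 s x) volume :=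
        integrable_mul_test huV (htest s hs).1.continuous (htest s hs).2.1 (htest s hs).2.2
      have iL : Integrable (fun x => u x * (-(lap (fPhi α k n σ h r1 s) x)
          - α^2 * distG Γ x ^ (-2 : ℝ) * q x * fPhi α k n σ h r1 s x)) volume := by
        refine (i1.neg.sub i2).congr (Eventually.of_forall fun x => ?_)
        simp only [Pi.sub_apply, Pi.neg_apply]; ring
      have iA : Integrable ((fAnn σ s).indicator (fun x => u x ^ p * fPhi α k n σ h r1 s x)) volume :=
        (hFint s hs).indicator (fAnn_meas σ s)
      have iR : Integrable (fun x => η * (fAnn σ s).indicator (fun x => u x ^ p * fPhi α k n σ h r1 s x) x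
          + η^(1-p') * (CY * fG k p' (α+p') σ h s x)) volume :=
        (iA.const_mul η).add ((hGs.1.const_mul CY).const_mul _)
      have hmono : ∫ x in Ω \ Γ, u x * (-(lap (fPhi α k n σ h r1 s) x)
          - α^2 * distG Γ x ^ (-2 : ℝ) * q x * fPhi α k n σ h r1 s x) ≤
          ∫ x in Ω \ Γ, (η * (fAnn σ s).indicator (fun x => u x ^ p * fPhi α k n σ h r1 s x) x
          + η^(1-p') * (CY * fG k p' (α+p') σ h s x)) := by
        apply integral_mono_ae iL.integrableOn iR.integrableOn
        filter_upwards [hu0W] with x hux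
        have hGx := fG_nonneg k p' (α+p') σ h hs x
        have hR2 : 0 ≤ η^(1-p') * (CY * fG k p' (α+p') σ h s x) := by positivity
        have hAx : 0 ≤ (fAnn σ s).indicator (fun x => u x ^ p * fPhi α k n σ h r1 s x) x := by
          by_cases hxA : x ∈ fAnn σ s
          · rw [Set.indicator_of_mem hxA]
            exact mul_nonneg (Real.rpow_nonneg hux p) (fPhi_nonneg _ _ _ _ _ _ _ _)
          · rw [Set.indicator_of_notMem hxA]
        by_cases hxO : x ∈ fO σ h r1
        · obtain ⟨hX, h32, ha1, hpx⟩ := hpt x hxO.1 hxO.2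
          have hp0 := hpx s (cR k r1) (by linarith)
          have hVx := hV x (ball_subset_ball hr12 hxO.1) hxO.2 α
          have hφx : fPhi α k n σ h r1 s x = f0 α k n σ h (cR k r1) s x := Set.indicator_of_mem hxO _
          have hφ0 := fPhi_nonneg α k n σ h r1 s x
          have hle : u x * (-(lap (fPhi α k n σ h r1 s) x)
              - α^2 * distG Γ x ^ (-2 : ℝ) * q x * fPhi α k n σ h r1 s x) ≤
              u x * (M * fE α k n σ h (cR k r1) s x) := by
            apply mul_le_mul_of_nonneg_left _ hux
            rw [fPhi_lap hhc hxO]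
            have := mul_le_mul_of_nonneg_right hVx hφ0
            rw [← hφx] at hp0
            linarith
          refine hle.trans ?_
          by_cases hxA : x ∈ fAnn σ s
          · refine (hY s x (u x) η hxO.2 hX (by linarith) hux hη).trans ?_
            rw [Set.indicator_of_mem hxA, hφx, ← mul_assoc η]
            refine add_le_add le_rfl ?_
            have hxb : x ∈ ball σ (2*s) := by
              rw [mem_ball, dist_eq_norm]
              refine lt_of_le_of_lt hxA.2 ?_
              have : Real.exp (1/2) < 2 := by
                have h1 : Real.exp (1/2) ^ 2 < 2 ^ 2 := by
                  rw [← Real.exp_nat_mul]; norm_num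
                  linarith [Real.exp_one_lt_d9]
                exact lt_of_pow_lt_pow_left₀ 2 (by norm_num) h1
              nlinarith
            rw [fG, Set.indicator_of_mem hxb]
            gcongr ?_ * (_ * (?_ * _))
            exact Real.rpow_le_rpow_of_nonpos hs hxA.1 (by linarith)
          · rw [fE_zero hs hX hxA, mul_zero, mul_zero]
            positivity
        · have hxt : x ∉ tsupport (fPhi α k n σ h r1 s) := fun hh => hxO ((htest0 s hs).2.2 hh)
          have h1 : fPhi α k n σ h r1 s x = 0 := image_eq_zero_of_notMem_tsupport hxt
          have h2 : lap (fPhi α k n σ h r1 s) x = 0 :=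
            image_eq_zero_of_notMem_tsupport (fun hh => hxt (lap_tsupport _ hh))
          rw [h1, h2]
          simp only [neg_zero, mul_zero, sub_zero]
          positivity
      refine hmono.trans ?_
      rw [integral_add (iA.const_mul η).integrableOn ((hGs.1.const_mul CY).const_mul _).integrableOn,
        integral_const_mul, integral_const_mul, integral_const_mul]
      have : ∫ x in Ω \ Γ, fG k p' (α+p') σ h s x ≤ C0 :=
        (setIntegral_le_integral hGs.1 (Eventually.of_forall (fG_nonneg k p' (α+p') σ h hs))).trans hGs.2
      gcongr)
  have hae : ∀ᵐ x ∂(volume.restrict (Ω \ Γ)), u x ^ p * fPhi α k n σ h r1 s1 x = 0 := by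
    have := (integral_eq_zero_iff_of_nonneg_ae (by
      filter_upwards [hu0W] with x hx
      exact mul_nonneg (Real.rpow_nonneg hx p) (fPhi_nonneg _ _ _ _ _ _ _ _)) (hFint s1 hs1).integrableOn).1 hzero
    filter_upwards [this] with x hx using hx
  rw [ae_restrict_iff' hWm] at hae
  have hsub : {x | 0 < fPhi α k n σ h r1 s1 x} ⊆ Ω \ Γ := by
    intro x hx
    exact (htest s1 hs1).2.2 (subset_closure (ne_of_gt hx))
  refine ⟨{x | 0 < fPhi α k n σ h r1 s1 x}, isOpen_lt continuous_const (htest s1 hs1).1.continuous,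
    ⟨x0, ?_, ?_⟩, ?_⟩
  · exact hsub (hx0.trans_le (fPhi_mono _ _ _ _ _ _ hs1 hs10 x0))
  · exact hx0.trans_le (fPhi_mono _ _ _ _ _ _ hs1 hs10 x0)
  · filter_upwards [hae, hu0] with x h1 h2 hx
    have h3 := h1 (hsub hx)
    have h4 := h2 (hsub hx)
    rcases mul_eq_zero.1 h3 with h5 | h5
    · exact ((Real.rpow_eq_zero_iff_of_nonneg h4).1 h5).1
    · exact absurd h5 (ne_of_gt hx)

/-- **Theorem 4.1.** Let `Γ` be a smooth closed `k`-dimensional submanifold of a smooth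
domain `Ω ⊆ ℝ^N`, `1 ≤ k < N - 2`, and let `q ∈ C²(Ω̄)` be nonnegative with
`max_Γ q = 1`. If `p ≥ (N-k+2)/(N-k-2)`, then there is no nontrivial nonnegative
distributional supersolution of `-Δu - ((N-k-2)²/4) δ⁻² q u ≥ uᵖ` on `Ω \\ Γ`. -/
theorem nonexistence_submanifold {N k : ℕ} (hN : 4 ≤ N) (hk1 : 1 ≤ k) (hk2 : k + 2 < N)
    (Γ Ω : Set (Euc N)) (hΓ : IsSmoothSubmanifold N k Γ)
    (hΩ : IsSmoothDomain Ω) (hΓΩ : Γ ⊆ Ω)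
    (q : Euc N → ℝ) (hq : ContDiffOn ℝ 2 q (closure Ω))
    (hq0 : ∀ x ∈ Ω, 0 ≤ q x)
    (hq1 : ∀ σ ∈ Γ, q σ ≤ 1) (hqmax : ∃ σ ∈ Γ, q σ = 1)
    (p : ℝ) (hp : ((N : ℝ) - k + 2) / ((N : ℝ) - k - 2) ≤ p) :
    ¬ ∃ u : Euc N → ℝ,
      (∀ᵐ x ∂volume, x ∈ Ω \ Γ → 0 ≤ u x) ∧
      ¬ (∀ᵐ x ∂volume, x ∈ Ω \ Γ → u x = 0) ∧
      LocallyIntegrableOn u (Ω \ Γ) volume ∧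
      LocallyIntegrableOn (fun x => u x ^ p) (Ω \ Γ) volume ∧
      LocallyIntegrableOn (fun x => (((N : ℝ) - k - 2) ^ 2 / 4) * distG Γ x ^ (-2 : ℝ) * q x * u x) (Ω \ Γ) volume ∧
      (∀ φ : Euc N → ℝ, IsTestFun (Ω \ Γ) φ → (∀ x, 0 ≤ φ x) →
        ∫ x in Ω \ Γ, u x ^ p * φ x ≤
          ∫ x in Ω \ Γ, u x * (-(lap φ x) - (((N : ℝ) - k - 2) ^ 2 / 4) * distG Γ x ^ (-2 : ℝ) * q x * φ x)) := by
  rintro ⟨u, hu0, hune, hu, hup, huV, hI⟩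
  have hkN : ((N - k : ℕ) : ℝ) = (N:ℝ) - k := by
    rw [Nat.cast_sub (by omega)]
  have h3 : (3:ℝ) ≤ (N:ℝ) - k := by
    rw [← hkN]; exact_mod_cast (by omega : 3 ≤ N - k)
  set α : ℝ := ((N:ℝ) - k - 2) / 2 with hαd
  have hα0 : 0 < α := by rw [hαd]; linarith
  have hα2 : ((N:ℝ) - k - 2) ^ 2 / 4 = α ^ 2 := by rw [hαd]; ring
  rw [hα2] at huV hI
  have hp' : (α + 2) ≤ p * α := by
    rw [div_le_iff₀ (by linarith)] at hp
    have e : (N:ℝ) - k - 2 = 2 * α := by rw [hαd]; ring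
    nlinarith
  have hp1 : 1 < p := by nlinarith
  have hpq : p.HolderConjugate (p / (p - 1)) := by
    have := Real.HolderConjugate.conjExponent hp1
    simpa [Real.conjExponent] using this
  have hpp : 2 * (p / (p - 1)) ≤ α + 2 := by
    rw [← mul_div_assoc, div_le_iff₀ (by linarith)]
    nlinarith
  have hΓc : IsClosed Γ := hΓ.1.isClosed
  have hW : IsOpen (Ω \ Γ) := hΩ.1.sdiff hΓc
  obtain ⟨O, hO, hne, h0⟩ := vanish (m := N - k) (by omega) hk1 (by omega) hΓ hΩ.1 hΓΩ hq hq0 hqmax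
    (α := α) (by rw [hkN, hαd]; ring) hpq hpp hu0 hu hup huV hI
  refine hune (smp_global hW (conn_diff hk2 hΓ hΩ.1 hΩ.2.2.1.isPreconnected) hu0 hu ?_ hO hne h0)
  intro φ hφ hφ0
  have i1 : Integrable (fun x => u x * lap φ x) volume :=
    integrable_mul_test hu (lap_cont hφ.1) (hφ.2.1.mono' (subset_closure.trans (lap_tsupport _)))
      ((lap_tsupport _).trans hφ.2.2)
  have i2 := integrable_mul_test huV hφ.1.continuous hφ.2.1 hφ.2.2
  have e1 : ∫ x in Ω \ Γ, u x * (-(lap φ x) - α ^ 2 * distG Γ x ^ (-2 : ℝ) * q x * φ x) =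
      (∫ x in Ω \ Γ, u x * (-(lap φ x))) -
        ∫ x in Ω \ Γ, α ^ 2 * distG Γ x ^ (-2 : ℝ) * q x * u x * φ x := by
    rw [← integral_sub]
    · congr 1
      ext x
      ring
    · have := i1.neg.integrableOn (s := Ω \ Γ)
      refine this.congr (Eventually.of_forall fun x => ?_)
      simp
    · exact i2.integrableOn
  have n1 : 0 ≤ ∫ x in Ω \ Γ, α ^ 2 * distG Γ x ^ (-2 : ℝ) * q x * u x * φ x := by
    apply setIntegral_nonneg_of_ae_restrict
    rw [EventuallyLE, ae_restrict_iff' hW.measurableSet]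
    filter_upwards [hu0] with x hx hxW
    have a1 := hx hxW
    have a2 := hq0 x hxW.1
    have a3 := hφ0 x
    have a4 : 0 ≤ distG Γ x := Metric.infDist_nonneg
    simp only [Pi.zero_apply]
    positivity
  have n2 : 0 ≤ ∫ x in Ω \ Γ, u x ^ p * φ x := by
    apply setIntegral_nonneg_of_ae_restrict
    rw [EventuallyLE, ae_restrict_iff' hW.measurableSet]
    filter_upwards [hu0] with x hx hxW
    have a1 := hx hxW
    have a3 := hφ0 x
    simp only [Pi.zero_apply]
    positivity
  have := hI φ hφ hφ0
  rw [e1] at this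
  linarith
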